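/- Let Φ be irreducible and not of type G₂, and let w ∈ W. Then w is fully commutative if and only if the subspace 𝔞_w = ⊕_{α∈Φ(w)} 𝔤_α is a spherical subspace of 𝔫, i.e. ad(x)⁴ = 0 for every x ∈ 𝔞_w. -/

import Mathlib

/- Background setup: a finite reduced crystallographic root system `Φ` with chosen
positive roots `Φ⁺` in a euclidean space `V`, the Cartan pairing, and the basic
combinatorial notions used in the statement. -/

open scoped RealInnerProductSpace

noncomputable section

variable {V : Type*} [NormedAddCommGroup V] [InnerProductSpace ℝ V]

/-- The Cartan pairing `⟨α, β⟩ = 2 (α, β) / (β, β)`. -/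
def cpair (α β : V) : ℝ := 2 * ⟪α, β⟫ / ⟪β, β⟫

/-- The reflection associated to `β`, as a linear endomorphism of `V`:
`v ↦ v - (2 (β, v)/(β, β)) • β`. -/
def reflEnd (β : V) : Module.End ℝ V :=
  LinearMap.id -
    (LinearMap.toSpanSingleton ℝ V β ∘ₗ ((2 / ⟪β, β⟫) • (innerSL ℝ β).toLinearMap))

/-- A subset of `V` is orthogonal if the Cartan pairing of any two distinct
elements vanishes. -/
def OrthogonalSet (S : Set V) : Prop := ∀ γ ∈ S, ∀ γ' ∈ S, γ ≠ γ' → cpair γ γ' = 0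

/-- A finite reduced crystallographic root system in the euclidean space `V`,
together with a choice of positive roots. -/
structure RootSystemData (V : Type*) [NormedAddCommGroup V] [InnerProductSpace ℝ V] where
  /-- the set of roots Φ -/
  roots : Set V
  /-- the set of positive roots Φ⁺ -/
  pos : Set V
  finite : roots.Finite
  ne_zero : ∀ α ∈ roots, α ≠ 0
  span_eq_top : Submodule.span ℝ roots = ⊤
  reduced : ∀ α ∈ roots, ∀ t : ℝ, t • α ∈ roots → t = 1 ∨ t = -1
  crystallographic : ∀ α ∈ roots, ∀ β ∈ roots, ∃ n : ℤ, cpair α β = (n : ℝ)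
  reflect_mem : ∀ α ∈ roots, ∀ β ∈ roots, reflEnd β α ∈ roots
  pos_subset : pos ⊆ roots
  pos_iff : ∀ α ∈ roots, (α ∈ pos ↔ ¬ (-α ∈ pos))
  pos_add : ∀ α ∈ pos, ∀ β ∈ pos, α + β ∈ roots → α + β ∈ pos

namespace RootSystemData

variable (D : RootSystemData V)

/-- Irreducibility: the roots admit no nontrivial partition into two mutually
orthogonal parts. -/
def IsIrreducible : Prop :=
  D.roots.Nonempty ∧
    ∀ s ⊆ D.roots, (∀ α ∈ s, ∀ β ∈ D.roots \ s, ⟪α, β⟫ = 0) → s = ∅ ∨ s = D.roots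

/-- An irreducible root system is not of type `G₂` iff no Cartan pairing of two
roots equals `±3`. -/
def NotG2 : Prop := ∀ α ∈ D.roots, ∀ β ∈ D.roots, cpair α β ≠ 3 ∧ cpair α β ≠ -3

/-- An irreducible root system is of type `G₂` iff some Cartan pairing of two
roots equals `±3`. -/
def IsG2 : Prop :=
  D.IsIrreducible ∧ ∃ α ∈ D.roots, ∃ β ∈ D.roots, cpair α β = 3 ∨ cpair α β = -3

/-- All roots have the same length (types A, D, E). -/
def SimplyLaced : Prop := ∀ α ∈ D.roots, ∀ β ∈ D.roots, ⟪α, α⟫ = ⟪β, β⟫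

/-- There are exactly two root lengths, with squared-length ratio 2
(types B, C, F₄). -/
def DoublyLaced : Prop :=
  (∃ α ∈ D.roots, ∃ β ∈ D.roots, ⟪β, β⟫ = 2 * ⟪α, α⟫) ∧
    ∀ α ∈ D.roots, ∀ β ∈ D.roots,
      ⟪α, α⟫ = ⟪β, β⟫ ∨ ⟪β, β⟫ = 2 * ⟪α, α⟫ ∨ ⟪α, α⟫ = 2 * ⟪β, β⟫

/-- A root of maximal length. -/
def IsLong (α : V) : Prop := α ∈ D.roots ∧ ∀ β ∈ D.roots, ⟪β, β⟫ ≤ ⟪α, α⟫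

/-- A root of minimal length. -/
def IsShort (α : V) : Prop := α ∈ D.roots ∧ ∀ β ∈ D.roots, ⟪α, α⟫ ≤ ⟪β, β⟫

/-- A set of positive roots is convex if any root which is a linear combination of
two of its elements with positive coefficients lies in it. -/
def ConvexSubset (S : Set V) : Prop :=
  ∀ α ∈ S, ∀ β ∈ S, ∀ a b : ℝ, 0 < a → 0 < b →
    a • α + b • β ∈ D.roots → a • α + b • β ∈ S

/-- A subset `Ψ ⊆ Φ⁺` is biconvex if both `Ψ` and `Φ⁺ \ Ψ` are convex. -/
def Biconvex (S : Set V) : Prop :=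
  S ⊆ D.pos ∧ D.ConvexSubset S ∧ D.ConvexSubset (D.pos \ S)

/-- A subset `Ψ ⊆ Φ⁺` is a combinatorial ideal if `α ∈ Ψ`, `β ∈ Φ⁺`, `α + β ∈ Φ⁺`
imply `α + β ∈ Ψ`. -/
def CombIdeal (S : Set V) : Prop :=
  S ⊆ D.pos ∧ ∀ α ∈ S, ∀ β ∈ D.pos, α + β ∈ D.pos → α + β ∈ S

end RootSystemData

/- The Weyl group: words in the simple reflections, reduced expressions, length,
inversion sets, and the (fully) commutative elements. -/

/-- The product of the reflections attached to a word (a list of roots). -/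
def wordProd (l : List V) : Module.End ℝ V := (l.map reflEnd).prod

/-- The alternating word `[α, β, α, β, ...]` of length `n`. -/
def altWord (α β : V) : ℕ → List V
  | 0 => []
  | n + 1 => α :: altWord β α n

namespace RootSystemData

variable (D : RootSystemData V)

/-- The simple roots: the positive roots which are not sums of two positive
roots. -/
def simpleRoots : Set V :=
  {α | α ∈ D.pos ∧ ¬ ∃ β ∈ D.pos, ∃ γ ∈ D.pos, α = β + γ}

/-- A word in the simple reflections, encoded as a list of simple roots. -/
def IsWord (l : List V) : Prop := ∀ α ∈ l, α ∈ D.simpleRoots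

/-- Membership in the Weyl group: `w` is a product of simple reflections. -/
def InWeyl (w : Module.End ℝ V) : Prop := ∃ l : List V, D.IsWord l ∧ wordProd l = w

/-- A reduced word: a word of minimal length among all words with the same
product. -/
def IsReducedWord (l : List V) : Prop :=
  D.IsWord l ∧
    ∀ l' : List V, D.IsWord l' → wordProd l' = wordProd l → l.length ≤ l'.length

/-- The length of a Weyl group element. -/
noncomputable def len (w : Module.End ℝ V) : ℕ :=
  sInf {n | ∃ l : List V, D.IsWord l ∧ wordProd l = w ∧ l.length = n}

/-- The inversion set `Φ(w) = {α ∈ Φ⁺ | w(α) ∈ Φ⁻}`. -/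
def inversions (w : Module.End ℝ V) : Set V :=
  {α | α ∈ D.pos ∧ w α ∈ D.roots ∧ w α ∉ D.pos}

/-- `w` is fully commutative: no reduced expression for `w` contains a contiguous
substring `s_α s_β s_α s_β ⋯` of length `m(s_α, s_β)`, where `s_α, s_β` are
non-commuting simple reflections and `m(s_α, s_β)` is the order of `s_α s_β`. -/
def FullyCommutative (w : Module.End ℝ V) : Prop :=
  D.InWeyl w ∧
    ∀ l : List V, D.IsReducedWord l → wordProd l = w →
      ∀ α ∈ D.simpleRoots, ∀ β ∈ D.simpleRoots,
        ¬ Commute (reflEnd α) (reflEnd β) →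
          ¬ (altWord α β (orderOf (reflEnd α * reflEnd β)) <:+: l)

/-- `w` is commutative: no reduced expression for `w` contains a substring
`s_α s_β s_α` with `α, β` simple and `‖α‖ ≤ ‖β‖`. -/
def Commutative (w : Module.End ℝ V) : Prop :=
  D.InWeyl w ∧
    ∀ l : List V, D.IsReducedWord l → wordProd l = w →
      ∀ α ∈ D.simpleRoots, ∀ β ∈ D.simpleRoots, ‖α‖ ≤ ‖β‖ →
        ¬ ([α, β, α] <:+: l)

end RootSystemData

/- The Lie-theoretic setup: a finite-dimensional complex simple Lie algebra `𝔤`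
with Cartan subalgebra `𝔱`, whose root space decomposition is indexed by the
root system `Φ ⊆ V`. -/

/-- A finite-dimensional simple complex Lie algebra `L`, together with a Cartan
subalgebra and its root space decomposition, whose root system is `Φ ⊆ V` with a
choice of positive roots (determining the Borel subalgebra `𝔟 = 𝔱 ⊕ 𝔫`). -/
structure LieRootData (V : Type*) [NormedAddCommGroup V] [InnerProductSpace ℝ V]
    (L : Type*) [LieRing L] [LieAlgebra ℂ L] extends RootSystemData V where
  /-- the Cartan subalgebra 𝔱 -/
  cartan : LieSubalgebra ℂ L
  /-- the root space 𝔤_α attached to each root α -/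
  rs : V → Submodule ℂ L
  finiteDim : FiniteDimensional ℂ L
  isSimple : LieAlgebra.IsSimple ℂ L
  isCartan : cartan.IsCartanSubalgebra
  rs_dim : ∀ α ∈ roots, Module.finrank ℂ (rs α) = 1
  sup_eq_top : cartan.toSubmodule ⊔ (⨆ α ∈ roots, rs α) = ⊤
  indep : ∀ α ∈ roots, rs α ⊓ (cartan.toSubmodule ⊔ ⨆ β ∈ roots \ {α}, rs β) = ⊥
  weight_vec : ∀ α ∈ roots, ∀ h ∈ cartan, ∀ x ∈ rs α, ∃ c : ℂ, ⁅h, x⁆ = c • x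
  bracket_mem : ∀ α ∈ roots, ∀ β ∈ roots, α + β ∈ roots →
    ∀ x ∈ rs α, ∀ y ∈ rs β, ⁅x, y⁆ ∈ rs (α + β)
  bracket_ne_zero : ∀ α ∈ roots, ∀ β ∈ roots, α + β ∈ roots →
    ∀ x ∈ rs α, x ≠ 0 → ∀ y ∈ rs β, y ≠ 0 → ⁅x, y⁆ ≠ 0
  bracket_eq_zero : ∀ α ∈ roots, ∀ β ∈ roots, α + β ∉ roots → α + β ≠ 0 →
    ∀ x ∈ rs α, ∀ y ∈ rs β, ⁅x, y⁆ = 0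
  bracket_cartan_mem : ∀ α ∈ roots, ∀ x ∈ rs α, ∀ y ∈ rs (-α), ⁅x, y⁆ ∈ cartan

namespace LieRootData

variable {L : Type*} [LieRing L] [LieAlgebra ℂ L] (D : LieRootData V L)

/-- The nilradical `𝔫 = ⊕_{α ∈ Φ⁺} 𝔤_α` of the Borel subalgebra, as a submodule. -/
def nilrad : Submodule ℂ L := ⨆ α ∈ D.pos, D.rs α

/-- The Borel subalgebra `𝔟 = 𝔱 ⊕ 𝔫`, as a submodule. -/
def borel : Submodule ℂ L := D.cartan.toSubmodule ⊔ D.nilrad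

/-- The subspace `𝔞_Ψ = ⊕_{α ∈ Ψ} 𝔤_α` attached to a subset `Ψ ⊆ Φ⁺`. -/
def aSubspace (S : Set V) : Submodule ℂ L := ⨆ α ∈ S, D.rs α

end LieRootData

/-- A subspace of `𝔫` is spherical if `ad(x)^4 = 0` for every `x` in it. -/
def IsSphericalSubspace {L : Type*} [LieRing L] [LieAlgebra ℂ L]
    (a : Submodule ℂ L) : Prop :=
  ∀ x ∈ a, (LieAlgebra.ad ℂ L x) ^ 4 = 0

/-- The height of a nilpotent element `x`: `max {n | ad(x)^n ≠ 0}`. -/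
noncomputable def heightOf {L : Type*} [LieRing L] [LieAlgebra ℂ L] (x : L) : ℕ :=
  sSup {n : ℕ | (LieAlgebra.ad ℂ L x) ^ n ≠ 0}




lemma refl_apply (β v : V) : reflEnd β v = v - cpair v β • β := by
  simp only [reflEnd, cpair, LinearMap.sub_apply, LinearMap.id_apply, LinearMap.comp_apply,
    LinearMap.smul_apply, LinearMap.toSpanSingleton_apply, ContinuousLinearMap.coe_coe,
    innerSL_apply_apply, smul_eq_mul]
  rw [real_inner_comm β v]
  congr 2
  ring

lemma cpair_mul {β : V} (hβ : β ≠ 0) (v : V) : cpair v β * ⟪β, β⟫ = 2 * ⟪v, β⟫ := by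
  have : ⟪β, β⟫ ≠ 0 := inner_self_ne_zero.mpr hβ
  simp only [cpair]; field_simp

lemma inner_refl_left (β x y : V) : ⟪reflEnd β x, y⟫ = ⟪x, y⟫ - 2 * ⟪x, β⟫ * ⟪β, y⟫ / ⟪β, β⟫ := by
  rw [refl_apply, inner_sub_left, inner_smul_left]
  simp only [cpair, RCLike.conj_to_real]; ring

lemma inner_refl_comm (β x y : V) : ⟪reflEnd β x, y⟫ = ⟪x, reflEnd β y⟫ := by
  rw [inner_refl_left, real_inner_comm (reflEnd β y) x, inner_refl_left, real_inner_comm x y,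
    real_inner_comm β x, real_inner_comm β y]; ring

lemma refl_refl (β x : V) : reflEnd β (reflEnd β x) = x := by
  by_cases hβ : β = 0
  · subst hβ; simp [refl_apply]
  · have h := inner_self_ne_zero (𝕜 := ℝ) |>.mpr hβ
    have : cpair (reflEnd β x) β = - cpair x β := by
      have := inner_refl_left β x β
      unfold cpair
      rw [this]; field_simp; ring
    rw [refl_apply, this, refl_apply]; simp

lemma inner_refl_refl (β x y : V) : ⟪reflEnd β x, reflEnd β y⟫ = ⟪x, y⟫ := by
  rw [inner_refl_comm, refl_refl]

lemma refl_mul_self (β : V) : reflEnd β * reflEnd β = 1 := by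
  ext x; exact refl_refl β x

lemma refl_self (β : V) : reflEnd β β = -β := by
  by_cases hβ : β = 0
  · subst hβ; simp
  · have h := inner_self_ne_zero (𝕜 := ℝ) |>.mpr hβ
    rw [refl_apply]
    have : cpair β β = 2 := by unfold cpair; field_simp
    rw [this, two_smul]; abel

lemma refl_of_orth {β x : V} (h : ⟪x, β⟫ = 0) : reflEnd β x = x := by
  rw [refl_apply, cpair, h]; simp

lemma refl_of_cpair {β x : V} {c : ℝ} (h : cpair x β = c) : reflEnd β x = x - c • β := by
  rw [refl_apply, h]

namespace RootSystemData

variable (D : RootSystemData V)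

lemma inner_pos {α : V} (h : α ∈ D.roots) : 0 < ⟪α, α⟫ :=
  real_inner_self_pos.mpr (D.ne_zero α h)

lemma neg_mem {α : V} (h : α ∈ D.roots) : -α ∈ D.roots := by
  have := D.reflect_mem α h α h
  rwa [refl_self] at this

lemma zero_not_mem : (0 : V) ∉ D.roots := fun h => D.ne_zero 0 h rfl

lemma neg_mem_iff {α : V} : -α ∈ D.roots ↔ α ∈ D.roots :=
  ⟨fun h => by simpa using D.neg_mem h, D.neg_mem⟩

/-- Cauchy–Schwarz is strict for non-proportional roots. -/
lemma cs_lt {α β : V} (ha : α ∈ D.roots) (hb : β ∈ D.roots) (h1 : α ≠ β) (h2 : α ≠ -β) :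
    ⟪α, β⟫ * ⟪α, β⟫ < ⟪α, α⟫ * ⟪β, β⟫ := by
  have hbp := D.inner_pos hb
  by_contra hcon
  push Not at hcon
  set t := ⟪α, β⟫ / ⟪β, β⟫ with ht
  have htb : t * ⟪β, β⟫ = ⟪α, β⟫ := by rw [ht]; field_simp
  have hz : ⟪α - t • β, α - t • β⟫ ≤ 0 := by
    simp only [inner_sub_left, inner_sub_right, inner_smul_left, inner_smul_right,
      RCLike.conj_to_real]
    rw [real_inner_comm α β]
    have : ⟪α, α⟫ * ⟪β, β⟫ - t * ⟪α, β⟫ * ⟪β, β⟫ ≤ 0 := by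
      rw [mul_right_comm, htb]; linarith
    have h3 : ⟪α, α⟫ - t * ⟪α, β⟫ ≤ 0 := by
      by_contra h4; push Not at h4; nlinarith [mul_pos h4 hbp]
    nlinarith
  have hz' : α - t • β = 0 := by
    rw [← inner_self_eq_zero (𝕜 := ℝ)]
    exact le_antisymm hz real_inner_self_nonneg
  have hα : α = t • β := sub_eq_zero.mp hz'
  rcases D.reduced β hb t (hα ▸ ha) with h | h
  · rw [h, one_smul] at hα; exact h1 hα
  · rw [h, neg_smul, one_smul] at hα; exact h2 hα

/-- The possible pairs of Cartan integers. -/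
lemma cpair_cases (hG : D.NotG2) {α β : V} (ha : α ∈ D.roots) (hb : β ∈ D.roots)
    (h1 : α ≠ β) (h2 : α ≠ -β) :
    (⟪α, β⟫ = 0 ∧ cpair α β = 0 ∧ cpair β α = 0) ∨
    (0 < ⟪α, β⟫ ∧ ((cpair α β = 1 ∧ cpair β α = 1) ∨ (cpair α β = 1 ∧ cpair β α = 2) ∨
      (cpair α β = 2 ∧ cpair β α = 1))) ∨
    (⟪α, β⟫ < 0 ∧ ((cpair α β = -1 ∧ cpair β α = -1) ∨ (cpair α β = -1 ∧ cpair β α = -2) ∨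
      (cpair α β = -2 ∧ cpair β α = -1))) := by
  have hcs := D.cs_lt ha hb h1 h2
  have hap := D.inner_pos ha
  have hbp := D.inner_pos hb
  obtain ⟨m, hm⟩ := D.crystallographic α ha β hb
  obtain ⟨n, hn⟩ := D.crystallographic β hb α ha
  have e1 := cpair_mul (D.ne_zero β hb) α
  have e2 := cpair_mul (D.ne_zero α ha) β
  rw [real_inner_comm α β] at e2
  have g1 := hG α ha β hb
  have g2 := hG β hb α ha
  rw [hm] at g1 e1
  rw [hn] at g2 e2
  rw [hm, hn]
  have hmn : (m : ℝ) * n < 4 := by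
    by_contra hc; push Not at hc
    have : (m * n : ℝ) * (⟪α, α⟫ * ⟪β, β⟫) = 4 * (⟪α, β⟫ * ⟪α, β⟫) := by
      calc _ = (m * ⟪β, β⟫) * (n * ⟪α, α⟫) := by ring
        _ = _ := by rw [e1, e2]; ring
    nlinarith [mul_pos hap hbp]
  have hmn' : m * n < 4 := by exact_mod_cast hmn
  have g1a : m ≠ 3 := by rintro rfl; exact g1.1 (by norm_num)
  have g1b : m ≠ -3 := by rintro rfl; exact g1.2 (by norm_num)
  have g2a : n ≠ 3 := by rintro rfl; exact g2.1 (by norm_num)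
  have g2b : n ≠ -3 := by rintro rfl; exact g2.2 (by norm_num)
  rcases lt_trichotomy ⟪α, β⟫ 0 with h | h | h
  · right; right
    have hm0 : m < 0 := by
      by_contra hc; push Not at hc
      have : (0 : ℝ) ≤ m := by exact_mod_cast hc
      nlinarith [mul_nonneg this hbp.le]
    have hn0 : n < 0 := by
      by_contra hc; push Not at hc
      have : (0 : ℝ) ≤ n := by exact_mod_cast hc
      nlinarith [mul_nonneg this hap.le]
    refine ⟨h, ?_⟩
    have : -3 ≤ m := by nlinarith
    have : -3 ≤ n := by nlinarith
    interval_cases m <;> interval_cases n <;> simp_all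
  · left
    rw [h] at e1 e2
    refine ⟨h, ?_, ?_⟩
    · simpa [D.ne_zero β hb] using e1
    · simpa [D.ne_zero α ha] using e2
  · right; left
    have hm0 : 0 < m := by
      by_contra hc; push Not at hc
      have : (m : ℝ) ≤ 0 := by exact_mod_cast hc
      nlinarith [mul_nonneg (neg_nonneg.mpr this) hbp.le]
    have hn0 : 0 < n := by
      by_contra hc; push Not at hc
      have : (n : ℝ) ≤ 0 := by exact_mod_cast hc
      nlinarith [mul_nonneg (neg_nonneg.mpr this) hap.le]
    refine ⟨h, ?_⟩
    have : m ≤ 3 := by nlinarith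
    have : n ≤ 3 := by nlinarith
    interval_cases m <;> interval_cases n <;> simp_all

lemma sub_mem (hG : D.NotG2) {α β : V} (ha : α ∈ D.roots) (hb : β ∈ D.roots)
    (h1 : α ≠ β) (h : 0 < ⟪α, β⟫) : α - β ∈ D.roots := by
  have h2 : α ≠ -β := by
    rintro rfl; rw [inner_neg_left] at h; linarith [D.inner_pos hb]
  have hs : cpair α β = 1 ∨ cpair β α = 1 := by
    rcases D.cpair_cases hG ha hb h1 h2 with h' | ⟨-, h'⟩ | h'
    · linarith [h'.1]
    · tauto
    · linarith [h'.1]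
  rcases hs with h' | h'
  · have := D.reflect_mem α ha β hb
    rwa [refl_of_cpair h', one_smul] at this
  · have := D.neg_mem (D.reflect_mem β hb α ha)
    rwa [refl_of_cpair h', one_smul, neg_sub] at this

lemma add_mem (hG : D.NotG2) {α β : V} (ha : α ∈ D.roots) (hb : β ∈ D.roots)
    (h1 : α ≠ -β) (h : ⟪α, β⟫ < 0) : α + β ∈ D.roots := by
  have := D.sub_mem hG ha (D.neg_mem hb) h1 (by rw [inner_neg_right]; linarith)
  simpa using this

/-! Lengths in an irreducible root system. -/

lemma ratio_of_ne (hG : D.NotG2) {α β : V} (ha : α ∈ D.roots) (hb : β ∈ D.roots)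
    (h : ⟪α, β⟫ ≠ 0) :
    ⟪α, α⟫ = ⟪β, β⟫ ∨ ⟪β, β⟫ = 2 * ⟪α, α⟫ ∨ ⟪α, α⟫ = 2 * ⟪β, β⟫ := by
  by_cases h1 : α = β
  · left; rw [h1]
  by_cases h2 : α = -β
  · left; rw [h2]; simp
  have e1 := cpair_mul (D.ne_zero β hb) α
  have e2 := cpair_mul (D.ne_zero α ha) β
  rw [real_inner_comm α β] at e2
  rcases D.cpair_cases hG ha hb h1 h2 with h' | ⟨-, h' | h' | h'⟩ | ⟨-, h' | h' | h'⟩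
  · exact absurd h'.1 h
  all_goals rw [h'.1] at e1; rw [h'.2] at e2
  · left; linarith
  · right; left; linarith
  · right; right; linarith
  · left; linarith
  · right; left; linarith
  · right; right; linarith

lemma ratio (hG : D.NotG2) (hI : D.IsIrreducible) {α β : V} (ha : α ∈ D.roots)
    (hb : β ∈ D.roots) :
    ⟪α, α⟫ = ⟪β, β⟫ ∨ ⟪β, β⟫ = 2 * ⟪α, α⟫ ∨ ⟪α, α⟫ = 2 * ⟪β, β⟫ := by
  let U : Set V := {b | b ∈ D.roots ∧ ∃ γ ∈ D.roots, ⟪γ, γ⟫ = ⟪α, α⟫ ∧ ⟪γ, b⟫ ≠ 0}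
  have hU : U = D.roots := by
    have key : ∀ α ∈ U, ∀ β ∈ D.roots \ U, ⟪α, β⟫ = 0 := by
      rintro b ⟨hb, γ, hγ, hn, hne⟩ b' ⟨hb', hb'U⟩
      by_contra hne'
      apply hb'U
      by_cases h0 : ⟪γ, b'⟫ = 0
      · refine ⟨hb', reflEnd b γ, D.reflect_mem γ hγ b hb, ?_, ?_⟩
        · rw [inner_refl_refl, hn]
        · rw [inner_refl_left, h0]
          have := (D.inner_pos hb).ne'
          simp [hne, hne', D.ne_zero b hb]
      · exact ⟨hb', γ, hγ, hn, h0⟩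
    rcases hI.2 U (fun b hb => hb.1) key with h | h
    · exfalso
      have : α ∈ U := ⟨ha, α, ha, rfl, (D.inner_pos ha).ne'⟩
      rw [h] at this; exact this
    · exact h
  have : β ∈ U := by rw [hU]; exact hb
  obtain ⟨-, γ, hγ, hn, hne⟩ := this
  have := D.ratio_of_ne hG hγ hb hne
  rwa [hn] at this

lemma exists_scale (hG : D.NotG2) (hI : D.IsIrreducible) :
    ∃ N : ℝ, 0 < N ∧ ∀ α ∈ D.roots, ⟪α, α⟫ = N ∨ ⟪α, α⟫ = 2 * N := by
  obtain ⟨μ, hμ, hmin⟩ := D.finite.exists_minimalFor (fun x : V => ⟪x, x⟫) D.roots hI.1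
  refine ⟨⟪μ, μ⟫, D.inner_pos hμ, fun α ha => ?_⟩
  have hp := D.inner_pos hμ
  rcases D.ratio hG hI ha hμ with h | h | h
  · left; exact h
  · have hp2 := D.inner_pos ha
    have := hmin ha (by simp only; linarith)
    simp only at this
    linarith
  · right; exact h

end RootSystemData



namespace RootSystemData

variable (D : RootSystemData V)

lemma pos_neg {α : V} (h : α ∈ D.pos) : -α ∉ D.pos :=
  (D.pos_iff α (D.pos_subset h)).mp h

lemma neg_pos_of {α : V} (hr : α ∈ D.roots) (h : α ∉ D.pos) : -α ∈ D.pos := by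
  by_contra hc; exact h ((D.pos_iff α hr).mpr hc)

lemma pos_ne_neg {α β : V} (ha : α ∈ D.pos) (hb : β ∈ D.pos) : α ≠ -β := by
  rintro rfl; exact D.pos_neg hb ha

lemma list_sum_ne_zero (hG : D.NotG2) : ∀ (n : ℕ) (l : List V), l.length = n →
    (∀ x ∈ l, x ∈ D.pos) → l ≠ [] → l.sum ≠ 0 := by
  intro n
  induction n using Nat.strong_induction_on with
  | _ n ih =>
  intro l hl hpos hne hsum
  cases l with
  | nil => exact hne rfl
  | cons a t =>
    have ha : a ∈ D.pos := hpos a (by simp)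
    have har := D.pos_subset ha
    rw [List.sum_cons] at hsum
    have hneg : ⟪a, t.sum⟫ < 0 := by
      have : t.sum = -a := (neg_eq_of_add_eq_zero_right hsum).symm
      rw [this, inner_neg_right]; linarith [D.inner_pos har]
    have hex : ∃ b ∈ t, ⟪a, b⟫ < 0 := by
      by_contra hc; push Not at hc
      have : ∀ t : List V, (∀ b ∈ t, 0 ≤ ⟪a, b⟫) → 0 ≤ ⟪a, t.sum⟫ := by
        intro t
        induction t with
        | nil => simp
        | cons b t ih2 =>
          intro h
          rw [List.sum_cons, inner_add_right]
          have h1 := h b (by simp)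
          have h2 := ih2 (fun c hc => h c (by simp [hc]))
          linarith
      linarith [this t hc]
    obtain ⟨b, hbt, hab⟩ := hex
    classical
    have hb : b ∈ D.pos := hpos b (by simp [hbt])
    have hper := List.perm_cons_erase hbt
    have hmem : a + b ∈ D.pos := D.pos_add a ha b hb
      (D.add_mem hG har (D.pos_subset hb) (D.pos_ne_neg ha hb) hab)
    refine ih ((a + b) :: t.erase b).length ?_ ((a + b) :: t.erase b) rfl ?_ (by simp) ?_
    · have := hper.length_eq
      simp only [List.length_cons] at this hl ⊢
      omega
    · intro x hx
      rcases List.mem_cons.mp hx with rfl | hx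
      · exact hmem
      · exact hpos x (by simp [List.mem_of_mem_erase hx])
    · have := hper.sum_eq
      rw [List.sum_cons] at this ⊢
      rw [add_assoc, ← this, hsum]

lemma simple_pos {α : V} (h : α ∈ D.simpleRoots) : α ∈ D.pos := h.1

lemma simple_root {α : V} (h : α ∈ D.simpleRoots) : α ∈ D.roots := D.pos_subset h.1

lemma simple_inner (hG : D.NotG2) {α β : V} (ha : α ∈ D.simpleRoots) (hb : β ∈ D.simpleRoots)
    (hne : α ≠ β) : ⟪α, β⟫ ≤ 0 := by
  by_contra hc
  push Not at hc
  have h := D.sub_mem hG (D.simple_root ha) (D.simple_root hb) hne hc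
  by_cases hp : α - β ∈ D.pos
  · exact ha.2 ⟨α - β, hp, β, hb.1, by abel⟩
  · exact hb.2 ⟨-(α - β), D.neg_pos_of h hp, α, ha.1, by abel⟩

/-- A simple reflection permutes the other positive roots. -/
lemma simple_refl_pos (hG : D.NotG2) {α β : V} (ha : α ∈ D.simpleRoots) (hb : β ∈ D.pos)
    (hne : β ≠ α) : reflEnd α β ∈ D.pos := by
  have har := D.simple_root ha
  have hbr := D.pos_subset hb
  have hne2 := D.pos_ne_neg hb ha.1
  have hm := D.reflect_mem β hbr α har
  rcases D.cpair_cases hG hbr har hne hne2 with h | ⟨h, hc⟩ | ⟨h, hc⟩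
  · rwa [refl_of_orth h.1]
  · have hsub := D.sub_mem hG hbr har hne h
    have hsubp : β - α ∈ D.pos := by
      by_contra hp
      exact ha.2 ⟨-(β - α), D.neg_pos_of hsub hp, β, hb, by abel⟩
    have hc' : cpair β α = 1 ∨ cpair β α = 2 := by tauto
    rcases hc' with hc | hc
    · rw [refl_of_cpair hc, one_smul]; exact hsubp
    · rw [refl_of_cpair hc] at hm ⊢
      by_contra hp
      exact ha.2 ⟨-(β - (2 : ℝ) • α), D.neg_pos_of hm hp, β - α, hsubp, by rw [two_smul]; abel⟩
  · have hadd := D.pos_add β hb α ha.1 (D.add_mem hG hbr har hne2 h)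
    have hc' : cpair β α = -1 ∨ cpair β α = -2 := by tauto
    rcases hc' with hc | hc
    · rw [refl_of_cpair hc, neg_smul, one_smul, sub_neg_eq_add]; exact hadd
    · have e : reflEnd α β = (β + α) + α := by
        rw [refl_of_cpair hc, neg_smul, two_smul]; abel
      rw [e] at hm ⊢
      exact D.pos_add _ hadd _ ha.1 hm

def posF : Finset V := (D.finite.subset D.pos_subset).toFinset

lemma mem_posF {α : V} : α ∈ D.posF ↔ α ∈ D.pos := by simp [posF]

def twoRho : V := ∑ α ∈ D.posF, α

/-- The height functional. -/
def ht : V →ₗ[ℝ] ℝ := (innerSL ℝ D.twoRho).toLinearMap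

lemma ht_apply (v : V) : D.ht v = ⟪D.twoRho, v⟫ := by simp [ht]

lemma ht_simple (hG : D.NotG2) {α : V} (ha : α ∈ D.simpleRoots) : 0 < D.ht α := by
  classical
  have hmem : α ∈ D.posF := D.mem_posF.mpr ha.1
  have h1 : D.twoRho = α + ∑ β ∈ D.posF.erase α, β := (Finset.add_sum_erase _ _ hmem).symm
  have h2 : reflEnd α (∑ β ∈ D.posF.erase α, β) = ∑ β ∈ D.posF.erase α, β := by
    rw [map_sum]
    refine Finset.sum_nbij' (reflEnd α) (reflEnd α) ?_ ?_ ?_ ?_ ?_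
    · intro b hb
      rw [Finset.mem_erase, mem_posF] at hb ⊢
      refine ⟨?_, D.simple_refl_pos hG ha hb.2 hb.1⟩
      intro h
      have : b = -α := by rw [← refl_refl α b, h, refl_self]
      exact D.pos_ne_neg hb.2 ha.1 this
    · intro b hb
      rw [Finset.mem_erase, mem_posF] at hb ⊢
      refine ⟨?_, D.simple_refl_pos hG ha hb.2 hb.1⟩
      intro h
      have : b = -α := by rw [← refl_refl α b, h, refl_self]
      exact D.pos_ne_neg hb.2 ha.1 this
    · intro b _; exact refl_refl α b
    · intro b _; exact refl_refl α b
    · intro b _; rfl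
  have h3 : ⟪∑ β ∈ D.posF.erase α, β, α⟫ = 0 := by
    have := inner_refl_comm α (∑ β ∈ D.posF.erase α, β) α
    rw [h2, refl_self, inner_neg_right] at this
    linarith
  rw [ht_apply, h1, inner_add_left, h3, add_zero]
  exact D.inner_pos (D.simple_root ha)

lemma ht_pos (hG : D.NotG2) {α : V} (ha : α ∈ D.pos) : 0 < D.ht α := by
  let r : V → V → Prop := fun x y => ∃ l : List V, l ≠ [] ∧ (∀ z ∈ l, z ∈ D.pos) ∧ y = x + l.sum
  have hirr : Std.Irrefl r := ⟨by
    rintro x ⟨l, hne, hl, h⟩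
    exact D.list_sum_ne_zero hG _ l rfl hl hne (by simpa using h)⟩
  have htr : IsTrans V r := ⟨by
    rintro x y z ⟨l, hne, hl, h⟩ ⟨l', hne', hl', h'⟩
    refine ⟨l ++ l', by simp [hne], ?_, ?_⟩
    · intro z hz
      rcases List.mem_append.mp hz with hz | hz
      · exact hl z hz
      · exact hl' z hz
    · rw [h', h, List.sum_append]; abel⟩
  have hso : IsStrictOrder V r := {}
  have hwf : D.pos.WellFoundedOn r := (D.finite.subset D.pos_subset).wellFoundedOn
  refine hwf.induction (P := fun x => 0 < D.ht x) ha ?_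
  intro x hx ih
  by_cases hs : x ∈ D.simpleRoots
  · exact D.ht_simple hG hs
  · have : ∃ β ∈ D.pos, ∃ γ ∈ D.pos, x = β + γ := by
      by_contra hc; exact hs ⟨hx, hc⟩
    obtain ⟨b, hb, c, hc, h⟩ := this
    have h1 := ih b hb ⟨[c], by simp, by simpa using hc, by simpa using h⟩
    have h2 := ih c hc ⟨[b], by simp, by simpa using hb, by simp [h, add_comm]⟩
    rw [h, map_add]; linarith

lemma mem_pos_iff (hG : D.NotG2) {α : V} (ha : α ∈ D.roots) : α ∈ D.pos ↔ 0 < D.ht α := by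
  constructor
  · exact D.ht_pos hG
  · intro h
    by_contra hc
    have := D.ht_pos hG (D.neg_pos_of ha hc)
    rw [map_neg] at this; linarith

lemma not_mem_pos_iff (hG : D.NotG2) {α : V} (ha : α ∈ D.roots) : α ∉ D.pos ↔ D.ht α < 0 := by
  constructor
  · intro h
    have := D.ht_pos hG (D.neg_pos_of ha h)
    rw [map_neg] at this; linarith
  · intro h hc
    linarith [D.ht_pos hG hc]

end RootSystemData



lemma wordProd_nil : wordProd ([] : List V) = 1 := rfl

lemma wordProd_cons (α : V) (l : List V) : wordProd (α :: l) = reflEnd α * wordProd l := by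
  simp [wordProd]

lemma wordProd_append (l l' : List V) : wordProd (l ++ l') = wordProd l * wordProd l' := by
  simp [wordProd]

lemma wordProd_singleton (α : V) : wordProd [α] = reflEnd α := by simp [wordProd]

lemma wordProd_mul_reverse (l : List V) : wordProd l * wordProd l.reverse = 1 := by
  induction l with
  | nil => simp [wordProd]
  | cons a t ih =>
    rw [List.reverse_cons, wordProd_append, wordProd_cons, wordProd_singleton]
    calc _ = reflEnd a * (wordProd t * wordProd t.reverse) * reflEnd a := by noncomm_ring
      _ = 1 := by rw [ih, mul_one, refl_mul_self]

lemma wordProd_reverse_mul (l : List V) : wordProd l.reverse * wordProd l = 1 := by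
  have := wordProd_mul_reverse l.reverse
  rwa [List.reverse_reverse] at this

lemma inner_wordProd (l : List V) (x y : V) : ⟪wordProd l x, wordProd l y⟫ = ⟪x, y⟫ := by
  induction l with
  | nil => simp [wordProd]
  | cons a t ih => rw [wordProd_cons, Module.End.mul_apply, Module.End.mul_apply,
      inner_refl_refl, ih]

lemma wordProd_conj (l : List V) {α β : V} (h : wordProd l α = β) :
    reflEnd β * wordProd l = wordProd l * reflEnd α := by
  ext x
  simp only [Module.End.mul_apply]
  rw [refl_apply, refl_apply, map_sub, map_smul, h]
  congr 2
  simp only [cpair]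
  rw [← h, inner_wordProd, inner_wordProd]

namespace RootSystemData

variable (D : RootSystemData V)

lemma isWord_append {l l' : List V} : D.IsWord (l ++ l') ↔ D.IsWord l ∧ D.IsWord l' := by
  simp only [IsWord, List.mem_append]
  constructor
  · intro h; exact ⟨fun a ha => h a (Or.inl ha), fun a ha => h a (Or.inr ha)⟩
  · rintro ⟨h, h'⟩ a (ha | ha)
    · exact h a ha
    · exact h' a ha

lemma isWord_cons {a : V} {l : List V} : D.IsWord (a :: l) ↔ a ∈ D.simpleRoots ∧ D.IsWord l := by
  simp [IsWord]

lemma isWord_singleton {a : V} : D.IsWord [a] ↔ a ∈ D.simpleRoots := by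
  simp [IsWord]

lemma isWord_reverse {l : List V} : D.IsWord l.reverse ↔ D.IsWord l := by
  simp [IsWord]

lemma wordProd_root {l : List V} (hl : D.IsWord l) {x : V} (hx : x ∈ D.roots) :
    wordProd l x ∈ D.roots := by
  induction l with
  | nil => simpa [wordProd] using hx
  | cons a t ih =>
    rw [isWord_cons] at hl
    rw [wordProd_cons, Module.End.mul_apply]
    exact D.reflect_mem _ (ih hl.2) _ (D.simple_root hl.1)

lemma exchange (hG : D.NotG2) {l : List V} (hl : D.IsWord l) {α : V} (ha : α ∈ D.simpleRoots)
    (h : wordProd l α ∉ D.pos) :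
    ∃ l', D.IsWord l' ∧ wordProd l' = wordProd l * reflEnd α ∧ l'.length + 1 = l.length := by
  induction l with
  | nil => exact absurd ha.1 (by simpa [wordProd] using h)
  | cons b t ih =>
    rw [isWord_cons] at hl
    by_cases ht : wordProd t α ∈ D.pos
    · have hb : wordProd t α = b := by
        by_contra hne
        apply h
        rw [wordProd_cons, Module.End.mul_apply]
        exact D.simple_refl_pos hG hl.1 ht hne
      refine ⟨t, hl.2, ?_, by simp⟩
      rw [wordProd_cons, wordProd_conj t hb, mul_assoc, refl_mul_self, mul_one]
    · obtain ⟨l', h1, h2, h3⟩ := ih hl.2 ht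
      refine ⟨b :: l', D.isWord_cons.mpr ⟨hl.1, h1⟩, ?_, by simp [h3]⟩
      rw [wordProd_cons, wordProd_cons, h2, mul_assoc]

lemma reduced_left {l l' : List V} (h : D.IsReducedWord (l ++ l')) : D.IsReducedWord l := by
  refine ⟨(D.isWord_append.mp h.1).1, fun m hm hp => ?_⟩
  have := h.2 (m ++ l') (D.isWord_append.mpr ⟨hm, (D.isWord_append.mp h.1).2⟩)
    (by rw [wordProd_append, wordProd_append, hp])
  simpa using this

lemma reduced_right {l l' : List V} (h : D.IsReducedWord (l ++ l')) : D.IsReducedWord l' := by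
  refine ⟨(D.isWord_append.mp h.1).2, fun m hm hp => ?_⟩
  have := h.2 (l ++ m) (D.isWord_append.mpr ⟨(D.isWord_append.mp h.1).1, hm⟩)
    (by rw [wordProd_append, wordProd_append, hp])
  simpa using this

lemma reduced_congr {l l' : List V} (h : D.IsReducedWord l) (hw : D.IsWord l')
    (hp : wordProd l' = wordProd l) (hlen : l'.length = l.length) : D.IsReducedWord l' :=
  ⟨hw, fun m hm hmp => by rw [hlen]; exact h.2 m hm (hmp.trans hp)⟩

lemma reduced_reverse {l : List V} (h : D.IsReducedWord l) : D.IsReducedWord l.reverse := by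
  refine ⟨D.isWord_reverse.mpr h.1, fun m hm hp => ?_⟩
  have := h.2 m.reverse (D.isWord_reverse.mpr hm) ?_
  · simpa using this
  · calc wordProd m.reverse = wordProd m.reverse * (wordProd l.reverse * wordProd l) := by
          rw [wordProd_reverse_mul, mul_one]
      _ = (wordProd m.reverse * wordProd m) * wordProd l := by rw [hp, mul_assoc]
      _ = wordProd l := by rw [wordProd_reverse_mul, one_mul]

lemma reduced_snoc_pos (hG : D.NotG2) {l : List V} {α : V} (h : D.IsReducedWord (l ++ [α])) :
    wordProd l α ∈ D.pos := by
  by_contra hc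
  obtain ⟨hl, ha⟩ := D.isWord_append.mp h.1
  rw [isWord_singleton] at ha
  obtain ⟨l', h1, h2, h3⟩ := D.exchange hG hl ha hc
  have := h.2 l' h1 (by rw [wordProd_append, wordProd_singleton, h2])
  simp at this; omega

lemma reduced_snoc_neg (hG : D.NotG2) {l : List V} {α : V} (h : D.IsReducedWord (l ++ [α])) :
    wordProd (l ++ [α]) α ∉ D.pos := by
  rw [wordProd_append, wordProd_singleton, Module.End.mul_apply, refl_self, map_neg]
  exact D.pos_neg (D.reduced_snoc_pos hG h)

/-- If `α` is a right descent of `w`, a reduced word of `w` can be chosen ending in `α`. -/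
lemma descent (hG : D.NotG2) {l : List V} (h : D.IsReducedWord l) {α : V}
    (ha : α ∈ D.simpleRoots) (hd : wordProd l α ∉ D.pos) :
    ∃ l', D.IsReducedWord (l' ++ [α]) ∧ wordProd (l' ++ [α]) = wordProd l ∧
      D.IsReducedWord l' ∧ wordProd l' = wordProd l * reflEnd α ∧ l'.length + 1 = l.length := by
  obtain ⟨l', h1, h2, h3⟩ := D.exchange hG h.1 ha hd
  have hp : wordProd (l' ++ [α]) = wordProd l := by
    rw [wordProd_append, wordProd_singleton, h2, mul_assoc, refl_mul_self, mul_one]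
  have hr : D.IsReducedWord (l' ++ [α]) :=
    D.reduced_congr h (D.isWord_append.mpr ⟨h1, D.isWord_singleton.mpr ha⟩) hp (by simp [h3])
  exact ⟨l', hr, hp, D.reduced_left hr, h2, h3⟩

lemma exists_reduced {w : Module.End ℝ V} (h : D.InWeyl w) :
    ∃ l, D.IsReducedWord l ∧ wordProd l = w := by
  obtain ⟨l, ⟨hl, hp⟩, hmin⟩ := exists_minimalFor_of_wellFoundedLT
    (fun l : List V => D.IsWord l ∧ wordProd l = w) List.length h
  refine ⟨l, ⟨hl, fun l' h1 h2 => ?_⟩, hp⟩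
  by_contra hc
  push Not at hc
  exact absurd (hmin ⟨h1, h2.trans hp⟩ hc.le) (by simpa using hc)

lemma weyl_root {w : Module.End ℝ V} (h : D.InWeyl w) {x : V} (hx : x ∈ D.roots) :
    w x ∈ D.roots := by
  obtain ⟨l, hl, rfl⟩ := h
  exact D.wordProd_root hl hx

lemma weyl_mul {w : Module.End ℝ V} (h : D.InWeyl w) {α : V} (ha : α ∈ D.simpleRoots) :
    D.InWeyl (w * reflEnd α) := by
  obtain ⟨l, hl, rfl⟩ := h
  exact ⟨l ++ [α], D.isWord_append.mpr ⟨hl, D.isWord_singleton.mpr ha⟩,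
    by rw [wordProd_append, wordProd_singleton]⟩

lemma mem_inv {w : Module.End ℝ V} (hG : D.NotG2) (h : D.InWeyl w) {x : V} (hx : x ∈ D.roots) :
    x ∈ D.inversions w ↔ 0 < D.ht x ∧ D.ht (w x) < 0 := by
  have hwx := D.weyl_root h hx
  rw [← D.mem_pos_iff hG hx, ← D.not_mem_pos_iff hG hwx]
  simp [inversions, hwx]

lemma inv_root {w : Module.End ℝ V} {x : V} (hx : x ∈ D.inversions w) : x ∈ D.roots :=
  D.pos_subset hx.1

lemma ht_ne (hG : D.NotG2) {x : V} (hx : x ∈ D.roots) : D.ht x ≠ 0 := by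
  by_cases h : x ∈ D.pos
  · exact ((D.mem_pos_iff hG hx).mp h).ne'
  · exact ((D.not_mem_pos_iff hG hx).mp h).ne

lemma inv_step (hG : D.NotG2) {w : Module.End ℝ V} {α x : V}
    (ha : α ∈ D.simpleRoots) (hx : x ∈ D.inversions w) (hne : x ≠ α) :
    reflEnd α x ∈ D.inversions (w * reflEnd α) := by
  refine ⟨D.simple_refl_pos hG ha hx.1 hne, ?_⟩
  rw [Module.End.mul_apply, refl_refl]
  exact hx.2

lemma inv_step_back (hG : D.NotG2) {w : Module.End ℝ V} {α x : V}
    (ha : α ∈ D.simpleRoots) (hx : x ∈ D.inversions (w * reflEnd α)) (hne : x ≠ α) :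
    reflEnd α x ∈ D.inversions w := by
  have := D.inv_step hG ha hx hne
  rwa [mul_assoc, refl_mul_self, mul_one] at this

lemma inv_one : D.inversions 1 = ∅ := by
  ext x; simp only [inversions, Set.mem_ofPred_eq, Module.End.one_apply, Set.mem_empty_iff_false,
    iff_false]
  tauto

/-- fully commutative passes to right descents. -/
lemma fc_step (hG : D.NotG2) {w : Module.End ℝ V} (hw : D.FullyCommutative w) {α : V}
    (ha : α ∈ D.simpleRoots) (hd : α ∈ D.inversions w) :
    D.FullyCommutative (w * reflEnd α) := by
  refine ⟨D.weyl_mul hw.1 ha, fun l hl hp β hb γ hc hnc hinf => ?_⟩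
  obtain ⟨l0, h0, hp0⟩ := D.exists_reduced hw.1
  have hd' : wordProd l0 α ∉ D.pos := by rw [hp0]; exact hd.2.2
  obtain ⟨l', h1, h2, h3, h4, h5⟩ := D.descent hG h0 ha hd'
  have hpl : wordProd (l ++ [α]) = w := by
    rw [wordProd_append, wordProd_singleton, hp, mul_assoc, refl_mul_self, mul_one]
  have hlen : l.length ≤ l'.length := hl.2 l' h3.1 (by rw [h4, hp0, hp])
  have hword : D.IsWord (l ++ [α]) := D.isWord_append.mpr ⟨hl.1, D.isWord_singleton.mpr ha⟩
  have hle := h0.2 _ hword (hpl.trans hp0.symm)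
  have hr : D.IsReducedWord (l ++ [α]) :=
    D.reduced_congr h0 hword (hpl.trans hp0.symm) (by simp at hle ⊢; omega)
  exact hw.2 _ hr hpl β hb γ hc hnc (hinf.trans (List.infix_append' [] l [α]))

/-! Orders of products of two reflections. -/

lemma commute_of_orth {α β : V} (h : ⟪α, β⟫ = 0) : Commute (reflEnd α) (reflEnd β) := by
  have h' : ⟪β, α⟫ = 0 := by rw [real_inner_comm]; exact h
  ext x
  simp only [Module.End.mul_apply, refl_apply, cpair, inner_sub_left, inner_smul_left, h, h',
    RCLike.conj_to_real, mul_zero, sub_zero]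
  abel

lemma orth_of_commute {α β : V} (ha : α ∈ D.pos) (hb : β ∈ D.pos) (hne : α ≠ β)
    (h : Commute (reflEnd α) (reflEnd β)) : ⟪α, β⟫ = 0 := by
  by_contra h0
  have := LinearMap.congr_fun h.eq α
  simp only [Module.End.mul_apply, refl_self, map_neg] at this
  -- s_α s_β α = - s_β α
  have e : reflEnd β α = α - cpair α β • β := refl_apply β α
  set c := cpair α β with hc
  have hc0 : c ≠ 0 := by
    have := cpair_mul (D.ne_zero β (D.pos_subset hb)) α
    intro h; rw [← hc, h, zero_mul] at this; exact h0 (by linarith)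
  rw [e, map_sub, map_smul, refl_self, refl_apply α β] at this
  have h3 : (c * cpair β α + 0) • α = (2 * c) • β + (0 : ℝ) • α := by
    have : c • (β - cpair β α • α) = - (c • β) := by
      have h4 : -α - c • (β - cpair β α • α) = -(α - c • β) := this
      have : c • (β - cpair β α • α) = -α + (α - c • β) := by
        rw [eq_comm, ← sub_eq_zero] at h4
        rw [← sub_eq_zero, ← h4]; abel
      rw [this]; abel
    rw [smul_sub, smul_smul] at this
    rw [add_zero, zero_smul, add_zero, mul_smul 2 c, two_smul]
    rw [sub_eq_iff_eq_add] at this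
    rw [← sub_eq_zero] at this ⊢
    rw [← neg_eq_zero, ← this]; abel
  simp only [add_zero, zero_smul] at h3
  have hβ : β = (cpair β α / 2) • α := by
    have : (2 * c)⁻¹ • ((c * cpair β α) • α) = (2 * c)⁻¹ • ((2 * c) • β) := by rw [h3]
    rw [smul_smul, smul_smul, inv_mul_cancel₀ (by simpa using hc0), one_smul] at this
    refine this.symm.trans ?_; congr 1; field_simp
  rcases D.reduced α (D.pos_subset ha) (cpair β α / 2) (hβ ▸ D.pos_subset hb) with h | h
  · rw [h, one_smul] at hβ; exact hne hβ.symm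
  · rw [h, neg_smul, one_smul] at hβ; exact D.pos_ne_neg hb ha hβ

lemma braid_A {α β : V} (h1 : cpair α β = -1) (h2 : cpair β α = -1) :
    reflEnd α * reflEnd β * reflEnd α = reflEnd β * reflEnd α * reflEnd β := by
  have e : reflEnd β (reflEnd α β) = α := by
    rw [refl_of_cpair h2, map_sub, map_smul, refl_self, refl_of_cpair h1]; module
  have h := wordProd_conj [β, α] (α := β) (β := α) (by simpa [wordProd] using e)
  simpa [wordProd, mul_assoc] using h

lemma braid_B {α β : V} (h1 : cpair α β = -1) (h2 : cpair β α = -2) :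
    reflEnd α * reflEnd β * reflEnd α * reflEnd β
      = reflEnd β * reflEnd α * reflEnd β * reflEnd α := by
  have e : reflEnd β (reflEnd α (reflEnd β α)) = α := by
    rw [refl_of_cpair h1]
    simp only [map_sub, map_smul, map_neg, refl_self, refl_of_cpair h2, refl_of_cpair h1]
    module
  have h := wordProd_conj [β, α, β] (α := α) (β := α) (by simpa [wordProd] using e)
  simpa [wordProd, mul_assoc] using h

lemma order_A {α β : V} (hne : reflEnd α ≠ reflEnd β) (h1 : cpair α β = -1) (h2 : cpair β α = -1) :
    orderOf (reflEnd α * reflEnd β) = 3 := by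
  have : Fact (Nat.Prime 3) := ⟨by norm_num⟩
  apply orderOf_eq_prime
  · have h := braid_A h1 h2
    calc (reflEnd α * reflEnd β) ^ 3
        = (reflEnd α * reflEnd β * reflEnd α) * (reflEnd β * reflEnd α * reflEnd β) := by
          simp only [pow_succ, pow_zero, one_mul, mul_assoc]
      _ = reflEnd β * (reflEnd α * (reflEnd β * reflEnd β) * reflEnd α) * reflEnd β := by
          rw [h]; simp only [mul_assoc]
      _ = 1 := by simp [refl_mul_self]
  · intro h
    apply hne
    calc reflEnd α = reflEnd α * reflEnd β * reflEnd β := by rw [mul_assoc, refl_mul_self, mul_one]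
      _ = reflEnd β := by rw [h, one_mul]

lemma order_B {α β : V} (hnc : ¬ Commute (reflEnd α) (reflEnd β))
    (h : reflEnd α * reflEnd β * reflEnd α * reflEnd β
      = reflEnd β * reflEnd α * reflEnd β * reflEnd α) :
    orderOf (reflEnd α * reflEnd β) = 4 := by
  have : Fact (Nat.Prime 2) := ⟨by norm_num⟩
  have := orderOf_eq_prime_pow (x := reflEnd α * reflEnd β) (p := 2) (n := 1) ?_ ?_
  · simpa using this
  · intro h
    apply hnc
    have h4 : reflEnd α * reflEnd β * (reflEnd α * reflEnd β) = 1 := by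
      rw [← h]; norm_num [pow_succ]
    calc reflEnd α * reflEnd β = reflEnd α * reflEnd β * ((reflEnd α * (reflEnd β * reflEnd β) * reflEnd α)) := by
          simp [refl_mul_self]
      _ = (reflEnd α * reflEnd β * (reflEnd α * reflEnd β)) * (reflEnd β * reflEnd α) := by
          simp only [mul_assoc]
      _ = _ := by rw [h4, one_mul]
  · norm_num
    calc (reflEnd α * reflEnd β) ^ 4
        = (reflEnd α * reflEnd β * reflEnd α * reflEnd β) * (reflEnd α * reflEnd β * reflEnd α * reflEnd β) := by
          simp only [pow_succ, pow_zero, one_mul, mul_assoc]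
      _ = (reflEnd β * reflEnd α * reflEnd β * reflEnd α) * (reflEnd α * reflEnd β * reflEnd α * reflEnd β) := by
          rw [h]
      _ = reflEnd β * (reflEnd α * (reflEnd β * (reflEnd α * reflEnd α) * reflEnd β) * reflEnd α) * reflEnd β := by
          simp only [mul_assoc]
      _ = 1 := by simp [refl_mul_self]

end RootSystemData



lemma cpair_eq {x y : V} {c : ℝ} (hy : y ≠ 0) (h : 2 * ⟪x, y⟫ = c * ⟪y, y⟫) : cpair x y = c := by
  have : ⟪y, y⟫ ≠ 0 := inner_self_ne_zero.mpr hy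
  unfold cpair; field_simp; linarith

namespace RootSystemData

variable (D : RootSystemData V)

lemma inv_of_mid (hG : D.NotG2) {m l2 : List V} {α : V}
    (h : D.IsReducedWord (m ++ [α] ++ l2)) :
    wordProd l2.reverse α ∈ D.inversions (wordProd (m ++ [α] ++ l2)) := by
  have h1 : D.IsReducedWord ([α] ++ l2) := D.reduced_right (l := m) (by simpa using h)
  have h2 := D.reduced_reverse h1
  rw [List.reverse_append, List.reverse_singleton] at h2
  have h3 := D.reduced_snoc_pos hG h2
  refine ⟨h3, D.wordProd_root h.1 (D.pos_subset h3), ?_⟩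
  have h4 := D.reduced_snoc_neg hG (D.reduced_left h)
  rw [wordProd_append, Module.End.mul_apply, ← Module.End.mul_apply (wordProd l2),
    wordProd_mul_reverse, Module.End.one_apply]
  exact h4

lemma bad_aux (hG : D.NotG2) {m m' l2 : List V} {α β : V} (hin : ⟪α, β⟫ < 0)
    (h : D.IsReducedWord (m ++ [α] ++ l2)) (hb : β ∈ D.simpleRoots) (hm' : D.IsWord m')
    (hlen : m'.length = m.length)
    (hp : wordProd (m' ++ [β]) = wordProd (m ++ [α])) :
    ∃ a ∈ D.inversions (wordProd (m ++ [α] ++ l2)),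
      ∃ b ∈ D.inversions (wordProd (m ++ [α] ++ l2)), ⟪a, b⟫ < 0 := by
  have hp' : wordProd (m' ++ [β] ++ l2) = wordProd (m ++ [α] ++ l2) := by
    rw [wordProd_append, wordProd_append _ l2, hp]
  have hl2 := (D.isWord_append.mp h.1).2
  have h' : D.IsReducedWord (m' ++ [β] ++ l2) :=
    D.reduced_congr h (D.isWord_append.mpr ⟨D.isWord_append.mpr ⟨hm', D.isWord_singleton.mpr hb⟩,
      hl2⟩) hp' (by simp [hlen])
  refine ⟨_, D.inv_of_mid hG h, wordProd l2.reverse β, ?_, ?_⟩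
  · have := D.inv_of_mid hG h'
    rwa [hp'] at this
  · rw [inner_wordProd]; exact hin

lemma bad_of_not_fc (hG : D.NotG2) {w : Module.End ℝ V} (hw : D.InWeyl w)
    (h : ¬ D.FullyCommutative w) : ∃ a ∈ D.inversions w, ∃ b ∈ D.inversions w, ⟪a, b⟫ < 0 := by
  simp only [FullyCommutative, hw, true_and] at h
  push Not at h
  obtain ⟨l, hl, rfl, α, ha, β, hb, hnc, l1, l2, hinf⟩ := h
  have hne : α ≠ β := by rintro rfl; exact hnc (Commute.refl _)
  have hin : ⟪α, β⟫ < 0 :=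
    lt_of_le_of_ne (D.simple_inner hG ha hb hne) (fun h => hnc (commute_of_orth h))
  have hin' : ⟪β, α⟫ < 0 := by rw [real_inner_comm]; exact hin
  have hrne : reflEnd α ≠ reflEnd β := fun h => hnc (by rw [h])
  have hl1 : D.IsWord l1 := by
    have := hl.1; rw [← hinf] at this
    exact (D.isWord_append.mp (D.isWord_append.mp this).1).1
  rcases D.cpair_cases hG (D.simple_root ha) (D.simple_root hb) hne
    (D.pos_ne_neg ha.1 hb.1) with h' | h' | ⟨-, h' | h' | h'⟩
  · linarith [h'.1]
  · linarith [h'.1]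
  · rw [order_A hrne h'.1 h'.2] at hinf
    subst hinf
    have := D.bad_aux hG (m := l1 ++ [α, β]) (m' := l1 ++ [β, α]) (l2 := l2) (α := α) (β := β) hin
      (by simpa [altWord] using hl) hb
      (D.isWord_append.mpr ⟨hl1, by simp [IsWord, ha, hb]⟩) (by simp)
      (by simp only [List.append_assoc]
          rw [wordProd_append, wordProd_append l1]
          congr 1
          have := braid_A h'.1 h'.2
          simpa [wordProd, mul_assoc] using this.symm)
    simpa [altWord] using this
  all_goals
    have hbr : reflEnd α * reflEnd β * reflEnd α * reflEnd β
      = reflEnd β * reflEnd α * reflEnd β * reflEnd α := by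
      first
      | exact braid_B h'.1 h'.2
      | exact (braid_B h'.2 h'.1).symm
    rw [order_B hnc hbr] at hinf
    subst hinf
    have := D.bad_aux hG (m := l1 ++ [α, β, α]) (m' := l1 ++ [β, α, β]) (l2 := l2) (α := β) (β := α)
      hin' (by simpa [altWord] using hl) ha
      (D.isWord_append.mpr ⟨hl1, by simp [IsWord, ha, hb]⟩) (by simp)
      (by simp only [List.append_assoc]
          rw [wordProd_append, wordProd_append l1]
          congr 1
          simpa [wordProd, mul_assoc] using hbr.symm)
    simpa [altWord] using this

/-- The final configuration in the induction. -/
lemma final_conf (hG : D.NotG2) {w : Module.End ℝ V} (hw : D.InWeyl w) {a e1 e2 e3 : V} {κ T : ℝ}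
    (hT : 0 < T) (hκ : 0 < κ) (h11 : ⟪e1, e1⟫ = T / 2) (h22 : ⟪e2, e2⟫ = T / 2)
    (h33 : ⟪e3, e3⟫ = T / 2) (h12 : ⟪e1, e2⟫ = 0) (h13 : ⟪e1, e3⟫ = 0) (h23 : ⟪e2, e3⟫ = 0)
    (hβ : κ • e3 ∈ D.simpleRoots) (hτ : e2 - e3 ∈ D.simpleRoots) (hσ : e1 - e2 ∈ D.simpleRoots)
    (ha : a ∈ D.inversions w) (ha3 : ⟪a, e3⟫ < 0) (ha23 : 0 ≤ ⟪a, e2⟫ + ⟪a, e3⟫)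
    (ha13 : 0 ≤ ⟪a, e1⟫ + ⟪a, e3⟫) (hsτ : e2 + e3 ∈ D.inversions w)
    (hwσ : 0 < D.ht (w (e1 - e2))) (hwe2 : 0 < D.ht (w e2))
    (star : ∀ x ∈ D.inversions w, ∀ y ∈ D.inversions w, ⟪x, y⟫ < 0 → x = κ • e3 ∨ y = κ • e3) :
    False := by
  have h21 : ⟪e2, e1⟫ = 0 := by rw [real_inner_comm]; exact h12
  have h31 : ⟪e3, e1⟫ = 0 := by rw [real_inner_comm]; exact h13
  have h32 : ⟪e3, e2⟫ = 0 := by rw [real_inner_comm]; exact h23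
  have n1 : e1 ≠ 0 := by rintro rfl; simp at h11; linarith
  have n2 : e2 ≠ 0 := by rintro rfl; simp at h22; linarith
  have n3 : e3 ≠ 0 := by rintro rfl; simp at h33; linarith
  have nβ := D.ne_zero _ (D.simple_root hβ)
  have nτ := D.ne_zero _ (D.simple_root hτ)
  have nσ := D.ne_zero _ (D.simple_root hσ)
  -- reflections
  have sb1 : reflEnd (κ • e3) e1 = e1 := refl_of_orth (by simp [inner_smul_right, h13])
  have sb2 : reflEnd (κ • e3) e2 = e2 := refl_of_orth (by simp [inner_smul_right, h23])
  have sb3 : reflEnd (κ • e3) e3 = - e3 := by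
    have := refl_self (κ • e3)
    rw [map_smul] at this
    have h := congrArg (fun x => κ⁻¹ • x) this
    simpa [smul_smul, hκ.ne'] using h
  have st2 : reflEnd (e2 - e3) e2 = e3 := by
    rw [refl_of_cpair (cpair_eq nτ (c := 1) (by
      simp only [inner_sub_left, inner_sub_right, h22, h23, h32, h33]; ring))]
    simp
  have st3 : reflEnd (e2 - e3) e3 = e2 := by
    have := congrArg (reflEnd (e2 - e3)) st2
    rw [refl_refl] at this; exact this.symm
  have st1 : reflEnd (e2 - e3) e1 = e1 := refl_of_orth (by simp [inner_sub_right, h12, h13])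
  have ss1 : reflEnd (e1 - e2) e1 = e2 := by
    rw [refl_of_cpair (cpair_eq nσ (c := 1) (by
      simp only [inner_sub_left, inner_sub_right, h11, h12, h21, h22]; ring))]
    simp
  have ss2 : reflEnd (e1 - e2) e2 = e1 := by
    have := congrArg (reflEnd (e1 - e2)) ss1
    rw [refl_refl] at this; exact this.symm
  have ss3 : reflEnd (e1 - e2) e3 = e3 := refl_of_orth (by simp [inner_sub_right, h31, h32])
  set P := wordProd [e2 - e3, κ • e3, e2 - e3] with hP
  have hPσ : P (e1 - e2) = e1 + e2 := by
    simp [hP, wordProd, st1, st2, sb1, sb3, st3]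
  have hζ := wordProd_conj _ hPσ
  have hPP : P * P = 1 := wordProd_mul_reverse [e2 - e3, κ • e3, e2 - e3]
  have hζ' : reflEnd (e1 + e2) a = P (reflEnd (e1 - e2) (P a)) := by
    have := congrArg (fun f => (f * P) a) hζ
    simp only [mul_assoc] at this
    rw [← hP, hPP, mul_one] at this
    exact this
  have hζr : e1 + e2 ∈ D.roots := by
    rw [← hPσ]
    exact D.wordProd_root (by simp [IsWord, hβ, hτ]) (D.simple_root hσ)
  have nζ := D.ne_zero _ hζr
  have har := D.inv_root ha
  have hsar : reflEnd (e1 + e2) a ∈ D.roots := D.reflect_mem _ har _ hζr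
  have hζc : 0 < cpair a (e1 + e2) := by
    unfold cpair
    apply div_pos _ (D.inner_pos hζr)
    rw [inner_add_right]; linarith
  have hwsa : D.ht (w (reflEnd (e1 + e2) a)) < 0 := by
    rw [refl_apply, map_sub, map_smul, map_sub, map_smul]
    have h1 := ((D.mem_inv hG hw har).mp ha).2
    have h2 : 0 < D.ht (w (e1 + e2)) := by
      have : e1 + e2 = (e1 - e2) + (2 : ℝ) • e2 := by module
      rw [this, map_add, map_smul, map_add, map_smul, smul_eq_mul]; linarith
    have := mul_pos hζc h2
    rw [smul_eq_mul]; linarith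
  by_cases hpos : reflEnd (e1 + e2) a ∈ D.pos
  · have hsa : reflEnd (e1 + e2) a ∈ D.inversions w :=
      (D.mem_inv hG hw hsar).mpr ⟨D.ht_pos hG hpos, hwsa⟩
    have hneg : ⟪reflEnd (e1 + e2) a, e2 + e3⟫ < 0 := by
      rw [inner_refl_comm, refl_of_cpair (cpair_eq nζ (c := 1) (by
        simp only [inner_add_left, inner_add_right, h11, h12, h21, h22, h31, h32]; ring))]
      simp only [inner_sub_right, inner_add_right, one_smul]
      linarith
    rcases star _ hsa _ hsτ hneg with h | h
    · have : a = κ • e3 := by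
        have h2 := congrArg (reflEnd (e1 + e2)) h
        rw [refl_refl] at h2
        rw [h2]
        exact refl_of_orth (by simp [inner_smul_left, inner_add_right, h31, h32])
      rw [this, inner_smul_left, h33] at ha3
      have := mul_pos hκ hT
      simp at ha3; linarith
    · have := congrArg (fun x => ⟪x, e2⟫) h
      simp only [inner_add_left, inner_smul_left, h22, h32, mul_zero, RCLike.conj_to_real] at this
      linarith
  · let Sp : Submodule ℝ V := Submodule.span ℝ {e1, e2, e3}
    have m1 : e1 ∈ Sp := Submodule.subset_span (by simp)
    have m2 : e2 ∈ Sp := Submodule.subset_span (by simp)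
    have m3 : e3 ∈ Sp := Submodule.subset_span (by simp)
    have step : ∀ s ∈ D.simpleRoots, s ∈ Sp → ∀ x, x ∈ D.pos → x ∉ Sp →
        reflEnd s x ∈ D.pos ∧ reflEnd s x ∉ Sp := by
      intro s hs hsS x hx hxS
      refine ⟨D.simple_refl_pos hG hs hx (by rintro rfl; exact hxS hsS), fun h => hxS ?_⟩
      rw [refl_apply] at h
      have := Sp.add_mem h (Sp.smul_mem (cpair x s) hsS)
      simpa using this
    have mβ : κ • e3 ∈ Sp := Sp.smul_mem _ m3
    have mτ : e2 - e3 ∈ Sp := Sp.sub_mem m2 m3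
    have mσ : e1 - e2 ∈ Sp := Sp.sub_mem m1 m2
    have stepP : ∀ x, x ∈ D.pos → x ∉ Sp → P x ∈ D.pos ∧ P x ∉ Sp := by
      intro x hx hxS
      have h1 := step _ hτ mτ x hx hxS
      have h2 := step _ hβ mβ _ h1.1 h1.2
      have h3 := step _ hτ mτ _ h2.1 h2.2
      simpa [hP, wordProd] using h3
    by_cases haS : a ∈ Sp
    · obtain ⟨x1, x2, x3, hx⟩ : ∃ x1 x2 x3 : ℝ, a = x1 • e1 + x2 • e2 + x3 • e3 := by
        rw [Submodule.mem_span_insert] at haS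
        obtain ⟨x1, z, hz, rfl⟩ := haS
        rw [Submodule.mem_span_pair] at hz
        obtain ⟨x2, x3, rfl⟩ := hz
        exact ⟨x1, x2, x3, by rw [add_assoc]⟩
      have a1 : ⟪a, e1⟫ = x1 * (T / 2) := by
        rw [hx]; simp only [add_zero, zero_add, mul_zero, RCLike.conj_to_real, inner_add_left, inner_smul_left, h11, h21, h31]
      have a2 : ⟪a, e2⟫ = x2 * (T / 2) := by
        rw [hx]; simp only [add_zero, zero_add, mul_zero, RCLike.conj_to_real, inner_add_left, inner_smul_left, h12, h22, h32]
      have a3 : ⟪a, e3⟫ = x3 * (T / 2) := by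
        rw [hx]; simp only [add_zero, zero_add, mul_zero, RCLike.conj_to_real, inner_add_left, inner_smul_left, h13, h23, h33]
      have aa : ⟪a, a⟫ = (x1 ^ 2 + x2 ^ 2 + x3 ^ 2) * (T / 2) := by
        conv_lhs => rw [hx]
        simp only [RCLike.conj_to_real, inner_add_left, inner_add_right, inner_smul_left, inner_smul_right, h11, h12, h13,
          h21, h22, h23, h31, h32, h33]
        ring
      have r3 : κ • e3 ∈ D.roots := D.simple_root hβ
      have r2 : κ • e2 ∈ D.roots := by
        have := D.reflect_mem _ r3 _ (D.simple_root hτ)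
        rwa [map_smul, st3] at this
      have r1 : κ • e1 ∈ D.roots := by
        have := D.reflect_mem _ r2 _ (D.simple_root hσ)
        rwa [map_smul, ss2] at this
      obtain ⟨k1, hk1⟩ := D.crystallographic _ har _ r1
      obtain ⟨k2, hk2⟩ := D.crystallographic _ har _ r2
      obtain ⟨k3, hk3⟩ := D.crystallographic _ har _ r3
      have c1 := cpair_mul (D.ne_zero _ r1) a
      have c2 := cpair_mul (D.ne_zero _ r2) a
      have c3 := cpair_mul (D.ne_zero _ r3) a
      rw [hk1] at c1; rw [hk2] at c2; rw [hk3] at c3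
      simp only [inner_smul_left, inner_smul_right, RCLike.conj_to_real, h11, h22, h33, a1, a2,
        a3] at c1 c2 c3
      have hT2 : κ * T ≠ 0 := by positivity
      have y1 : 2 * x1 = k1 * κ := by
        apply mul_right_cancel₀ hT2; linarith
      have y2 : 2 * x2 = k2 * κ := by
        apply mul_right_cancel₀ hT2; linarith
      have y3 : 2 * x3 = k3 * κ := by
        apply mul_right_cancel₀ hT2; linarith
      have bb : ⟪κ • e3, κ • e3⟫ = κ ^ 2 * (T / 2) := by
        simp only [inner_smul_left, inner_smul_right, RCLike.conj_to_real, h33]; ring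
      have hab : ⟪a, κ • e3⟫ ≠ 0 := by
        rw [inner_smul_right]; exact mul_ne_zero hκ.ne' ha3.ne
      have aa' : 4 * ⟪a, a⟫ = (k1 ^ 2 + k2 ^ 2 + k3 ^ 2 : ℤ) * ⟪κ • e3, κ • e3⟫ := by
        rw [aa, bb]; push_cast
        have e1 : (2 * x1) ^ 2 = (k1 * κ) ^ 2 := by rw [y1]
        have e2 : (2 * x2) ^ 2 = (k2 * κ) ^ 2 := by rw [y2]
        have e3 : (2 * x3) ^ 2 = (k3 * κ) ^ 2 := by rw [y3]
        linear_combination (T / 2) * e1 + (T / 2) * e2 + (T / 2) * e3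
      have bp := (D.inner_pos r3)
      have z1 : k1 ≠ 0 := by
        rintro rfl
        have : x1 = 0 := by push_cast at y1; linarith
        rw [this] at a1; linarith
      have z2 : k2 ≠ 0 := by
        rintro rfl
        have : x2 = 0 := by push_cast at y2; linarith
        rw [this] at a2; linarith
      have z3 : k3 ≠ 0 := by
        rintro rfl
        have : x3 = 0 := by push_cast at y3; linarith
        rw [this] at a3; linarith
      have hcases : k1 ^ 2 + k2 ^ 2 + k3 ^ 2 = 4 ∨ k1 ^ 2 + k2 ^ 2 + k3 ^ 2 = 2 ∨
          k1 ^ 2 + k2 ^ 2 + k3 ^ 2 = 8 := by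
        rcases D.ratio_of_ne hG har r3 hab with h | h | h
        · left
          have : ((k1 ^ 2 + k2 ^ 2 + k3 ^ 2 : ℤ) : ℝ) = (4 : ℤ) := by
            apply mul_right_cancel₀ bp.ne'; rw [← aa', h]; norm_num
          exact_mod_cast this
        · right; left
          have : ((k1 ^ 2 + k2 ^ 2 + k3 ^ 2 : ℤ) : ℝ) = (2 : ℤ) := by
            apply mul_right_cancel₀ bp.ne'; rw [← aa', h]; push_cast; ring
          exact_mod_cast this
        · right; right
          have : ((k1 ^ 2 + k2 ^ 2 + k3 ^ 2 : ℤ) : ℝ) = (8 : ℤ) := by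
            apply mul_right_cancel₀ bp.ne'; rw [← aa', h]; push_cast; ring
          exact_mod_cast this
      have sq : ∀ k : ℤ, k ≠ 0 → k ^ 2 ≤ 8 → k ^ 2 = 1 ∨ k ^ 2 = 4 := by
        intro k hk h8
        have : k ≤ 2 := by nlinarith
        have : -2 ≤ k := by nlinarith
        interval_cases k <;> simp_all
      have p1 : 0 ≤ k1 ^ 2 := sq_nonneg _
      have p2 : 0 ≤ k2 ^ 2 := sq_nonneg _
      have p3 : 0 ≤ k3 ^ 2 := sq_nonneg _
      have q1 := sq k1 z1 (by omega)
      have q2 := sq k2 z2 (by omega)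
      have q3 := sq k3 z3 (by omega)
      omega
    · apply hpos
      rw [hζ']
      have h1 := stepP a ha.1 haS
      have h2 := step _ hσ mσ _ h1.1 h1.2
      exact (stepP _ h2.1 h2.2).1

end RootSystemData



namespace RootSystemData

variable (D : RootSystemData V)

lemma no_two_double {β τ σ : V} (hG : D.NotG2) (hβ : β ∈ D.simpleRoots) (hτ : τ ∈ D.simpleRoots)
    (hσ : σ ∈ D.simpleRoots) (h1 : ⟪β, τ⟫ < 0) (h2 : ⟪β, σ⟫ < 0) (h3 : ⟪τ, σ⟫ ≤ 0)
    (d1 : 2 * (⟪β, τ⟫ * ⟪β, τ⟫) = ⟪β, β⟫ * ⟪τ, τ⟫) (d2 : 2 * (⟪β, σ⟫ * ⟪β, σ⟫) = ⟪β, β⟫ * ⟪σ, σ⟫) :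
    False := by
  have pt := D.inner_pos (D.simple_root hτ)
  have ps := D.inner_pos (D.simple_root hσ)
  set p := -⟪β, τ⟫ / ⟪τ, τ⟫ with hp
  set q := -⟪β, σ⟫ / ⟪σ, σ⟫ with hq
  have p0 : 0 < p := div_pos (by linarith) pt
  have q0 : 0 < q := div_pos (by linarith) ps
  have ep : p * ⟪τ, τ⟫ = -⟪β, τ⟫ := by rw [hp]; field_simp
  have eq : q * ⟪σ, σ⟫ = -⟪β, σ⟫ := by rw [hq]; field_simp
  have ep2 : 2 * p * ⟪β, τ⟫ = - ⟪β, β⟫ := by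
    apply mul_right_cancel₀ pt.ne'
    linear_combination 2 * ⟪β, τ⟫ * ep - d1
  have eq2 : 2 * q * ⟪β, σ⟫ = - ⟪β, β⟫ := by
    apply mul_right_cancel₀ ps.ne'
    linear_combination 2 * ⟪β, σ⟫ * eq - d2
  have hv : ⟪β + p • τ + q • σ, β + p • τ + q • σ⟫ ≤ 0 := by
    simp only [inner_add_left, inner_add_right, inner_smul_left, inner_smul_right,
      RCLike.conj_to_real]
    rw [real_inner_comm β τ, real_inner_comm β σ, real_inner_comm τ σ]
    have : p * q * ⟪τ, σ⟫ ≤ 0 := mul_nonpos_of_nonneg_of_nonpos (mul_pos p0 q0).le h3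
    have e1 : p * (p * ⟪τ, τ⟫) = ⟪β, β⟫ / 2 := by rw [ep]; linarith
    have e2 : q * (q * ⟪σ, σ⟫) = ⟪β, β⟫ / 2 := by rw [eq]; linarith
    nlinarith
  have hv0 : β + p • τ + q • σ = 0 := by
    rw [← inner_self_eq_zero (𝕜 := ℝ)]
    exact le_antisymm hv real_inner_self_nonneg
  have := congrArg D.ht hv0
  simp only [map_add, map_smul, smul_eq_mul, map_zero] at this
  have a1 := D.ht_simple hG hβ
  have a2 := mul_pos p0 (D.ht_simple hG hτ)
  have a3 := mul_pos q0 (D.ht_simple hG hσ)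
  linarith

lemma double_of {α β : V} (ha : α ∈ D.roots) (hb : β ∈ D.roots)
    (h : cpair α β * cpair β α = 2) : 2 * (⟪α, β⟫ * ⟪α, β⟫) = ⟪α, α⟫ * ⟪β, β⟫ := by
  have e1 := cpair_mul (D.ne_zero _ hb) α
  have e2 := cpair_mul (D.ne_zero _ ha) β
  rw [real_inner_comm α β] at e2
  linear_combination (-(1:ℝ)/2) * (cpair β α * ⟪α, α⟫) * e1 - ⟪α, β⟫ * e2 +
    (1/2 : ℝ) * ⟪α, α⟫ * ⟪β, β⟫ * h

lemma last_letter (hG : D.NotG2) {l : List V} (h : D.IsReducedWord l) {x : V}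
    (hx : x ∈ D.inversions (wordProd l)) :
    ∃ σ ∈ D.simpleRoots, σ ∈ D.inversions (wordProd l) := by
  rcases List.eq_nil_or_concat l with rfl | ⟨l0, σ, rfl⟩
  · rw [wordProd_nil, inv_one] at hx; exact absurd hx (by simp)
  · rw [List.concat_eq_append] at *
    have hs : σ ∈ D.simpleRoots := D.isWord_singleton.mp (D.isWord_append.mp h.1).2
    exact ⟨σ, hs, hs.1, D.wordProd_root h.1 (D.simple_root hs), D.reduced_snoc_neg hG h⟩

lemma not_inv_mul {w : Module.End ℝ V} {τ : V} (h : τ ∈ D.inversions w) :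
    τ ∉ D.inversions (w * reflEnd τ) := by
  rintro ⟨-, -, h3⟩
  rw [Module.End.mul_apply, refl_self, map_neg] at h3
  exact h3 (D.neg_pos_of h.2.1 h.2.2)

lemma simple_pair_not_fc (hG : D.NotG2) {l : List V} (hl : D.IsReducedWord l) {a β : V}
    (ha : a ∈ D.simpleRoots) (hb : β ∈ D.simpleRoots) (hai : a ∈ D.inversions (wordProd l))
    (hbi : β ∈ D.inversions (wordProd l)) (hin : ⟪a, β⟫ < 0) :
    ¬ D.FullyCommutative (wordProd l) := by
  intro hfc
  have hne : a ≠ β := by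
    rintro rfl; linarith [D.inner_pos (D.simple_root ha)]
  have hnc : ¬ Commute (reflEnd a) (reflEnd β) := fun h => by
    linarith [D.orth_of_commute ha.1 hb.1 hne h]
  have hnc' : ¬ Commute (reflEnd β) (reflEnd a) := fun h => hnc h.symm
  have hrne : reflEnd β ≠ reflEnd a := fun h => hnc (by rw [h])
  have hw : D.InWeyl (wordProd l) := ⟨l, hl.1, rfl⟩
  have wa := ((D.mem_inv hG hw (D.simple_root ha)).mp hai).2
  have wb := ((D.mem_inv hG hw (D.simple_root hb)).mp hbi).2
  have neg : ∀ l' : List V, D.IsWord l' → ∀ x ∈ D.roots, D.ht (wordProd l' x) < 0 →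
      wordProd l' x ∉ D.pos := fun l' hl' x hx h =>
    (D.not_mem_pos_iff hG (D.wordProd_root hl' hx)).mpr h
  obtain ⟨l1, r1, p1, q1, e1, -⟩ := D.descent hG hl hb hbi.2.2
  set c := cpair a β with hc
  set d := cpair β a with hd
  have sa : reflEnd β a = a - c • β := refl_apply _ _
  have sb : reflEnd a β = β - d • a := refl_apply _ _
  have hcd : (c = -1 ∧ d = -1) ∨ (c < 0 ∧ d < 0 ∧ c * d = 2 ∧
      reflEnd a * reflEnd β * reflEnd a * reflEnd β
      = reflEnd β * reflEnd a * reflEnd β * reflEnd a) := by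
    rcases D.cpair_cases hG (D.simple_root ha) (D.simple_root hb) hne
      (D.pos_ne_neg ha.1 hb.1) with h' | h' | ⟨-, h' | h' | h'⟩
    · linarith [h'.1]
    · linarith [h'.1]
    · left; exact h'
    · right; exact ⟨by linarith [h'.1], by linarith [h'.2], by rw [hc, hd, h'.1, h'.2]; norm_num,
        braid_B h'.1 h'.2⟩
    · right; exact ⟨by linarith [h'.1], by linarith [h'.2], by rw [hc, hd, h'.1, h'.2]; norm_num,
        (braid_B h'.2 h'.1).symm⟩
  have c0 : c < 0 := by rcases hcd with h | h <;> linarith [h.1]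
  have d0 : d < 0 := by
    rcases hcd with h | h
    · linarith [h.2]
    · exact h.2.1
  obtain ⟨l2, r2, p2, q2, e2, -⟩ := D.descent hG q1 ha (neg l1 q1.1 a (D.simple_root ha) (by
    rw [e1, Module.End.mul_apply, sa, map_sub, map_smul, map_sub, map_smul, smul_eq_mul]
    have := mul_pos_of_neg_of_neg c0 wb
    linarith))
  have hcd1 : 0 ≤ c * d - 1 := by
    rcases hcd with h | h
    · rw [h.1, h.2]; norm_num
    · rw [h.2.2.1]; norm_num
  obtain ⟨l3, r3, p3, q3, e3, -⟩ := D.descent hG q2 hb (neg l2 q2.1 β (D.simple_root hb) (by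
    rw [e2, e1, Module.End.mul_apply, sb, map_sub, map_smul, Module.End.mul_apply,
      Module.End.mul_apply, sa, refl_self]
    simp only [map_sub, map_smul, map_neg, smul_eq_mul]
    have := mul_pos_of_neg_of_neg d0 wa
    have := mul_nonpos_of_nonneg_of_nonpos hcd1 wb.le
    nlinarith))
  rcases hcd with h | ⟨-, -, h, hbr⟩
  · have hfin : wordProd (l3 ++ [β, a, β]) = wordProd l := by
      have : l3 ++ [β, a, β] = (l3 ++ [β]) ++ [a] ++ [β] := by simp
      rw [this, wordProd_append, wordProd_append, p3, ← wordProd_append, p2, ← wordProd_append, p1]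
    have hlen : (l3 ++ [β, a, β]).length = l.length := by
      have u1 := hl.2 _ r1.1 p1
      have v1 := r1.2 _ hl.1 p1.symm
      have u2 := q1.2 _ r2.1 p2
      have v2 := r2.2 _ q1.1 p2.symm
      have u3 := q2.2 _ r3.1 p3
      have v3 := r3.2 _ q2.1 p3.symm
      simp at *; omega
    have hred := D.reduced_congr hl (D.isWord_append.mpr ⟨q3.1, by simp [IsWord, ha, hb]⟩) hfin hlen
    have := hfc.2 _ hred hfin β hb a ha hnc'
    rw [order_A hrne h.2 h.1] at this
    exact this ⟨l3, [], by simp [altWord]⟩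
  · obtain ⟨l4, r4, p4, q4, e4, -⟩ := D.descent hG q3 ha (neg l3 q3.1 a (D.simple_root ha) (by
      have : reflEnd β (reflEnd a (reflEnd β a)) = a := by
        rw [sa, map_sub, map_smul, refl_self, sb, map_sub, map_smul, map_sub, map_smul, refl_self,
          map_neg, sa]
        have : c • d • (a - c • β) = (2 : ℝ) • (a - c • β) := by rw [smul_smul, h]
        rw [smul_sub, this]; module
      rw [e3, e2, e1, Module.End.mul_apply, Module.End.mul_apply, Module.End.mul_apply, this]
      exact wa))
    have hfin : wordProd (l4 ++ [a, β, a, β]) = wordProd l := by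
      have : l4 ++ [a, β, a, β] = (l4 ++ [a]) ++ [β] ++ [a] ++ [β] := by simp
      rw [this, wordProd_append, wordProd_append, wordProd_append, p4, ← wordProd_append, p3,
        ← wordProd_append, p2, ← wordProd_append, p1]
    have hlen : (l4 ++ [a, β, a, β]).length = l.length := by
      have u1 := hl.2 _ r1.1 p1
      have v1 := r1.2 _ hl.1 p1.symm
      have u2 := q1.2 _ r2.1 p2
      have v2 := r2.2 _ q1.1 p2.symm
      have u3 := q2.2 _ r3.1 p3
      have v3 := r3.2 _ q2.1 p3.symm
      have u4 := q3.2 _ r4.1 p4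
      have v4 := r4.2 _ q3.1 p4.symm
      simp at *; omega
    have hred := D.reduced_congr hl (D.isWord_append.mpr ⟨q4.1, by simp [IsWord, ha, hb]⟩) hfin hlen
    have := hfc.2 _ hred hfin a ha β hb hnc
    rw [order_B hnc hbr] at this
    exact this ⟨l4, [], by simp [altWord]⟩

end RootSystemData



namespace RootSystemData

variable (D : RootSystemData V)

lemma no_bad_step (hG : D.NotG2) {l : List V} (hl : D.IsReducedWord l)
    (hfc : D.FullyCommutative (wordProd l))
    (IH : ∀ l', D.IsReducedWord l' → l'.length < l.length → D.FullyCommutative (wordProd l') →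
      ∀ a ∈ D.inversions (wordProd l'), ∀ b ∈ D.inversions (wordProd l'), 0 ≤ ⟪a, b⟫)
    {a β : V} (hβ : β ∈ D.simpleRoots) (hβi : β ∈ D.inversions (wordProd l))
    (ha : a ∈ D.inversions (wordProd l)) (hin : ⟪a, β⟫ < 0) : False := by
  obtain ⟨w, hwl⟩ : ∃ w, w = wordProd l := ⟨_, rfl⟩
  have hw : D.InWeyl w := ⟨l, hl.1, hwl.symm⟩
  have har := D.inv_root ha
  have hβr := D.simple_root hβ
  have hab : a ≠ β := by rintro rfl; linarith [D.inner_pos hβr]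
  have has : a ∉ D.simpleRoots := fun h =>
    D.simple_pair_not_fc hG hl h hβ ha hβi hin hfc
  -- (i)
  have H1 : ∀ s ∈ D.simpleRoots, s ∈ D.inversions w → ∀ x ∈ D.inversions w, ∀ y ∈ D.inversions w,
      ⟪x, y⟫ < 0 → x = s ∨ y = s := by
    intro s hs hsi x hx y hy hxy
    by_contra hcon
    push Not at hcon
    rw [hwl] at hsi hx hy
    obtain ⟨l', -, -, h3, h4, h5⟩ := D.descent hG hl hs hsi.2.2
    have hf := D.fc_step hG hfc hs hsi
    rw [← h4] at hf
    have := IH l' h3 (by omega) hf (reflEnd s x) (by rw [h4]; exact D.inv_step hG hs hx hcon.1)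
      (reflEnd s y) (by rw [h4]; exact D.inv_step hG hs hy hcon.2)
    rw [inner_refl_refl] at this
    linarith
  have notin : ∀ s ∈ D.simpleRoots, s ≠ β → s ∉ D.inversions w := by
    intro s hs hne hsi
    rcases H1 s hs hsi a (hwl ▸ ha) β (hwl ▸ hβi) hin with h | h
    · exact has (h ▸ hs)
    · exact hne h.symm
  have star := H1 β hβ (hwl ▸ hβi)
  obtain ⟨l1, -, -, r1, e1, k1⟩ := D.descent hG hl hβ hβi.2.2
  have fc1 := D.fc_step hG hfc hβ hβi
  have nb1 := IH l1 r1 (by omega) (by rw [e1]; exact fc1)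
  have asi : reflEnd β a ∈ D.inversions (wordProd l1) := by
    rw [e1]; exact D.inv_step hG hβ ha hab
  have K : ∀ τ ∈ D.simpleRoots, τ ∈ D.inversions (wordProd l1) → τ ≠ β ∧ ⟪τ, β⟫ < 0 ∧
      reflEnd β τ ∈ D.inversions w ∧ 0 ≤ ⟪a, reflEnd β τ⟫ ∧ reflEnd τ β ∉ D.inversions w ∧
      cpair τ β * cpair β τ = 2 := by
    intro τ hτ hτi
    have hτr := D.simple_root hτ
    have hne : τ ≠ β := by
      rintro rfl
      rw [e1] at hτi
      exact D.not_inv_mul hβi hτi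
    have hsi : reflEnd β τ ∈ D.inversions w := by
      rw [hwl]; exact D.inv_step_back hG hβ (e1 ▸ hτi) hne
    have hni := notin τ hτ hne
    have hneg : ⟪τ, β⟫ < 0 := by
      refine lt_of_le_of_ne (D.simple_inner hG hτ hβ hne) fun h => hni ?_
      rwa [refl_of_orth h] at hsi
    have hnn : 0 ≤ ⟪a, reflEnd β τ⟫ := by
      rw [← inner_refl_comm]; exact nb1 _ asi _ hτi
    have hc0 : cpair τ β < 0 := by
      unfold cpair; exact div_neg_of_neg_of_pos (by linarith) (D.inner_pos hβr)
    have hd0 : cpair β τ < 0 := by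
      unfold cpair
      exact div_neg_of_neg_of_pos (by rw [real_inner_comm]; linarith) (D.inner_pos hτr)
    have haτ : 0 < ⟪a, τ⟫ := by
      have h := hnn
      rw [refl_apply, inner_sub_right, inner_smul_right] at h
      have := mul_pos_of_neg_of_neg hc0 hin
      linarith
    have haτ' : a ≠ τ := fun h => has (h ▸ hτ)
    have htτ : 0 < D.ht (w τ) := by
      have := D.ht_ne hG (D.weyl_root hw hτr)
      by_contra hc
      exact hni ((D.mem_inv hG hw hτr).mpr ⟨D.ht_simple hG hτ, lt_of_le_of_ne (not_lt.mp hc) this⟩)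
    have ha'r := D.reflect_mem _ har _ hτr
    have ha'i : reflEnd τ a ∈ D.inversions w := by
      refine (D.mem_inv hG hw ha'r).mpr ⟨D.ht_pos hG (D.simple_refl_pos hG hτ ha.1 haτ'), ?_⟩
      rw [refl_apply, map_sub, map_smul, map_sub, map_smul, smul_eq_mul]
      have h1 : 0 < cpair a τ := div_pos (by linarith) (D.inner_pos hτr)
      have h2 := ((D.mem_inv hG hw har).mp (hwl ▸ ha)).2
      have := mul_pos h1 htτ
      linarith
    have hcc : cpair τ β * cpair β τ ≤ 2 ∧ (cpair τ β * cpair β τ = 2 ∨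
        (cpair τ β = -1 ∧ cpair β τ = -1)) := by
      rcases D.cpair_cases hG hτr hβr hne (D.pos_ne_neg hτ.1 hβ.1) with h' | h' | ⟨-, h' | h' | h'⟩
      · linarith [h'.1]
      · linarith [h'.1]
      all_goals rw [h'.1, h'.2]; norm_num
    have hout : reflEnd τ β ∉ D.inversions w := by
      intro hc
      rcases star _ ha'i _ hc (by rw [inner_refl_refl]; exact hin) with h | h
      · have h2 : a = reflEnd τ β := by rw [← h, refl_refl]
        rw [h2, refl_apply, inner_sub_left, inner_smul_left, RCLike.conj_to_real] at hin
        have h3 := cpair_mul (D.ne_zero _ hβr) τ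
        have := D.inner_pos hβr
        have : cpair β τ * ⟪τ, β⟫ = (cpair τ β * cpair β τ) * ⟪β, β⟫ / 2 := by
          linear_combination (-(1:ℝ)/2) * cpair β τ * h3
        rw [this] at hin
        nlinarith [hcc.1]
      · rw [refl_apply, sub_eq_self, smul_eq_zero] at h
        rcases h with h | h
        · linarith
        · exact D.ne_zero _ hτr h
    refine ⟨hne, hneg, hsi, hnn, hout, ?_⟩
    rcases hcc.2 with h | h
    · exact h
    · exfalso; apply hout
      rw [refl_of_cpair h.2]
      rw [refl_of_cpair h.1] at hsi
      convert hsi using 1; module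
  obtain ⟨τ, hτ, hτi⟩ := D.last_letter hG r1 asi
  obtain ⟨hτβ, hτβ0, hsτi, hsτa, hout, hcd⟩ := K τ hτ hτi
  have hτr := D.simple_root hτ
  obtain ⟨l2, -, -, r2, e2, k2⟩ := D.descent hG r1 hτ hτi.2.2
  have fc2 := D.fc_step hG (by rw [e1]; exact fc1) hτ hτi
  have nb2 := IH l2 r2 (by omega) (by rw [e2]; exact fc2)
  have hβτ0 : ⟪β, τ⟫ < 0 := by rw [real_inner_comm]; exact hτβ0
  have a2i : reflEnd τ (reflEnd β a) ∈ D.inversions (wordProd l2) := by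
    rw [e2]; refine D.inv_step hG hτ asi fun h => ?_
    have h2 : a = reflEnd β τ := by rw [← h, refl_refl]
    rw [h2, inner_refl_comm, refl_self, inner_neg_right] at hin
    linarith
  obtain ⟨σ, hσ, hσi⟩ := D.last_letter hG r2 a2i
  have hσr := D.simple_root hσ
  have hστ : σ ≠ τ := by
    rintro rfl
    rw [e2] at hσi
    exact D.not_inv_mul hτi hσi
  have dτβ := D.double_of hτr hβr hcd
  have dβτ := D.double_of hβr hτr (by rw [mul_comm]; exact hcd)
  have hσβ : σ ≠ β := by
    rintro rfl
    apply hout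
    have h0 : ⟪reflEnd τ σ, σ⟫ = 0 := by
      rw [inner_refl_left]
      have := (D.inner_pos hτr).ne'
      field_simp
      rw [real_inner_comm σ τ]
      linear_combination - dβτ
    have := D.inv_step_back hG hτ (e2 ▸ hσi) hστ
    rw [e1] at this
    refine ⟨D.simple_refl_pos hG hτ hσ.1 hστ, ?_⟩
    have h := this.2
    rw [Module.End.mul_apply, refl_of_orth h0] at h
    rw [hwl]; exact h
  have ha2σ := nb2 _ a2i _ hσi
  have hστ0 : ⟪σ, τ⟫ < 0 := by
    refine lt_of_le_of_ne (D.simple_inner hG hσ hτ hστ) fun h => ?_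
    have h2 := D.inv_step_back hG hτ (e2 ▸ hσi) hστ
    rw [refl_of_orth h] at h2
    obtain ⟨-, q1, -, -, -, q2⟩ := K σ hσ h2
    exact D.no_two_double hG hβ hτ hσ hβτ0 (by rw [real_inner_comm]; exact q1)
      (by rw [real_inner_comm, h]) dβτ (D.double_of hβr hσr (by rw [mul_comm]; exact q2))
  have hτσ0 : ⟪τ, σ⟫ < 0 := by rw [real_inner_comm]; exact hστ0
  have hβσ' : ⟪β, σ⟫ ≤ 0 := D.simple_inner hG hβ hσ hσβ.symm
  have hc1 : cpair τ σ = -1 ∧ cpair σ τ = -1 := by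
    rcases D.cpair_cases hG hτr hσr hστ.symm (D.pos_ne_neg hτ.1 hσ.1) with
      h' | h' | ⟨-, h' | h' | h'⟩
    · linarith [h'.1]
    · linarith [h'.1]
    · exact h'
    all_goals
      exact (D.no_two_double hG hτ hβ hσ hτβ0 hτσ0 hβσ' dτβ
        (D.double_of hτr hσr (by rw [h'.1, h'.2]; norm_num))).elim
  have f1 := cpair_mul (D.ne_zero _ hσr) τ
  have f2 := cpair_mul (D.ne_zero _ hτr) σ
  rw [hc1.1] at f1; rw [hc1.2] at f2
  rw [real_inner_comm τ σ] at f2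
  have hTS : ⟪σ, σ⟫ = ⟪τ, τ⟫ := by linarith
  have hT := D.inner_pos hτr
  have g1 := cpair_mul (D.ne_zero _ hβr) τ
  have g2 := cpair_mul (D.ne_zero _ hτr) β
  rw [real_inner_comm τ β] at g2
  have hBc : (⟪β, β⟫ = ⟪τ, τ⟫ / 2 ∧ ⟪τ, β⟫ = -(⟪τ, τ⟫ / 2)) ∨
      (⟪β, β⟫ = 2 * ⟪τ, τ⟫ ∧ ⟪τ, β⟫ = -⟪τ, τ⟫) := by
    rcases D.cpair_cases hG hτr hβr hτβ (D.pos_ne_neg hτ.1 hβ.1) with h' | h' | ⟨-, h' | h' | h'⟩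
    · linarith [h'.1]
    · linarith [h'.1]
    · rw [h'.1, h'.2] at hcd; norm_num at hcd
    · right; rw [h'.1] at g1; rw [h'.2] at g2; constructor <;> linarith
    · left; rw [h'.1] at g1; rw [h'.2] at g2; constructor <;> linarith
  have hβσ : ⟪β, σ⟫ = 0 := by
    by_contra hne
    have hlt := lt_of_le_of_ne hβσ' hne
    refine D.no_two_double hG hβ hτ hσ hβτ0 hlt hτσ0.le dβτ ?_
    apply D.double_of hβr hσr
    have m1 := cpair_mul (D.ne_zero _ hσr) β
    have m2 := cpair_mul (D.ne_zero _ hβr) σ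
    rw [real_inner_comm β σ] at m2
    rcases D.cpair_cases hG hβr hσr hσβ.symm (D.pos_ne_neg hβ.1 hσ.1) with
      h' | h' | ⟨-, h' | h' | h'⟩
    · linarith [h'.1]
    · linarith [h'.1]
    · exfalso; rw [h'.1] at m1; rw [h'.2] at m2
      rcases hBc with h | h <;> linarith [h.1]
    all_goals rw [h'.1, h'.2]; norm_num
  have hσβ0 : ⟪σ, β⟫ = 0 := by rw [real_inner_comm]; exact hβσ
  -- choose κ
  obtain ⟨κ, hκ, hBB, hτβv⟩ : ∃ κ : ℝ, 0 < κ ∧ ⟪β, β⟫ = κ ^ 2 * (⟪τ, τ⟫ / 2) ∧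
      ⟪τ, β⟫ = -(κ * (⟪τ, τ⟫ / 2)) := by
    rcases hBc with h | h
    · exact ⟨1, by norm_num, by rw [h.1]; ring, by rw [h.2]; ring⟩
    · exact ⟨2, by norm_num, by rw [h.1]; ring, by rw [h.2]; ring⟩
  obtain ⟨e3, he3⟩ : ∃ e3, β = κ • e3 := ⟨κ⁻¹ • β, by rw [smul_smul, mul_inv_cancel₀ hκ.ne', one_smul]⟩
  subst he3
  have i33 : ⟪e3, e3⟫ = ⟪τ, τ⟫ / 2 := by
    rw [inner_smul_left, inner_smul_right, RCLike.conj_to_real] at hBB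
    apply mul_left_cancel₀ (pow_ne_zero 2 hκ.ne'); rw [← hBB]; ring
  have iτ3 : ⟪τ, e3⟫ = -(⟪τ, τ⟫ / 2) := by
    rw [inner_smul_right] at hτβv
    apply mul_left_cancel₀ hκ.ne'; rw [hτβv]; ring
  have iσ3 : ⟪σ, e3⟫ = 0 := by
    rw [inner_smul_right] at hσβ0
    exact (mul_eq_zero.mp hσβ0).resolve_left hκ.ne'
  have iστ : ⟪σ, τ⟫ = -(⟪τ, τ⟫ / 2) := by rw [real_inner_comm]; linarith
  have iτσ : ⟪τ, σ⟫ = -(⟪τ, τ⟫ / 2) := by linarith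
  have i3τ : ⟪e3, τ⟫ = -(⟪τ, τ⟫ / 2) := by rw [real_inner_comm]; exact iτ3
  have i3σ : ⟪e3, σ⟫ = 0 := by rw [real_inner_comm]; exact iσ3
  have st3 : reflEnd τ e3 = τ + e3 := by
    rw [refl_of_cpair (cpair_eq (D.ne_zero _ hτr) (c := -1) (by rw [i3τ]; ring))]; module
  have sbτ : reflEnd (κ • e3) τ = τ + (2 : ℝ) • e3 := by
    rw [refl_of_cpair (cpair_eq (D.ne_zero _ hβr) (c := -2 / κ) (by
      rw [hBB, hτβv]; field_simp))]
    rw [smul_smul, div_mul_cancel₀ _ hκ.ne']; module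
  have sbσ : reflEnd (κ • e3) σ = σ := refl_of_orth hσβ0
  have stσ : reflEnd τ σ = σ + τ := by rw [refl_of_cpair hc1.2]; module
  have ha3 : ⟪a, e3⟫ < 0 := by
    rw [inner_smul_right] at hin
    by_contra hc
    have := mul_nonneg hκ.le (not_lt.mp hc)
    linarith
  refine D.final_conf hG hw (a := a) (e1 := σ + τ + e3) (e2 := τ + e3) (e3 := e3) (κ := κ)
    (T := ⟪τ, τ⟫) hT hκ ?_ ?_ i33 ?_ ?_ ?_ hβ (by simpa using hτ) (by simpa [add_assoc] using hσ) (hwl ▸ ha) ha3 ?_ ?_ ?_ ?_ ?_ star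
  · simp only [inner_add_left, inner_add_right, hTS, iστ, iτσ, iσ3, i3σ, iτ3, i3τ, i33]; ring
  · simp only [inner_add_left, inner_add_right, hTS, iστ, iτσ, iσ3, i3σ, iτ3, i3τ, i33]; ring
  · simp only [inner_add_left, inner_add_right, hTS, iστ, iτσ, iσ3, i3σ, iτ3, i3τ, i33]; ring
  · simp only [inner_add_left, inner_add_right, hTS, iστ, iτσ, iσ3, i3σ, iτ3, i3τ, i33]; ring
  · simp only [inner_add_left, inner_add_right, hTS, iστ, iτσ, iσ3, i3σ, iτ3, i3τ, i33]; ring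
  · rw [sbτ, inner_add_right, inner_smul_right] at hsτa
    rw [inner_add_right]; linarith
  · rw [inner_refl_comm, inner_refl_comm, stσ, map_add, sbσ, sbτ] at ha2σ
    simp only [inner_add_right, inner_smul_right] at ha2σ ⊢; linarith
  · rw [sbτ] at hsτi
    convert hsτi using 1; module
  · have h1 : σ + τ + e3 - (τ + e3) = σ := by abel
    rw [h1]
    by_contra hc
    exact notin σ hσ hσβ ((D.mem_inv hG hw hσr).mpr ⟨D.ht_simple hG hσ,
      lt_of_le_of_ne (not_lt.mp hc) (D.ht_ne hG (D.weyl_root hw hσr))⟩)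
  · rw [map_smul, st3] at hout
    have hr : κ • (τ + e3) ∈ D.roots := by
      have := D.reflect_mem _ hβr _ hτr
      rwa [map_smul, st3] at this
    have hp : κ • (τ + e3) ∈ D.pos := by
      have := D.simple_refl_pos hG hτ hβ.1 hτβ.symm
      rwa [map_smul, st3] at this
    have h1 : 0 < D.ht (w (κ • (τ + e3))) := by
      by_contra hc
      exact hout ((D.mem_inv hG hw hr).mpr ⟨D.ht_pos hG hp,
        lt_of_le_of_ne (not_lt.mp hc) (D.ht_ne hG (D.weyl_root hw hr))⟩)
    rw [map_smul, map_smul, smul_eq_mul] at h1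
    exact (mul_pos_iff_of_pos_left hκ).mp h1

lemma no_bad_aux (hG : D.NotG2) : ∀ (n : ℕ) (l : List V), l.length = n → D.IsReducedWord l →
    D.FullyCommutative (wordProd l) →
      ∀ a ∈ D.inversions (wordProd l), ∀ b ∈ D.inversions (wordProd l), 0 ≤ ⟪a, b⟫ := by
  intro n
  induction n using Nat.strong_induction_on with
  | _ n ih =>
    intro l hn hl hfc a ha b hb
    by_contra hc
    push Not at hc
    have IH : ∀ l', D.IsReducedWord l' → l'.length < l.length → D.FullyCommutative (wordProd l') →
        ∀ a ∈ D.inversions (wordProd l'), ∀ b ∈ D.inversions (wordProd l'), 0 ≤ ⟪a, b⟫ :=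
      fun l' h1 h2 h3 => ih _ (hn ▸ h2) l' rfl h1 h3
    obtain ⟨β, hβ, hβi⟩ := D.last_letter hG hl ha
    have : a = β ∨ b = β := by
      by_contra hcon
      push Not at hcon
      obtain ⟨l', -, -, h3, h4, h5⟩ := D.descent hG hl hβ hβi.2.2
      have hf := D.fc_step hG hfc hβ hβi
      rw [← h4] at hf
      have := IH l' h3 (by omega) hf (reflEnd β a) (by rw [h4]; exact D.inv_step hG hβ ha hcon.1)
        (reflEnd β b) (by rw [h4]; exact D.inv_step hG hβ hb hcon.2)
      rw [inner_refl_refl] at this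
      linarith
    rcases this with rfl | rfl
    · exact D.no_bad_step hG hl hfc IH hβ hβi hb (by rw [real_inner_comm]; exact hc)
    · exact D.no_bad_step hG hl hfc IH hβ hβi ha hc

/-- Combinatorial characterization of fully commutative elements. -/
theorem fc_iff (hG : D.NotG2) {w : Module.End ℝ V} (hw : D.InWeyl w) :
    D.FullyCommutative w ↔ ∀ a ∈ D.inversions w, ∀ b ∈ D.inversions w, 0 ≤ ⟪a, b⟫ := by
  constructor
  · intro h
    obtain ⟨l, hl, rfl⟩ := D.exists_reduced hw
    exact D.no_bad_aux hG _ l rfl hl h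
  · intro h
    by_contra hc
    obtain ⟨a, ha, b, hb, hab⟩ := D.bad_of_not_fc hG hw hc
    linarith [h a ha b hb]

end RootSystemData



namespace LieRootData

variable {L : Type*} [LieRing L] [LieAlgebra ℂ L] (D : LieRootData V L)

lemma exists_rs {α : V} (h : α ∈ D.roots) : ∃ x ∈ D.rs α, x ≠ 0 := by
  have h1 := D.rs_dim α h
  apply (Submodule.ne_bot_iff _).mp
  intro hb
  rw [hb] at h1
  simp at h1

lemma sl2_aux {a b : V} (ha : a ∈ D.roots) (hb : b ∈ D.roots) (hab : a + b ∈ D.roots)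
    (h1 : -a + b ∉ D.roots) (h1' : -a + b ≠ 0) (h2 : a + (a + b) ∉ D.roots)
    (h2' : a + (a + b) ≠ 0) {x y f : L} (hx : x ∈ D.rs a) (hy : y ∈ D.rs b) (hx0 : x ≠ 0)
    (hy0 : y ≠ 0) (hf : f ∈ D.rs (-a)) (hf0 : f ≠ 0) :
    ∃ l : ℂ, l ≠ 0 ∧ ⁅f, ⁅x, y⁆⁆ = l • y ∧ ⁅⁅x, f⁆, y⁆ = -(l • y) ∧ ⁅⁅x, f⁆, x⁆ = (2 * l) • x := by
  have hna := D.toRootSystemData.neg_mem ha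
  have hh := D.bracket_cartan_mem a ha x hx f hf
  obtain ⟨c, hc⟩ := D.weight_vec b hb _ hh y hy
  obtain ⟨d, hd⟩ := D.weight_vec a ha _ hh x hx
  have hfy : ⁅f, y⁆ = 0 := D.bracket_eq_zero _ hna _ hb h1 h1' f hf y hy
  have hz := D.bracket_mem a ha b hb hab x hx y hy
  have hz0 := D.bracket_ne_zero a ha b hb hab x hx hx0 y hy hy0
  have hxz : ⁅x, ⁅x, y⁆⁆ = 0 := D.bracket_eq_zero _ ha _ hab h2 h2' x hx _ hz
  have hfz : ⁅f, ⁅x, y⁆⁆ = -(c • y) := by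
    rw [leibniz_lie, hfy, lie_zero, add_zero, ← lie_skew f x, neg_lie, hc]
  have hfz0 : ⁅f, ⁅x, y⁆⁆ ≠ 0 :=
    D.bracket_ne_zero _ hna _ hab (by simpa using hb) f hf hf0 _ hz hz0
  have e1 : ⁅⁅x, f⁆, ⁅x, y⁆⁆ = (d + c) • ⁅x, y⁆ := by
    rw [leibniz_lie, hd, hc, smul_lie, lie_smul, add_smul]
  have e2 : ⁅⁅x, f⁆, ⁅x, y⁆⁆ = (-c) • ⁅x, y⁆ := by
    rw [lie_lie, hxz, lie_zero, sub_zero, hfz, lie_neg, lie_smul, neg_smul]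
  have e3 : d + c = -c := smul_left_injective ℂ hz0 (e1.symm.trans e2)
  refine ⟨-c, ?_, ?_, ?_, ?_⟩
  · intro h; apply hfz0; rw [hfz, neg_eq_zero.mp h]; simp
  · rw [hfz, neg_smul]
  · rw [hc, neg_smul, neg_neg]
  · rw [hd]; congr 1; linear_combination e3

lemma not_root_of_norm (hG : D.NotG2) (hI : D.IsIrreducible) {a v : V} (ha : a ∈ D.roots)
    {k : ℝ} (hk : ⟪v, v⟫ = k * ⟪a, a⟫) (h2 : 2 < k) : v ∉ D.roots ∧ v ≠ 0 := by
  have hp := D.toRootSystemData.inner_pos ha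
  constructor
  · intro hv
    rcases D.toRootSystemData.ratio hG hI hv ha with h | h | h <;> nlinarith
  · rintro rfl
    rw [inner_zero_left] at hk; nlinarith

lemma ad4_apply (x y : L) : ((LieAlgebra.ad ℂ L x) ^ 4) y = ⁅x, ⁅x, ⁅x, ⁅x, y⁆⁆⁆⁆ := by
  simp [pow_succ]

lemma not_sph_A (hG : D.NotG2) (hI : D.IsIrreducible) {a b : V} (ha : a ∈ D.roots)
    (hb : b ∈ D.roots) (h1 : cpair a b = -1) (h2 : cpair b a = -1)
    {x y : L} (hx : x ∈ D.rs a) (hy : y ∈ D.rs b) (hx0 : x ≠ 0) (hy0 : y ≠ 0) :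
    (LieAlgebra.ad ℂ L (x + y)) ^ 4 ≠ 0 := by
  have c1 := cpair_mul (D.ne_zero b hb) a
  have c2 := cpair_mul (D.ne_zero a ha) b
  rw [real_inner_comm a b] at c2
  rw [h1] at c1; rw [h2] at c2
  have pa := D.toRootSystemData.inner_pos ha
  have hab : a + b ∈ D.roots := D.toRootSystemData.add_mem hG ha hb
    (by rintro rfl; rw [inner_neg_left] at c1; linarith [D.toRootSystemData.inner_pos hb]) (by linarith)
  have hba : b + a ∈ D.roots := by rwa [add_comm]
  obtain ⟨n1, n1'⟩ := D.not_root_of_norm hG hI (v := -a + b) ha (k := 3) (by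
    simp only [inner_add_left, inner_add_right, inner_neg_left, inner_neg_right,
      real_inner_comm a b]; linarith) (by norm_num)
  obtain ⟨n2, n2'⟩ := D.not_root_of_norm hG hI (v := -b + a) ha (k := 3) (by
    simp only [inner_add_left, inner_add_right, inner_neg_left, inner_neg_right,
      real_inner_comm a b]; linarith) (by norm_num)
  obtain ⟨n3, n3'⟩ := D.not_root_of_norm hG hI (v := a + (a + b)) ha (k := 3) (by
    simp only [inner_add_left, inner_add_right, inner_neg_left, inner_neg_right,
      real_inner_comm a b]; linarith) (by norm_num)
  obtain ⟨n4, n4'⟩ := D.not_root_of_norm hG hI (v := b + (b + a)) ha (k := 3) (by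
    simp only [inner_add_left, inner_add_right, inner_neg_left, inner_neg_right,
      real_inner_comm a b]; linarith) (by norm_num)
  have hna := D.toRootSystemData.neg_mem ha
  have hnb := D.toRootSystemData.neg_mem hb
  have hnab := D.toRootSystemData.neg_mem hab
  obtain ⟨t, ht, ht0⟩ := D.exists_rs hnab
  have sa : b + -(a + b) = -a := by abel
  have sb : a + -(a + b) = -b := by abel
  have fa : ⁅y, t⁆ ∈ D.rs (-a) := by
    have := D.bracket_mem _ hb _ hnab (by rw [sa]; exact hna) y hy t ht
    rwa [sa] at this
  have fb : ⁅x, t⁆ ∈ D.rs (-b) := by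
    have := D.bracket_mem _ ha _ hnab (by rw [sb]; exact hnb) x hx t ht
    rwa [sb] at this
  have fa0 := D.bracket_ne_zero _ hb _ hnab (by rw [sa]; exact hna) y hy hy0 t ht ht0
  have fb0 := D.bracket_ne_zero _ ha _ hnab (by rw [sb]; exact hnb) x hx hx0 t ht ht0
  obtain ⟨l, hl0, l1, l2, l3⟩ := D.sl2_aux ha hb hab n1 n1' n3 n3' hx hy hx0 hy0 fa fa0
  obtain ⟨m, hm0, m1, m2, m3⟩ := D.sl2_aux hb ha hba n2 n2' n4 n4' hy hx hy0 hx0 fb fb0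
  have z0 := D.bracket_ne_zero a ha b hb hab x hx hx0 y hy hy0
  have hz := D.bracket_mem a ha b hb hab x hx y hy
  have q1 : ⁅x, ⁅x, t⁆⁆ = 0 :=
    D.bracket_eq_zero _ ha _ hnb (by rwa [add_comm]) (by rwa [add_comm]) x hx _ fb
  have q2 : ⁅y, ⁅y, t⁆⁆ = 0 :=
    D.bracket_eq_zero _ hb _ hna (by rwa [add_comm]) (by rwa [add_comm]) y hy _ fa
  have q3 : ⁅y, ⁅x, y⁆⁆ = 0 :=
    D.bracket_eq_zero _ hb _ hab (by rwa [add_comm a b]) (by rwa [add_comm a b]) y hy _ hz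
  have hlm : m = -l := by
    have e : ⁅⁅y, t⁆, ⁅x, y⁆⁆ = (-l - 2 * m) • y := by
      rw [lie_lie, q3, lie_zero, sub_zero, ← lie_skew t, lie_neg, lie_skew, lie_lie x y t, sub_lie, l2, m3]
      module
    rw [l1] at e
    have := smul_left_injective ℂ hy0 e
    linear_combination (1/2 : ℂ) * this
  intro h
  have h4 := LinearMap.congr_fun h t
  rw [ad4_apply, LinearMap.zero_apply] at h4
  have s2 : ⁅x + y, ⁅x + y, t⁆⁆ = ⁅x, ⁅y, t⁆⁆ + ⁅y, ⁅x, t⁆⁆ := by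
    rw [add_lie x y t, lie_add, add_lie, add_lie, q1, q2]; abel
  have s3 : ⁅x + y, ⁅x + y, ⁅x + y, t⁆⁆⁆ = (m - 2 * l) • x + (l - 2 * m) • y := by
    rw [s2, ← lie_skew, lie_add, add_lie, add_lie, l2, l3, m2, m3]; module
  rw [s3, lie_add, lie_smul, lie_smul, add_lie, add_lie, lie_self, lie_self, ← lie_skew y x, hlm] at h4
  have : (6 * l) • ⁅x, y⁆ = 0 := by rw [← h4]; module
  rcases smul_eq_zero.mp this with h | h
  · exact hl0 (by simpa using h)
  · exact z0 h

lemma not_sph_B (hG : D.NotG2) (hI : D.IsIrreducible) {a b : V} (ha : a ∈ D.roots)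
    (hb : b ∈ D.roots) (h1 : cpair a b = -1) (h2 : cpair b a = -2)
    {x y : L} (hx : x ∈ D.rs a) (hy : y ∈ D.rs b) (hx0 : x ≠ 0) (hy0 : y ≠ 0) :
    (LieAlgebra.ad ℂ L (x + y)) ^ 4 ≠ 0 := by
  have c1 := cpair_mul (D.ne_zero b hb) a
  have c2 := cpair_mul (D.ne_zero a ha) b
  rw [real_inner_comm a b] at c2
  rw [h1] at c1; rw [h2] at c2
  have pa := D.toRootSystemData.inner_pos ha
  have hab : a + b ∈ D.roots := D.toRootSystemData.add_mem hG ha hb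
    (by rintro rfl; rw [inner_neg_left, inner_neg_right] at *; linarith) (by linarith)
  have haab : a + (a + b) ∈ D.roots := by
    have := D.reflect_mem _ hb _ ha
    rw [refl_of_cpair h2] at this
    convert this using 1; module
  have hba : b + a ∈ D.roots := by rwa [add_comm]
  obtain ⟨n2, n2'⟩ := D.not_root_of_norm hG hI (v := -b + a) ha (k := 5) (by
    simp only [inner_add_left, inner_add_right, inner_neg_left, inner_neg_right,
      real_inner_comm a b]; linarith) (by norm_num)
  obtain ⟨n4, n4'⟩ := D.not_root_of_norm hG hI (v := b + (b + a)) ha (k := 5) (by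
    simp only [inner_add_left, inner_add_right, inner_neg_left, inner_neg_right,
      real_inner_comm a b]; linarith) (by norm_num)
  have hnb := D.toRootSystemData.neg_mem hb
  obtain ⟨f, hf, hf0⟩ := D.exists_rs hnb
  obtain ⟨l, hl0, l1, l2, l3⟩ := D.sl2_aux hb ha hba n2 n2' n4 n4' hy hx hy0 hx0 hf hf0
  have z0 := D.bracket_ne_zero a ha b hb hab x hx hx0 y hy hy0
  have hz := D.bracket_mem a ha b hb hab x hx y hy
  have q1 : ⁅x, f⁆ = 0 :=
    D.bracket_eq_zero _ ha _ hnb (by rwa [add_comm]) (by rwa [add_comm]) x hx _ hf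
  have q3 : ⁅y, ⁅x, y⁆⁆ = 0 :=
    D.bracket_eq_zero _ hb _ hab (by rwa [add_comm a b]) (by rwa [add_comm a b]) y hy _ hz
  have q4 := D.bracket_ne_zero _ ha _ hab haab x hx hx0 _ hz z0
  intro h
  have h4 := LinearMap.congr_fun h f
  rw [ad4_apply, LinearMap.zero_apply] at h4
  have s2 : ⁅x + y, ⁅x + y, f⁆⁆ = l • x - (2 * l) • y := by
    rw [add_lie x y f, q1, zero_add, ← lie_skew, lie_add, l2, l3]; abel
  have s3 : ⁅x + y, ⁅x + y, ⁅x + y, f⁆⁆⁆ = (-3 * l) • ⁅x, y⁆ := by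
    rw [s2, lie_sub, lie_smul, lie_smul, add_lie, add_lie, lie_self, lie_self, ← lie_skew y x]
    module
  rw [s3, lie_smul, add_lie, q3, add_zero] at h4
  rcases smul_eq_zero.mp h4 with h | h
  · exact hl0 (by simpa using h)
  · exact q4 h

lemma not_sph (hG : D.NotG2) (hI : D.IsIrreducible) {S : Set V} {a b : V} (ha : a ∈ S)
    (hb : b ∈ S) (hS : S ⊆ D.pos) (hab : ⟪a, b⟫ < 0) : ¬ IsSphericalSubspace (D.aSubspace S) := by
  intro hsph
  have hra := D.pos_subset (hS ha)
  have hrb := D.pos_subset (hS hb)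
  obtain ⟨x, hx, hx0⟩ := D.exists_rs hra
  obtain ⟨y, hy, hy0⟩ := D.exists_rs hrb
  have hmem : x + y ∈ D.aSubspace S :=
    Submodule.add_mem _ (Submodule.mem_iSup_of_mem a (Submodule.mem_iSup_of_mem ha hx))
      (Submodule.mem_iSup_of_mem b (Submodule.mem_iSup_of_mem hb hy))
  have h4 := hsph _ hmem
  have hne : a ≠ b := by
    rintro rfl; linarith [D.toRootSystemData.inner_pos hra]
  rcases D.toRootSystemData.cpair_cases hG hra hrb hne
    (D.toRootSystemData.pos_ne_neg (hS ha) (hS hb)) with h' | h' | ⟨-, h' | h' | h'⟩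
  · linarith [h'.1]
  · linarith [h'.1]
  · exact D.not_sph_A hG hI hra hrb h'.1 h'.2 hx hy hx0 hy0 h4
  · exact D.not_sph_B hG hI hra hrb h'.1 h'.2 hx hy hx0 hy0 h4
  · rw [add_comm] at h4
    exact D.not_sph_B hG hI hrb hra h'.2 h'.1 hy hx hy0 hx0 h4

end LieRootData



/-- Normalized integral inner product. -/
def zq (N : ℝ) (a b : V) : ℤ := ⌊2 * ⟪a, b⟫ / N⌋

namespace RootSystemData

variable (D : RootSystemData V)

/-- `N` is the squared length of short roots. -/
def Scale (N : ℝ) : Prop := 0 < N ∧ ∀ α ∈ D.roots, ⟪α, α⟫ = N ∨ ⟪α, α⟫ = 2 * N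

variable {D} {N : ℝ}

lemma zq_spec (hN : D.Scale N) {a b : V} (ha : a ∈ D.roots) (hb : b ∈ D.roots) :
    2 * ⟪a, b⟫ = (zq N a b : ℝ) * N := by
  obtain ⟨k, hk⟩ := D.crystallographic a ha b hb
  have h := cpair_mul (D.ne_zero b hb) a
  have key : ∀ m : ℤ, 2 * ⟪a, b⟫ = m * N → 2 * ⟪a, b⟫ = (zq N a b : ℝ) * N := by
    intro m hm
    have : 2 * ⟪a, b⟫ / N = (m : ℝ) := by rw [hm]; field_simp [hN.1.ne']
    rw [zq, this, Int.floor_intCast, hm]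
  rw [hk] at h
  rcases hN.2 b hb with h' | h'
  · exact key k (by rw [← h, h'])
  · exact key (2 * k) (by rw [← h, h']; push_cast; ring)

lemma zq_unique (hN : D.Scale N) {a b : V} {m : ℤ} (h : 2 * ⟪a, b⟫ = m * N) : zq N a b = m := by
  have : 2 * ⟪a, b⟫ / N = (m : ℝ) := by rw [h]; field_simp [hN.1.ne']
  rw [zq, this, Int.floor_intCast]

lemma zq_comm (a b : V) : zq N a b = zq N b a := by rw [zq, zq, real_inner_comm]

lemma zq_self (hN : D.Scale N) {a : V} (ha : a ∈ D.roots) : zq N a a = 2 ∨ zq N a a = 4 := by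
  rcases hN.2 a ha with h | h
  · left; exact zq_unique hN (by rw [h]; norm_num)
  · right; exact zq_unique hN (by rw [h]; push_cast; ring)

lemma zq_neg_right (hN : D.Scale N) {a b : V} (ha : a ∈ D.roots) (hb : b ∈ D.roots) :
    zq N a (-b) = - zq N a b := by
  apply zq_unique hN
  rw [inner_neg_right, mul_neg, zq_spec hN ha hb]; push_cast; ring

lemma zq_even (hN : D.Scale N) {a b : V} (ha : a ∈ D.roots) (hb : b ∈ D.roots)
    (h : zq N b b = 4) : (2 : ℤ) ∣ zq N a b := by
  obtain ⟨k, hk⟩ := D.crystallographic a ha b hb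
  have h1 := cpair_mul (D.ne_zero b hb) a
  have h2 := zq_spec hN hb hb
  rw [h] at h2
  have h3 : ⟪b, b⟫ = 2 * N := by push_cast at h2; linarith
  refine ⟨k, zq_unique hN ?_⟩
  rw [← h1, hk, h3]; push_cast; ring

lemma zq_lt (hN : D.Scale N) {a b : V} (ha : a ∈ D.roots) (hb : b ∈ D.roots)
    (h1 : a ≠ b) (h2 : a ≠ -b) : zq N a b * zq N a b < zq N a a * zq N b b := by
  have h := D.cs_lt ha hb h1 h2
  have e1 := zq_spec hN ha hb
  have e2 := zq_spec hN ha ha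
  have e3 := zq_spec hN hb hb
  have : ((zq N a b : ℝ) * N) * (zq N a b * N) < (zq N a a * N) * (zq N b b * N) := by
    rw [← e1, ← e2, ← e3]; linarith
  have h4 : ((zq N a b : ℝ) * zq N a b) < (zq N a a * zq N b b) := by
    have p := mul_pos hN.1 hN.1
    by_contra hc
    push Not at hc
    have := mul_le_mul_of_nonneg_right hc p.le
    linarith
  exact_mod_cast h4

lemma zq_le (hN : D.Scale N) {a b : V} (ha : a ∈ D.roots) (hb : b ∈ D.roots)
    (h1 : a ≠ b) : zq N a b ≤ 2 ∧ (zq N a a = 2 → zq N b b = 2 → zq N a b ≤ 1) := by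
  by_cases h2 : a = -b
  · subst h2
    rw [zq_comm, zq_neg_right hN hb hb]
    rcases zq_self hN hb with h | h <;> rw [h] <;> norm_num
  · have h := zq_lt hN ha hb h1 h2
    have ev := zq_even hN ha hb
    rcases zq_self hN ha with ea | ea <;> rcases zq_self hN hb with eb | eb <;>
      rw [ea, eb] at h ⊢
    · have : zq N a b ≤ 1 := by nlinarith
      omega
    · have : zq N a b ≤ 2 := by nlinarith
      omega
    · have : zq N a b ≤ 2 := by nlinarith
      omega
    · have : zq N a b ≤ 3 := by nlinarith
      have := ev eb
      omega

lemma zq_ge (hN : D.Scale N) {a b : V} (ha : a ∈ D.roots) (hb : b ∈ D.roots)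
    (h1 : a ≠ -b) : -2 ≤ zq N a b ∧ (zq N a a = 2 → zq N b b = 2 → -1 ≤ zq N a b) := by
  have hnb := D.neg_mem hb
  have := zq_le hN ha hnb h1
  rw [zq_neg_right hN ha hb, zq_neg_right hN hnb hb, zq_comm (-b), zq_neg_right hN hb hb] at this
  constructor
  · omega
  · intro h h'; have := this.2 h (by omega); omega

lemma zq_eq_of (hN : D.Scale N) {a b : V} (ha : a ∈ D.roots) (hb : b ∈ D.roots)
    (ea : zq N a a = 2) (eb : zq N b b = 2) (h : zq N a b = 2) : a = b := by
  by_contra hne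
  have := (zq_le hN ha hb hne).2 ea eb
  omega

/-- Vanishing of vectors with nonpositive norm. -/
lemma eq_zero_of_inner {v : V} (h : ⟪v, v⟫ ≤ 0) : v = 0 := by
  rw [← inner_self_eq_zero (𝕜 := ℝ)]
  exact le_antisymm h real_inner_self_nonneg

/-- a root of norm larger than `4` does not exist. -/
lemma no_root_of (hN : D.Scale N) {v : V} (h : 2 * N < ⟪v, v⟫) : v ∉ D.roots ∧ v ≠ 0 := by
  constructor
  · intro hv
    rcases hN.2 v hv with h' | h' <;> linarith [hN.1]
  · rintro rfl
    rw [inner_zero_left] at h; linarith [hN.1]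

/-- numerical data for one element of a path -/
def Row (n d d' u v r : ℤ) : Prop :=
  v = u + n + r ∧ -2 ≤ u ∧ v ≤ 2 ∧ (n = 2 ∨ n = 4) ∧ (d = 4 → 2 ∣ u) ∧ (d' = 4 → 2 ∣ v) ∧
    (n = 2 → d = 2 → -1 ≤ u) ∧ (n = 2 → d' = 2 → v ≤ 1) ∧ 0 ≤ r

lemma row_of (hN : D.Scale N) {g x y z δ δ' : V} (hg : g ∈ D.roots) (hx : x ∈ D.roots)
    (hy : y ∈ D.roots) (hz : z ∈ D.roots) (hδ : δ ∈ D.roots) (hδ' : δ' ∈ D.roots)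
    (gx : 0 ≤ ⟪g, x⟫) (gy : 0 ≤ ⟪g, y⟫) (gz : 0 ≤ ⟪g, z⟫) (xy : 0 ≤ ⟪x, y⟫) (xz : 0 ≤ ⟪x, z⟫)
    (yz : 0 ≤ ⟪y, z⟫) (h : δ' = δ + (g + x + y + z)) :
    Row (zq N g g) (zq N δ δ) (zq N δ' δ') (zq N g δ) (zq N g δ')
      (zq N g x + zq N g y + zq N g z) ∧ 0 ≤ zq N g x ∧ 0 ≤ zq N g y ∧ 0 ≤ zq N g z := by
  have big : 2 * N < ⟪x + y + z, x + y + z⟫ := by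
    simp only [inner_add_left, inner_add_right]
    rw [real_inner_comm x y, real_inner_comm x z, real_inner_comm y z]
    have hNN := hN.1
    rcases hN.2 x hx with h1 | h1 <;> rcases hN.2 y hy with h2 | h2 <;>
      rcases hN.2 z hz with h3 | h3 <;> rw [h1, h2, h3] <;> linarith
  have n1 : g ≠ δ' := by
    rintro rfl
    have : δ = -(x + y + z) := by
      rw [← sub_eq_zero]
      have := sub_eq_zero.mpr h
      rw [← neg_eq_zero, ← this]; abel
    rw [this] at hδ
    exact (no_root_of hN big).1 (D.neg_mem_iff.mp hδ)
  have n2 : g ≠ -δ := by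
    intro h2
    have : δ' = x + y + z := by rw [h, h2]; abel
    rw [this] at hδ'
    exact (no_root_of hN big).1 hδ'
  have nn : ∀ {x : V}, x ∈ D.roots → 0 ≤ ⟪g, x⟫ → 0 ≤ zq N g x := by
    intro x hx h0
    have := zq_spec hN hg hx
    have h2 : (0 : ℝ) ≤ zq N g x := by
      by_contra hc
      push Not at hc
      have := mul_neg_of_neg_of_pos hc hN.1
      linarith
    exact_mod_cast h2
  have qx := nn hx gx
  have qy := nn hy gy
  have qz := nn hz gz
  refine ⟨⟨?_, (zq_ge hN hg hδ n2).1, (zq_le hN hg hδ' n1).1, zq_self hN hg, zq_even hN hg hδ,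
    zq_even hN hg hδ', (zq_ge hN hg hδ n2).2, (zq_le hN hg hδ' n1).2, by omega⟩, qx, qy, qz⟩
  apply zq_unique hN
  rw [h]
  simp only [inner_add_right]
  have e1 := zq_spec hN hg hδ
  have e2 := zq_spec hN hg hg
  have e3 := zq_spec hN hg hx
  have e4 := zq_spec hN hg hy
  have e5 := zq_spec hN hg hz
  push_cast
  linear_combination e1 + e2 + e3 + e4 + e5

/-- All the numerical consequences of a path. -/
structure Path (N : ℝ) (a b c e δ δ' : V) : Prop where
  ra : Row (zq N a a) (zq N δ δ) (zq N δ' δ') (zq N a δ) (zq N a δ')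
    (zq N a b + zq N a c + zq N a e)
  rb : Row (zq N b b) (zq N δ δ) (zq N δ' δ') (zq N b δ) (zq N b δ')
    (zq N a b + zq N b c + zq N b e)
  rc : Row (zq N c c) (zq N δ δ) (zq N δ' δ') (zq N c δ) (zq N c δ')
    (zq N a c + zq N b c + zq N c e)
  re : Row (zq N e e) (zq N δ δ) (zq N δ' δ') (zq N e δ) (zq N e δ')
    (zq N a e + zq N b e + zq N c e)
  ab : 0 ≤ zq N a b
  ac : 0 ≤ zq N a c
  ae : 0 ≤ zq N a e
  bc : 0 ≤ zq N b c
  be : 0 ≤ zq N b e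
  ce : 0 ≤ zq N c e
  d : zq N δ δ = 2 ∨ zq N δ δ = 4
  d' : zq N δ' δ' = 2 ∨ zq N δ' δ' = 4
  dd : zq N δ' δ' = zq N δ δ + (zq N a δ + zq N b δ + zq N c δ + zq N e δ) +
    (zq N a δ' + zq N b δ' + zq N c δ' + zq N e δ')
  psd : 0 ≤ 4 * zq N δ δ + 4 * (zq N a δ + zq N b δ + zq N c δ + zq N e δ) + zq N a a + zq N b b
    + zq N c c + zq N e e + 2 * (zq N a b + zq N a c + zq N a e + zq N b c + zq N b e + zq N c e)
  psd0 : 0 = 4 * zq N δ δ + 4 * (zq N a δ + zq N b δ + zq N c δ + zq N e δ) + zq N a a + zq N b b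
    + zq N c c + zq N e e + 2 * (zq N a b + zq N a c + zq N a e + zq N b c + zq N b e + zq N c e) →
    (2 : ℝ) • δ + (a + b + c + e) = 0

lemma path_of (hN : D.Scale N) {a b c e δ δ' : V} (ha : a ∈ D.roots) (hb : b ∈ D.roots)
    (hc : c ∈ D.roots) (he : e ∈ D.roots) (hδ : δ ∈ D.roots) (hδ' : δ' ∈ D.roots)
    (ab : 0 ≤ ⟪a, b⟫) (ac : 0 ≤ ⟪a, c⟫) (ae : 0 ≤ ⟪a, e⟫) (bc : 0 ≤ ⟪b, c⟫) (be : 0 ≤ ⟪b, e⟫)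
    (ce : 0 ≤ ⟪c, e⟫) (h : δ' = δ + (a + b + c + e)) : Path N a b c e δ δ' := by
  have ba : 0 ≤ ⟪b, a⟫ := by rw [real_inner_comm]; exact ab
  have ca : 0 ≤ ⟪c, a⟫ := by rw [real_inner_comm]; exact ac
  have cb : 0 ≤ ⟪c, b⟫ := by rw [real_inner_comm]; exact bc
  have ea : 0 ≤ ⟪e, a⟫ := by rw [real_inner_comm]; exact ae
  have eb : 0 ≤ ⟪e, b⟫ := by rw [real_inner_comm]; exact be
  have ec : 0 ≤ ⟪e, c⟫ := by rw [real_inner_comm]; exact ce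
  obtain ⟨ra, qab, qac, qae⟩ := row_of hN ha hb hc he hδ hδ' ab ac ae bc be ce h
  obtain ⟨rb, qba, qbc, qbe⟩ := row_of hN hb ha hc he hδ hδ' ba bc be ac ae ce (by rw [h]; abel)
  obtain ⟨rc, qca, qcb, qce⟩ := row_of hN hc ha hb he hδ hδ' ca cb ce ab ae be (by rw [h]; abel)
  obtain ⟨re, qea, qeb, qec⟩ := row_of hN he ha hb hc hδ hδ' ea eb ec ab ac bc (by rw [h]; abel)
  rw [zq_comm b a] at rb
  rw [zq_comm c a, zq_comm c b] at rc
  rw [zq_comm e a, zq_comm e b, zq_comm e c] at re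
  have key : 2 * ⟪(2 : ℝ) • δ + (a + b + c + e), (2 : ℝ) • δ + (a + b + c + e)⟫ =
      ((4 * zq N δ δ + 4 * (zq N a δ + zq N b δ + zq N c δ + zq N e δ) + zq N a a + zq N b b
    + zq N c c + zq N e e + 2 * (zq N a b + zq N a c + zq N a e + zq N b c + zq N b e + zq N c e)
     : ℤ) : ℝ) * N := by
    simp only [inner_add_left, inner_add_right, inner_smul_left, inner_smul_right,
      RCLike.conj_to_real]
    rw [real_inner_comm a b, real_inner_comm a c, real_inner_comm a e, real_inner_comm b c,
      real_inner_comm b e, real_inner_comm c e, real_inner_comm a δ, real_inner_comm b δ,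
      real_inner_comm c δ, real_inner_comm e δ]
    have e1 := zq_spec hN hδ hδ
    have e2 := zq_spec hN ha hδ
    have e3 := zq_spec hN hb hδ
    have e4 := zq_spec hN hc hδ
    have e5 := zq_spec hN he hδ
    have e6 := zq_spec hN ha ha
    have e7 := zq_spec hN hb hb
    have e8 := zq_spec hN hc hc
    have e9 := zq_spec hN he he
    have f1 := zq_spec hN ha hb
    have f2 := zq_spec hN ha hc
    have f3 := zq_spec hN ha he
    have f4 := zq_spec hN hb hc
    have f5 := zq_spec hN hb he
    have f6 := zq_spec hN hc he
    push_cast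
    linear_combination 4 * e1 + 4 * e2 + 4 * e3 + 4 * e4 + 4 * e5 + e6 + e7 + e8 + e9 +
      2 * f1 + 2 * f2 + 2 * f3 + 2 * f4 + 2 * f5 + 2 * f6
  refine ⟨ra, rb, rc, re, qab, qac, qae, qbc, qbe, qce, zq_self hN hδ, zq_self hN hδ', ?_, ?_, ?_⟩
  · apply zq_unique hN
    have e1 := zq_spec hN hδ hδ
    have e2 := zq_spec hN ha hδ
    have e3 := zq_spec hN hb hδ
    have e4 := zq_spec hN hc hδ
    have e5 := zq_spec hN he hδ
    have e6 := zq_spec hN ha hδ'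
    have e7 := zq_spec hN hb hδ'
    have e8 := zq_spec hN hc hδ'
    have e9 := zq_spec hN he hδ'
    have h1 : ⟪δ', δ'⟫ = ⟪δ, δ⟫ + (⟪a, δ⟫ + ⟪b, δ⟫ + ⟪c, δ⟫ + ⟪e, δ⟫) +
        (⟪a, δ'⟫ + ⟪b, δ'⟫ + ⟪c, δ'⟫ + ⟪e, δ'⟫) := by
      have h2 : ⟪δ', δ'⟫ = ⟪δ, δ'⟫ + (⟪a, δ'⟫ + ⟪b, δ'⟫ + ⟪c, δ'⟫ + ⟪e, δ'⟫) := by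
        conv_lhs => rw [h]
        rw [h]
        simp only [inner_add_left]
      have h3 : ⟪δ, δ'⟫ = ⟪δ, δ⟫ + (⟪a, δ⟫ + ⟪b, δ⟫ + ⟪c, δ⟫ + ⟪e, δ⟫) := by
        rw [h]; simp only [inner_add_right]
        rw [real_inner_comm a δ, real_inner_comm b δ, real_inner_comm c δ, real_inner_comm e δ]
      rw [h2, h3]
    push_cast
    linear_combination 2 * h1 + e1 + e2 + e3 + e4 + e5 + e6 + e7 + e8 + e9
  · have h0 := real_inner_self_nonneg (x := (2 : ℝ) • δ + (a + b + c + e))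
    by_contra hc
    push Not at hc
    have : ((4 * zq N δ δ + 4 * (zq N a δ + zq N b δ + zq N c δ + zq N e δ) + zq N a a + zq N b b
    + zq N c c + zq N e e + 2 * (zq N a b + zq N a c + zq N a e + zq N b c + zq N b e + zq N c e)
     : ℤ) : ℝ) < 0 := by exact_mod_cast hc
    have := mul_neg_of_neg_of_pos this hN.1
    linarith
  · intro h0
    apply eq_zero_of_inner
    rw [← h0] at key
    simp only [Int.cast_zero, zero_mul] at key
    linarith

end RootSystemData



namespace RootSystemData

/-- The inversion set, described by two linear functionals, with nonnegative inner products. -/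
structure Good (D : RootSystemData V) (S : Set V) (p q : V →ₗ[ℝ] ℝ) : Prop where
  mem : ∀ γ, γ ∈ S ↔ γ ∈ D.roots ∧ 0 < p γ ∧ 0 < q γ
  nn : ∀ a ∈ S, ∀ b ∈ S, 0 ≤ ⟪a, b⟫

variable {D : RootSystemData V} {S : Set V} {p q : V →ₗ[ℝ] ℝ}

lemma Good.symm (h : Good D S p q) : Good D S q p :=
  ⟨fun γ => by rw [h.mem, and_comm (a := 0 < p γ)], h.nn⟩

lemma Good.root (h : Good D S p q) {a : V} (ha : a ∈ S) : a ∈ D.roots := ((h.mem a).mp ha).1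

lemma Good.excl (h : Good D S p q) {a b : V} (ha : a ∈ D.roots) (hb : b ∈ S) (hab : ⟪a, b⟫ < 0) :
    p a ≤ 0 ∨ q a ≤ 0 := by
  by_contra hc
  push Not at hc
  have := h.nn a ((h.mem a).mpr ⟨ha, hc.1, hc.2⟩) b hb
  linarith

lemma refl_sub {a b : V} (ha : a ∈ D.roots) (hb : b ∈ D.roots) {c : ℝ}
    (h : 2 * ⟪a, b⟫ = c * ⟪b, b⟫) : a - c • b ∈ D.roots := by
  have h1 := D.reflect_mem a ha b hb
  rwa [refl_of_cpair (cpair_eq (D.ne_zero b hb) h)] at h1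

lemma Good.no_D4 (h : Good D S p q) {a b c e : V} (ha : a ∈ S) (hb : b ∈ S) (hc : c ∈ S)
    (he : e ∈ S) (ab : ⟪a, b⟫ = 0) (ac : ⟪a, c⟫ = 0) (ae : ⟪a, e⟫ = 0) (bc : ⟪b, c⟫ = 0)
    (be : ⟪b, e⟫ = 0) (ce : ⟪c, e⟫ = 0) (hr : (1 / 2 : ℝ) • (a + b + c + e) ∈ D.roots) : False := by
  have key : ∀ x ∈ S, 2 * ⟪(1 / 2 : ℝ) • (a + b + c + e), x⟫ = 1 * ⟪x, x⟫ →
      p ((1 / 2 : ℝ) • (a + b + c + e)) ≤ p x ∨ q ((1 / 2 : ℝ) • (a + b + c + e)) ≤ q x := by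
    intro x hx hh
    have h1 := refl_sub hr (h.root hx) hh
    have hp := D.inner_pos (h.root hx)
    have := h.excl h1 hx (by
      rw [one_smul, inner_sub_left]; linarith)
    rw [one_smul, map_sub, map_sub, sub_nonpos, sub_nonpos] at this
    exact this
  obtain ⟨-, pa, qa⟩ := (h.mem a).mp ha
  obtain ⟨-, pb, qb⟩ := (h.mem b).mp hb
  obtain ⟨-, pc, qc⟩ := (h.mem c).mp hc
  obtain ⟨-, pe, qe⟩ := (h.mem e).mp he
  have ka := key a ha (by
    simp only [inner_smul_left, inner_add_left, RCLike.conj_to_real]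
    rw [real_inner_comm a b, real_inner_comm a c, real_inner_comm a e]; linarith)
  have kb := key b hb (by
    simp only [inner_smul_left, inner_add_left, RCLike.conj_to_real]
    rw [real_inner_comm b c, real_inner_comm b e]; linarith)
  have kc := key c hc (by
    simp only [inner_smul_left, inner_add_left, RCLike.conj_to_real]
    rw [real_inner_comm c e]; linarith)
  have ke := key e he (by
    simp only [inner_smul_left, inner_add_left, RCLike.conj_to_real]
    linarith)
  simp only [map_smul, map_add, smul_eq_mul] at ka kb kc ke
  rcases ka with ka | ka <;> rcases kb with kb | kb <;> rcases kc with kc | kc <;>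
    first | linarith | (rcases ke with ke | ke <;> linarith)

lemma Good.no_B (h : Good D S p q) {a b c : V} (ha : a ∈ S) (hb : b ∈ S) (hc : c ∈ S)
    (ab : ⟪a, b⟫ = 0) (ac : ⟪a, c⟫ = 0) (bc : ⟪b, c⟫ = 0)
    (hr : a + (1 / 2 : ℝ) • (b + c) ∈ D.roots) : False := by
  have key : ∀ x ∈ S, ∀ t : ℝ, 0 < t → 2 * ⟪a + (1 / 2 : ℝ) • (b + c), x⟫ = t * ⟪x, x⟫ →
      p (a + (1 / 2 : ℝ) • (b + c)) ≤ t * p x ∨ q (a + (1 / 2 : ℝ) • (b + c)) ≤ t * q x := by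
    intro x hx t ht hh
    have h1 := refl_sub hr (h.root hx) hh
    have hp := D.inner_pos (h.root hx)
    have := h.excl h1 hx (by
      rw [inner_sub_left, inner_smul_left, RCLike.conj_to_real]; nlinarith)
    rw [map_sub, map_sub, sub_nonpos, sub_nonpos, map_smul, map_smul] at this
    exact this
  obtain ⟨-, pa, qa⟩ := (h.mem a).mp ha
  obtain ⟨-, pb, qb⟩ := (h.mem b).mp hb
  obtain ⟨-, pc, qc⟩ := (h.mem c).mp hc
  have ka := key a ha 2 (by norm_num) (by
    simp only [inner_smul_left, inner_add_left, RCLike.conj_to_real]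
    rw [real_inner_comm a b, real_inner_comm a c]; linarith)
  have kb := key b hb 1 (by norm_num) (by
    simp only [inner_smul_left, inner_add_left, RCLike.conj_to_real]
    rw [real_inner_comm b c]; linarith)
  have kc := key c hc 1 (by norm_num) (by
    simp only [inner_smul_left, inner_add_left, RCLike.conj_to_real]
    linarith)
  simp only [map_smul, map_add, smul_eq_mul] at ka kb kc
  rcases ka with ka | ka <;> rcases kb with kb | kb <;> rcases kc with kc | kc <;> linarith

lemma Good.no_F_core (h : Good D S p q) {N : ℝ} (hN : 0 < N) {a b c e : V} (ha : a ∈ S) (hb : b ∈ S)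
    (hc : c ∈ S) (he : e ∈ S) (aa : ⟪a, a⟫ = N) (bb : ⟪b, b⟫ = N) (cc : ⟪c, c⟫ = N)
    (ee : ⟪e, e⟫ = 2 * N) (ab : ⟪a, b⟫ = N / 2) (ac : ⟪a, c⟫ = N / 2) (bc : ⟪b, c⟫ = N / 2)
    (ae : ⟪a, e⟫ = 0) (be : ⟪b, e⟫ = 0) (ce : ⟪c, e⟫ = 0)
    (hr : (1 / 2 : ℝ) • (a + b + c + e) ∈ D.roots)
    (h1 : p b < p a + p c) (h2 : q b < q a + q c) (h3 : p a + p b + p c ≤ p e) : False := by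
  obtain ⟨-, pa, qa⟩ := (h.mem a).mp ha
  obtain ⟨-, pb, qb⟩ := (h.mem b).mp hb
  obtain ⟨-, pc, qc⟩ := (h.mem c).mp hc
  obtain ⟨-, pe, qe⟩ := (h.mem e).mp he
  have ba : ⟪b, a⟫ = N / 2 := by rw [real_inner_comm, ab]
  have ca : ⟪c, a⟫ = N / 2 := by rw [real_inner_comm, ac]
  have cb : ⟪c, b⟫ = N / 2 := by rw [real_inner_comm, bc]
  have ea : ⟪e, a⟫ = 0 := by rw [real_inner_comm, ae]
  have eb : ⟪e, b⟫ = 0 := by rw [real_inner_comm, be]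
  have ec : ⟪e, c⟫ = 0 := by rw [real_inner_comm, ce]
  have r1 := refl_sub hr (h.root he) (c := 1) (by
    simp only [inner_smul_left, inner_add_left, RCLike.conj_to_real, ae, be, ce, ee]; ring)
  have r2 := refl_sub hr (h.root hb) (c := 2) (by
    simp only [inner_smul_left, inner_add_left, RCLike.conj_to_real, ab, bb, cb, eb]; ring)
  have r3 := refl_sub r2 r1 (c := -1) (by
    simp only [inner_smul_left, inner_add_left, inner_sub_left, inner_smul_right, inner_add_right,
      inner_sub_right, RCLike.conj_to_real, aa, bb, cc, ee, ab, ac, bc, ba, ca, cb, ae, be, ce,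
      ea, eb, ec]
    ring)
  have e3 : (1 / 2 : ℝ) • (a + b + c + e) - (2 : ℝ) • b -
      (-1 : ℝ) • ((1 / 2 : ℝ) • (a + b + c + e) - (1 : ℝ) • e) = a + c - b := by module
  rw [e3] at r3
  have r4 := refl_sub hr r3 (c := 1) (by
    simp only [inner_smul_left, inner_add_left, inner_sub_left, inner_smul_right, inner_add_right,
      inner_sub_right, RCLike.conj_to_real, aa, bb, cc, ee, ab, ac, bc, ba, ca, cb, ae, be, ce,
      ea, eb, ec]
    ring)
  have x2 := h.excl r2 hb (by
    simp only [inner_smul_left, inner_add_left, inner_sub_left, inner_smul_right, inner_add_right,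
      inner_sub_right, RCLike.conj_to_real, aa, bb, cc, ee, ab, ac, bc, ba, ca, cb, ae, be, ce,
      ea, eb, ec]
    linarith)
  have m3 : a + c - b ∈ S := (h.mem _).mpr ⟨r3, by simp only [map_sub, map_add]; linarith,
    by simp only [map_sub, map_add]; linarith⟩
  have x4 := h.excl r4 m3 (by
    simp only [inner_smul_left, inner_add_left, inner_sub_left, inner_smul_right, inner_add_right,
      inner_sub_right, RCLike.conj_to_real, aa, bb, cc, ee, ab, ac, bc, ba, ca, cb, ae, be, ce,
      ea, eb, ec]
    linarith)
  simp only [map_smul, map_add, map_sub, smul_eq_mul] at x2 x4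
  rcases x2 with x2 | x2 <;> rcases x4 with x4 | x4 <;> linarith

lemma Good.no_F (h : Good D S p q) {N : ℝ} (hN : 0 < N) {a b c e : V} (ha : a ∈ S)
    (hb : b ∈ S)
    (hc : c ∈ S) (he : e ∈ S) (aa : ⟪a, a⟫ = N) (bb : ⟪b, b⟫ = N) (cc : ⟪c, c⟫ = N)
    (ee : ⟪e, e⟫ = 2 * N) (ab : ⟪a, b⟫ = N / 2) (ac : ⟪a, c⟫ = N / 2) (bc : ⟪b, c⟫ = N / 2)
    (ae : ⟪a, e⟫ = 0) (be : ⟪b, e⟫ = 0) (ce : ⟪c, e⟫ = 0)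
    (hr : (1 / 2 : ℝ) • (a + b + c + e) ∈ D.roots) : False := by
  obtain ⟨-, pa, qa⟩ := (h.mem a).mp ha
  obtain ⟨-, pb, qb⟩ := (h.mem b).mp hb
  obtain ⟨-, pc, qc⟩ := (h.mem c).mp hc
  have ba : ⟪b, a⟫ = N / 2 := by rw [real_inner_comm, ab]
  have ca : ⟪c, a⟫ = N / 2 := by rw [real_inner_comm, ac]
  have cb : ⟪c, b⟫ = N / 2 := by rw [real_inner_comm, bc]
  have r1 := refl_sub hr (h.root he) (c := 1) (by
    simp only [inner_smul_left, inner_add_left, RCLike.conj_to_real, ae, be, ce, ee]; ring)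
  have x1 := h.excl r1 he (by
    simp only [inner_smul_left, inner_add_left, inner_sub_left, RCLike.conj_to_real, ae, be, ce, ee]
    linarith)
  simp only [map_smul, map_add, map_sub, smul_eq_mul] at x1
  have fin : ∀ {p q : V →ₗ[ℝ] ℝ}, Good D S p q → p a + p b + p c ≤ p e →
      (p b < p a + p c ∧ q b < q a + q c) ∨ (p a < p b + p c ∧ q a < q b + q c) ∨
      (p c < p a + p b ∧ q c < q a + q b) → False := by
    intro p q h h3 hh
    rcases hh with hh | hh | hh
    · exact h.no_F_core hN ha hb hc he aa bb cc ee ab ac bc ae be ce hr hh.1 hh.2 h3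
    · exact h.no_F_core hN hb ha hc he bb aa cc ee ba bc ac be ae ce
        (by convert hr using 2; abel) hh.1 hh.2 (by linarith)
    · exact h.no_F_core hN ha hc hb he aa cc bb ee ac ab cb ae ce be
        (by convert hr using 2; abel) hh.1 hh.2 (by linarith)
  have mid : (p b < p a + p c ∧ q b < q a + q c) ∨ (p a < p b + p c ∧ q a < q b + q c) ∨
      (p c < p a + p b ∧ q c < q a + q b) := by
    by_contra hcon
    push Not at hcon
    obtain ⟨c1, c2, c3⟩ := hcon
    by_cases k1 : p b < p a + p c <;> by_cases k2 : p a < p b + p c <;>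
      by_cases k3 : p c < p a + p b
    · linarith [c1 k1, c2 k2, c3 k3]
    · linarith [c1 k1, c2 k2]
    · linarith [c1 k1, c3 k3]
    · linarith
    · linarith [c2 k2, c3 k3]
    · linarith
    · linarith
    · linarith
  rcases x1 with x1 | x1
  · exact fin h (by linarith) mid
  · exact fin h.symm (by linarith) (by
      rcases mid with m | m | m
      · exact Or.inl ⟨m.2, m.1⟩
      · exact Or.inr (Or.inl ⟨m.2, m.1⟩)
      · exact Or.inr (Or.inr ⟨m.2, m.1⟩))

end RootSystemData



namespace RootSystemData

variable {D : RootSystemData V} {S : Set V} {p q : V →ₗ[ℝ] ℝ} {N : ℝ}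

lemma row4 {d d' u v r : ℤ} (h : Row 4 d d' u v r) : u = -2 ∧ v = 2 ∧ r = 0 := by
  unfold Row at h; omega

lemma row2_44 {u v r : ℤ} (h : Row 2 4 4 u v r) :
    (u = -2 ∧ v = 0 ∧ r = 0) ∨ (u = -2 ∧ v = 2 ∧ r = 2) ∨ (u = 0 ∧ v = 2 ∧ r = 0) := by
  unfold Row at h; omega

lemma row2_42 {u v r : ℤ} (h : Row 2 4 2 u v r) :
    u = -2 ∧ ((v = 0 ∧ r = 0) ∨ (v = 1 ∧ r = 1)) := by
  unfold Row at h; omega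

lemma row2_24 {u v r : ℤ} (h : Row 2 2 4 u v r) :
    v = 2 ∧ ((u = -1 ∧ r = 1) ∨ (u = 0 ∧ r = 0)) := by
  unfold Row at h; omega

lemma row2_22 {u v r : ℤ} (h : Row 2 2 2 u v r) : u = -1 ∧ v = 1 ∧ r = 0 := by
  unfold Row at h; omega

lemma num_LLLL {a b c e δ δ' : V} (P : Path N a b c e δ δ') (ha : zq N a a = 4) (hb : zq N b b = 4)
    (hc : zq N c c = 4) (he : zq N e e = 4) : zq N a b = 0 ∧ zq N a c = 0 ∧ zq N a e = 0 ∧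
    zq N b c = 0 ∧ zq N b e = 0 ∧ zq N c e = 0 ∧ (2 : ℝ) • δ + (a + b + c + e) = 0 := by
  obtain ⟨ra, rb, rc, re, ab, ac, ae, bc, be, ce, d, d', dd, psd, psd0⟩ := P
  rw [ha] at ra; rw [hb] at rb; rw [hc] at rc; rw [he] at re
  have ra4 := row4 ra; clear ra
  have rb4 := row4 rb; clear rb
  have rc4 := row4 rc; clear rc
  have re4 := row4 re; clear re
  refine ⟨by omega, by omega, by omega, by omega, by omega, by omega, psd0 (by omega)⟩

lemma num_SLLL {a b c e δ δ' : V} (P : Path N a b c e δ δ') (ha : zq N a a = 2) (hb : zq N b b = 4)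
    (hc : zq N c c = 4) (he : zq N e e = 4) : False := by
  obtain ⟨ra, rb, rc, re, ab, ac, ae, bc, be, ce, d, d', dd, psd, psd0⟩ := P
  rw [ha] at ra; rw [hb] at rb; rw [hc] at rc; rw [he] at re
  have rb4 := row4 rb; clear rb
  have rc4 := row4 rc; clear rc
  have re4 := row4 re; clear re
  rcases d with d | d <;> rcases d' with d' | d' <;> rw [d, d'] at ra
  · replace ra := row2_22 ra
    omega
  · replace ra := row2_24 ra
    omega
  · replace ra := row2_42 ra
    omega
  · replace ra := row2_44 ra
    omega

lemma num_SSLL {a b c e δ δ' : V} (P : Path N a b c e δ δ') (ha : zq N a a = 2) (hb : zq N b b = 2)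
    (hc : zq N c c = 4) (he : zq N e e = 4) : zq N a c = 0 ∧ zq N a e = 0 ∧
    zq N b c = 0 ∧ zq N b e = 0 ∧ zq N c e = 0 ∧ zq N c δ = -2 ∧ zq N e δ = -2 ∧
    ((zq N a b = 2 ∧ (2 : ℝ) • δ + (a + b + c + e) = 0) ∨
    (zq N a b = 0 ∧ zq N δ δ = 4 ∧ (zq N a δ = -2 ∨ zq N b δ = -2))) := by
  obtain ⟨ra, rb, rc, re, ab, ac, ae, bc, be, ce, d, d', dd, psd, psd0⟩ := P
  rw [ha] at ra; rw [hb] at rb; rw [hc] at rc; rw [he] at re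
  have rc4 := row4 rc; clear rc
  have re4 := row4 re; clear re
  rcases d with d | d <;> rcases d' with d' | d' <;> rw [d, d'] at ra rb
  · replace ra := row2_22 ra
    replace rb := row2_22 rb
    have h : zq N a b = 2 ∧ 0 = 4 * zq N δ δ + 4 * (zq N a δ + zq N b δ + zq N c δ + zq N e δ) + zq N a a + zq N b b
      + zq N c c + zq N e e + 2 * (zq N a b + zq N a c + zq N a e + zq N b c + zq N b e + zq N c e) ∨ 
      (zq N a b = 0 ∧ zq N δ δ = 4 ∧ (zq N a δ = -2 ∨ zq N b δ = -2)) := by omega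
    refine ⟨by omega, by omega, by omega, by omega, by omega, by omega, by omega, ?_⟩
    rcases h with h | h
    · left; exact ⟨h.1, psd0 h.2⟩
    · right; exact h
  · replace ra := row2_24 ra
    replace rb := row2_24 rb
    have h : zq N a b = 2 ∧ 0 = 4 * zq N δ δ + 4 * (zq N a δ + zq N b δ + zq N c δ + zq N e δ) + zq N a a + zq N b b
      + zq N c c + zq N e e + 2 * (zq N a b + zq N a c + zq N a e + zq N b c + zq N b e + zq N c e) ∨ 
      (zq N a b = 0 ∧ zq N δ δ = 4 ∧ (zq N a δ = -2 ∨ zq N b δ = -2)) := by omega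
    refine ⟨by omega, by omega, by omega, by omega, by omega, by omega, by omega, ?_⟩
    rcases h with h | h
    · left; exact ⟨h.1, psd0 h.2⟩
    · right; exact h
  · replace ra := row2_42 ra
    replace rb := row2_42 rb
    have h : zq N a b = 2 ∧ 0 = 4 * zq N δ δ + 4 * (zq N a δ + zq N b δ + zq N c δ + zq N e δ) + zq N a a + zq N b b
      + zq N c c + zq N e e + 2 * (zq N a b + zq N a c + zq N a e + zq N b c + zq N b e + zq N c e) ∨ 
      (zq N a b = 0 ∧ zq N δ δ = 4 ∧ (zq N a δ = -2 ∨ zq N b δ = -2)) := by omega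
    refine ⟨by omega, by omega, by omega, by omega, by omega, by omega, by omega, ?_⟩
    rcases h with h | h
    · left; exact ⟨h.1, psd0 h.2⟩
    · right; exact h
  · replace ra := row2_44 ra
    replace rb := row2_44 rb
    have h : zq N a b = 2 ∧ 0 = 4 * zq N δ δ + 4 * (zq N a δ + zq N b δ + zq N c δ + zq N e δ) + zq N a a + zq N b b
      + zq N c c + zq N e e + 2 * (zq N a b + zq N a c + zq N a e + zq N b c + zq N b e + zq N c e) ∨ 
      (zq N a b = 0 ∧ zq N δ δ = 4 ∧ (zq N a δ = -2 ∨ zq N b δ = -2)) := by omega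
    refine ⟨by omega, by omega, by omega, by omega, by omega, by omega, by omega, ?_⟩
    rcases h with h | h
    · left; exact ⟨h.1, psd0 h.2⟩
    · right; exact h

lemma num_SSSL {a b c e δ δ' : V} (P : Path N a b c e δ δ') (ha : zq N a a = 2) (hb : zq N b b = 2)
    (hc : zq N c c = 2) (he : zq N e e = 4) : zq N a b = 1 ∧ zq N a c = 1 ∧ zq N a e = 0 ∧
    zq N b c = 1 ∧ zq N b e = 0 ∧ zq N c e = 0 ∧ (2 : ℝ) • δ + (a + b + c + e) = 0 := by
  obtain ⟨ra, rb, rc, re, ab, ac, ae, bc, be, ce, d, d', dd, psd, psd0⟩ := P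
  rw [ha] at ra; rw [hb] at rb; rw [hc] at rc; rw [he] at re
  have re4 := row4 re; clear re
  rcases d with d | d <;> rcases d' with d' | d' <;> rw [d, d'] at ra rb rc
  · replace ra := row2_22 ra
    replace rb := row2_22 rb
    replace rc := row2_22 rc
    refine ⟨by omega, by omega, by omega, by omega, by omega, by omega, psd0 (by omega)⟩
  · replace ra := row2_24 ra
    replace rb := row2_24 rb
    replace rc := row2_24 rc
    refine ⟨by omega, by omega, by omega, by omega, by omega, by omega, psd0 (by omega)⟩
  · replace ra := row2_42 ra
    replace rb := row2_42 rb
    replace rc := row2_42 rc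
    refine ⟨by omega, by omega, by omega, by omega, by omega, by omega, psd0 (by omega)⟩
  · replace ra := row2_44 ra
    replace rb := row2_44 rb
    replace rc := row2_44 rc
    refine ⟨by omega, by omega, by omega, by omega, by omega, by omega, psd0 (by omega)⟩

lemma num_SSSS_eq {a b c e δ δ' : V} (P : Path N a b c e δ δ') (ha : zq N a a = 2)
    (hb : zq N b b = 2) (hc : zq N c c = 2) (he : zq N e e = 2) (h : zq N a b = 2)
    (h' : zq N a c = zq N b c) (h'' : zq N a e = zq N b e) :
    zq N a c = 0 ∧ zq N a e = 0 ∧ zq N δ δ = 4 ∧ zq N a δ = -2 ∧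
    (zq N c δ = -2 ∨ zq N e δ = -2) := by
  obtain ⟨ra, rb, rc, re, ab, ac, ae, bc, be, ce, d, d', dd, psd, psd0⟩ := P
  rw [ha] at ra; rw [hb] at rb; rw [hc] at rc; rw [he] at re
  rcases d with d | d <;> rcases d' with d' | d' <;> rw [d, d'] at ra rb rc re
  · replace ra := row2_22 ra
    replace rb := row2_22 rb
    replace rc := row2_22 rc
    replace re := row2_22 re
    omega
  · replace ra := row2_24 ra
    replace rb := row2_24 rb
    replace rc := row2_24 rc
    replace re := row2_24 re
    omega
  · replace ra := row2_42 ra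
    replace rb := row2_42 rb
    replace rc := row2_42 rc
    replace re := row2_42 re
    omega
  · replace ra := row2_44 ra
    replace rb := row2_44 rb
    replace rc := row2_44 rc
    replace re := row2_44 re
    omega

set_option maxHeartbeats 4000000 in
lemma num_SSSS_ne {a b c e δ δ' : V} (P : Path N a b c e δ δ') (ha : zq N a a = 2)
    (hb : zq N b b = 2) (hc : zq N c c = 2) (he : zq N e e = 2) (ab' : zq N a b ≤ 1)
    (ac' : zq N a c ≤ 1) (ae' : zq N a e ≤ 1) (bc' : zq N b c ≤ 1) (be' : zq N b e ≤ 1)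
    (ce' : zq N c e ≤ 1) :
    (zq N a b = 0 ∧ zq N a c = 0 ∧ zq N a e = 0 ∧ zq N b c = 0 ∧ zq N b e = 0 ∧ zq N c e = 0 ∧
      ((2 : ℝ) • δ + (a + b + c + e) = 0 ∨ (zq N δ δ = 4 ∧
        ((zq N a δ = -2 ∧ zq N b δ = -2) ∨ (zq N a δ = -2 ∧ zq N c δ = -2) ∨
        (zq N a δ = -2 ∧ zq N e δ = -2) ∨ (zq N b δ = -2 ∧ zq N c δ = -2) ∨
        (zq N b δ = -2 ∧ zq N e δ = -2) ∨ (zq N c δ = -2 ∧ zq N e δ = -2))))) ∨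
    (zq N a c = 0 ∧ zq N b e = 0 ∧ zq N a b = 1 ∧ zq N b c = 1 ∧ zq N c e = 1 ∧ zq N a e = 1) ∨
    (zq N a b = 0 ∧ zq N c e = 0 ∧ zq N a c = 1 ∧ zq N b c = 1 ∧ zq N b e = 1 ∧ zq N a e = 1) ∨
    (zq N a e = 0 ∧ zq N b c = 0 ∧ zq N a b = 1 ∧ zq N b e = 1 ∧ zq N c e = 1 ∧ zq N a c = 1) := by
  obtain ⟨ra, rb, rc, re, ab, ac, ae, bc, be, ce, d, d', dd, psd, psd0⟩ := P
  rw [ha] at ra; rw [hb] at rb; rw [hc] at rc; rw [he] at re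
  rcases d with d | d <;> rcases d' with d' | d' <;> rw [d, d'] at ra rb rc re
  · replace ra := row2_22 ra
    replace rb := row2_22 rb
    replace rc := row2_22 rc
    replace re := row2_22 re
    left
    exact ⟨by omega, by omega, by omega, by omega, by omega, by omega, Or.inl (psd0 (by omega))⟩
  · replace ra := row2_24 ra
    replace rb := row2_24 rb
    replace rc := row2_24 rc
    replace re := row2_24 re
    exfalso; clear psd psd0; omega
  · replace ra := row2_42 ra
    replace rb := row2_42 rb
    replace rc := row2_42 rc
    replace re := row2_42 re
    exfalso; clear psd psd0; omega
  · replace ra := row2_44 ra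
    replace rb := row2_44 rb
    replace rc := row2_44 rc
    replace re := row2_44 re
    clear psd psd0
    rcases ra with ⟨ua, va, ra⟩ | ⟨ua, va, ra⟩ | ⟨ua, va, ra⟩ <;>
    rcases rb with ⟨ub, vb, rb⟩ | ⟨ub, vb, rb⟩ | ⟨ub, vb, rb⟩ <;>
    rcases rc with ⟨uc, vc, rc⟩ | ⟨uc, vc, rc⟩ | ⟨uc, vc, rc⟩ <;>
    rcases re with ⟨ue, ve, re⟩ | ⟨ue, ve, re⟩ | ⟨ue, ve, re⟩ <;>
    (rw [ua, ub, uc, ue, va, vb, vc, ve, d, d'] at dd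
     first
     | (exfalso; omega)
     | (left; exact ⟨by omega, by omega, by omega, by omega, by omega, by omega,
          Or.inr ⟨d, by omega⟩⟩)
     | (right; omega))

end RootSystemData



namespace RootSystemData

variable {D : RootSystemData V} {S : Set V} {p q : V →ₗ[ℝ] ℝ} {N : ℝ}

/-- No weight `δ` such that both `δ` and `δ + a + b + c + e` are weights. -/
def NP (D : RootSystemData V) (a b c e : V) : Prop :=
  ∀ δ δ', (δ ∈ D.roots ∨ δ = 0) → (δ' ∈ D.roots ∨ δ' = 0) → δ' = δ + (a + b + c + e) → False

lemma NP.perm {a b c e a' b' c' e' : V} (h : D.NP a b c e)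
    (hs : a' + b' + c' + e' = a + b + c + e) : D.NP a' b' c' e' := by
  intro δ δ' h1 h2 h3
  exact h δ δ' h1 h2 (by rw [h3, hs])

lemma inner_zq (hN : D.Scale N) {a b : V} (ha : a ∈ D.roots) (hb : b ∈ D.roots) {m : ℤ}
    (h : zq N a b = m) : ⟪a, b⟫ = m * N / 2 := by
  have := zq_spec hN ha hb
  rw [h] at this; linarith

lemma Good.np_of (hN : D.Scale N) (h : Good D S p q) {a b c e : V} (ha : a ∈ S) (hb : b ∈ S)
    (hc : c ∈ S) (he : e ∈ S)
    (hP : ∀ δ δ', δ ∈ D.roots → δ' ∈ D.roots → Path N a b c e δ δ' → False) : D.NP a b c e := by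
  intro δ δ' h1 h2 h3
  have ab := h.nn a ha b hb
  have ac := h.nn a ha c hc
  have ae := h.nn a ha e he
  have bc := h.nn b hb c hc
  have be := h.nn b hb e he
  have ce := h.nn c hc e he
  have big : 2 * N < ⟪a + b + c + e, a + b + c + e⟫ := by
    simp only [inner_add_left, inner_add_right]
    rw [real_inner_comm a b, real_inner_comm a c, real_inner_comm b c, real_inner_comm a e,
      real_inner_comm b e, real_inner_comm c e]
    have hNN := hN.1
    have h1 : N ≤ ⟪a, a⟫ := by rcases hN.2 a (h.root ha) with h | h <;> linarith
    have h2 : N ≤ ⟪b, b⟫ := by rcases hN.2 b (h.root hb) with h | h <;> linarith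
    have h3 : N ≤ ⟪c, c⟫ := by rcases hN.2 c (h.root hc) with h | h <;> linarith
    have h4 : N ≤ ⟪e, e⟫ := by rcases hN.2 e (h.root he) with h | h <;> linarith
    linarith
  obtain ⟨b1, b2⟩ := no_root_of hN big
  rcases h1 with h1 | h1
  · rcases h2 with h2 | h2
    · exact hP δ δ' h1 h2 (path_of hN (h.root ha) (h.root hb) (h.root hc) (h.root he) h1 h2
        ab ac ae bc be ce h3)
    · apply b1
      have : a + b + c + e = -δ := by
        rw [h2] at h3; exact (neg_eq_of_add_eq_zero_right h3.symm).symm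
      rw [this]; exact D.neg_mem h1
  · rw [h1, zero_add] at h3
    rw [← h3] at b1 b2
    exact h2.elim b1 b2

lemma half_root {a b c e δ : V} (hδ : δ ∈ D.roots) (h : (2 : ℝ) • δ + (a + b + c + e) = 0) :
    (1 / 2 : ℝ) • (a + b + c + e) ∈ D.roots := by
  have : (1 / 2 : ℝ) • (a + b + c + e) = -δ := by
    have h2 : a + b + c + e = -((2 : ℝ) • δ) := (neg_eq_of_add_eq_zero_right h).symm
    rw [h2]; module
  rw [this]; exact D.neg_mem hδ

lemma Good.np_LLLL (hN : D.Scale N) (h : Good D S p q) {a b c e : V} (ha : a ∈ S) (hb : b ∈ S)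
    (hc : c ∈ S) (he : e ∈ S) (la : zq N a a = 4) (lb : zq N b b = 4) (lc : zq N c c = 4)
    (le : zq N e e = 4) : D.NP a b c e := by
  refine h.np_of hN ha hb hc he fun δ δ' hδ hδ' P => ?_
  obtain ⟨ab, ac, ae, bc, be, ce, h0⟩ := num_LLLL P la lb lc le
  refine h.no_D4 ha hb hc he ?_ ?_ ?_ ?_ ?_ ?_ (half_root hδ h0)
  · simpa using inner_zq hN (h.root ha) (h.root hb) ab
  · simpa using inner_zq hN (h.root ha) (h.root hc) ac
  · simpa using inner_zq hN (h.root ha) (h.root he) ae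
  · simpa using inner_zq hN (h.root hb) (h.root hc) bc
  · simpa using inner_zq hN (h.root hb) (h.root he) be
  · simpa using inner_zq hN (h.root hc) (h.root he) ce

lemma Good.np_SLLL (hN : D.Scale N) (h : Good D S p q) {a b c e : V} (ha : a ∈ S) (hb : b ∈ S)
    (hc : c ∈ S) (he : e ∈ S) (la : zq N a a = 2) (lb : zq N b b = 4) (lc : zq N c c = 4)
    (le : zq N e e = 4) : D.NP a b c e :=
  h.np_of hN ha hb hc he fun _ _ _ _ P => num_SLLL P la lb lc le

lemma Good.np_SSLL (hN : D.Scale N) (h : Good D S p q) {a b c e : V} (ha : a ∈ S) (hb : b ∈ S)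
    (hc : c ∈ S) (he : e ∈ S) (la : zq N a a = 2) (lb : zq N b b = 2) (lc : zq N c c = 4)
    (le : zq N e e = 4) : D.NP a b c e := by
  refine h.np_of hN ha hb hc he fun δ δ' hδ hδ' P => ?_
  obtain ⟨ac, ae, bc, be, ce, cd, ed, h0⟩ := num_SSLL P la lb lc le
  have ac' : ⟪a, c⟫ = 0 := by simpa using inner_zq hN (h.root ha) (h.root hc) ac
  have ae' : ⟪a, e⟫ = 0 := by simpa using inner_zq hN (h.root ha) (h.root he) ae
  have bc' : ⟪b, c⟫ = 0 := by simpa using inner_zq hN (h.root hb) (h.root hc) bc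
  have be' : ⟪b, e⟫ = 0 := by simpa using inner_zq hN (h.root hb) (h.root he) be
  have ce' : ⟪c, e⟫ = 0 := by simpa using inner_zq hN (h.root hc) (h.root he) ce
  have cd' := inner_zq hN (h.root hc) hδ cd
  have ed' := inner_zq hN (h.root he) hδ ed
  have cc' := inner_zq hN (h.root hc) (h.root hc) lc
  have ee' := inner_zq hN (h.root he) (h.root he) le
  have key : ∀ x ∈ S, zq N x x = 2 → ⟪x, c⟫ = 0 → ⟪x, e⟫ = 0 → zq N δ δ = 4 → zq N x δ = -2 →
      False := by
    intro x hx lx xc xe ld xd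
    have xd' := inner_zq hN (h.root hx) hδ xd
    have xx' := inner_zq hN (h.root hx) (h.root hx) lx
    have dd' := inner_zq hN hδ hδ ld
    have : x + (1 / 2 : ℝ) • (c + e) + δ = 0 := by
      apply eq_zero_of_inner
      simp only [inner_add_left, inner_add_right, inner_smul_left, inner_smul_right,
        RCLike.conj_to_real]
      rw [real_inner_comm x δ, real_inner_comm c δ, real_inner_comm e δ, real_inner_comm x c,
        real_inner_comm x e, real_inner_comm c e, xc, xe, ce', cd', ed', xd', cc', ee', xx', dd']
      push_cast; linarith [hN.1]
    refine h.no_B hx hc he xc xe ce' ?_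
    rw [eq_neg_of_add_eq_zero_left this]; exact D.neg_mem hδ
  rcases h0 with ⟨ab, h0⟩ | ⟨-, ld, h0 | h0⟩
  · have : a = b := zq_eq_of hN (h.root ha) (h.root hb) la lb ab
    subst this
    refine h.no_B ha hc he ac' ae' ce' ?_
    have := half_root hδ h0
    convert this using 1; module
  · exact key a ha la ac' ae' ld h0
  · exact key b hb lb bc' be' ld h0

lemma Good.np_SSSL (hN : D.Scale N) (h : Good D S p q) {a b c e : V} (ha : a ∈ S) (hb : b ∈ S)
    (hc : c ∈ S) (he : e ∈ S) (la : zq N a a = 2) (lb : zq N b b = 2) (lc : zq N c c = 2)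
    (le : zq N e e = 4) : D.NP a b c e := by
  refine h.np_of hN ha hb hc he fun δ δ' hδ hδ' P => ?_
  obtain ⟨ab, ac, ae, bc, be, ce, h0⟩ := num_SSSL P la lb lc le
  refine h.no_F hN.1 ha hb hc he ?_ ?_ ?_ ?_ ?_ ?_ ?_ ?_ ?_ ?_ (half_root hδ h0)
  · rw [inner_zq hN (h.root ha) (h.root ha) la]; push_cast; ring
  · rw [inner_zq hN (h.root hb) (h.root hb) lb]; push_cast; ring
  · rw [inner_zq hN (h.root hc) (h.root hc) lc]; push_cast; ring
  · rw [inner_zq hN (h.root he) (h.root he) le]; push_cast; ring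
  · rw [inner_zq hN (h.root ha) (h.root hb) ab]; push_cast; ring
  · rw [inner_zq hN (h.root ha) (h.root hc) ac]; push_cast; ring
  · rw [inner_zq hN (h.root hb) (h.root hc) bc]; push_cast; ring
  · simpa using inner_zq hN (h.root ha) (h.root he) ae
  · simpa using inner_zq hN (h.root hb) (h.root he) be
  · simpa using inner_zq hN (h.root hc) (h.root he) ce

lemma Good.np_long (hN : D.Scale N) (h : Good D S p q) {a b c e : V} (ha : a ∈ S) (hb : b ∈ S)
    (hc : c ∈ S) (he : e ∈ S) (le : zq N e e = 4) : D.NP a b c e := by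
  rcases zq_self hN (h.root ha) with la | la <;> rcases zq_self hN (h.root hb) with lb | lb <;>
    rcases zq_self hN (h.root hc) with lc | lc
  · exact h.np_SSSL hN ha hb hc he la lb lc le
  · exact h.np_SSLL hN ha hb hc he la lb lc le
  · exact (h.np_SSLL hN ha hc hb he la lc lb le).perm (by abel)
  · exact h.np_SLLL hN ha hb hc he la lb lc le
  · exact (h.np_SSLL hN hb hc ha he lb lc la le).perm (by abel)
  · exact (h.np_SLLL hN hb ha hc he lb la lc le).perm (by abel)
  · exact (h.np_SLLL hN hc ha hb he lc la lb le).perm (by abel)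
  · exact h.np_LLLL hN ha hb hc he la lb lc le

lemma sum_root (hN : D.Scale N) {x y δ : V} (hx : x ∈ D.roots) (hy : y ∈ D.roots)
    (hδ : δ ∈ D.roots) (lx : zq N x x = 2) (ly : zq N y y = 2) (xy : zq N x y = 0)
    (ld : zq N δ δ = 4) (xd : zq N x δ = -2) (yd : zq N y δ = -2) : x + y ∈ D.roots := by
  have : x + y + δ = 0 := by
    apply eq_zero_of_inner
    simp only [inner_add_left, inner_add_right]
    rw [real_inner_comm x δ, real_inner_comm y δ, real_inner_comm x y, inner_zq hN hx hx lx,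
      inner_zq hN hy hy ly, inner_zq hN hx hy xy, inner_zq hN hδ hδ ld, inner_zq hN hx hδ xd,
      inner_zq hN hy hδ yd]
    push_cast; linarith [hN.1]
  rw [eq_neg_of_add_eq_zero_left this]; exact D.neg_mem hδ

lemma diff_root {x y : V} (hx : x ∈ D.roots)
    (xy : ⟪x, y⟫ = 0) (h : x + y ∈ D.roots) : y - x ∈ D.roots := by
  have := refl_sub h hx (c := 2) (by
    rw [inner_add_left, real_inner_comm x y, xy]; ring)
  convert this using 1; module

lemma Good.cls_eq (hN : D.Scale N) (h : Good D S p q) {a c e : V} (ha : a ∈ S)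
    (hc : c ∈ S) (he : e ∈ S) (la : zq N a a = 2) (lc : zq N c c = 2)
    (le : zq N e e = 2) : D.NP a a c e ∨
    (zq N a c = 0 ∧ zq N a e = 0 ∧ (a + c ∈ D.roots ∨ a + e ∈ D.roots)) := by
  by_contra hcon
  push Not at hcon
  apply hcon.1
  refine h.np_of hN ha ha hc he fun δ δ' hδ hδ' P => ?_
  obtain ⟨ac, ae, ld, ad, cd⟩ := num_SSSS_eq P la la lc le la rfl rfl
  obtain ⟨h1, h2⟩ := hcon.2 ac ae
  rcases cd with cd | cd
  · exact h1 (sum_root hN (h.root ha) (h.root hc) hδ la lc ac ld ad cd)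
  · exact h2 (sum_root hN (h.root ha) (h.root he) hδ la le ae ld ad cd)

lemma Good.cls_ne (hN : D.Scale N) (h : Good D S p q) {a b c e : V} (ha : a ∈ S) (hb : b ∈ S)
    (hc : c ∈ S) (he : e ∈ S) (la : zq N a a = 2) (lb : zq N b b = 2) (lc : zq N c c = 2)
    (le : zq N e e = 2) (ab' : a ≠ b) (ac' : a ≠ c) (ae' : a ≠ e) (bc' : b ≠ c) (be' : b ≠ e)
    (ce' : c ≠ e) : D.NP a b c e ∨
    (zq N a b = 0 ∧ zq N a c = 0 ∧ zq N a e = 0 ∧ zq N b c = 0 ∧ zq N b e = 0 ∧ zq N c e = 0 ∧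
      (a + b ∈ D.roots ∨ a + c ∈ D.roots ∨ a + e ∈ D.roots ∨ b + c ∈ D.roots ∨
       b + e ∈ D.roots ∨ c + e ∈ D.roots)) ∨
    (zq N a c = 0 ∧ zq N b e = 0 ∧ zq N a b = 1 ∧ zq N b c = 1 ∧ zq N c e = 1 ∧ zq N a e = 1) ∨
    (zq N a b = 0 ∧ zq N c e = 0 ∧ zq N a c = 1 ∧ zq N b c = 1 ∧ zq N b e = 1 ∧ zq N a e = 1) ∨
    (zq N a e = 0 ∧ zq N b c = 0 ∧ zq N a b = 1 ∧ zq N b e = 1 ∧ zq N c e = 1 ∧ zq N a c = 1) := by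
  by_contra hcon
  rw [not_or] at hcon
  obtain ⟨h1, h2⟩ := hcon
  apply h1
  refine h.np_of hN ha hb hc he fun δ δ' hδ hδ' P => ?_
  have ra := h.root ha
  have rb := h.root hb
  have rc := h.root hc
  have re := h.root he
  rcases num_SSSS_ne P la lb lc le ((zq_le hN ra rb ab').2 la lb) ((zq_le hN ra rc ac').2 la lc)
    ((zq_le hN ra re ae').2 la le) ((zq_le hN rb rc bc').2 lb lc) ((zq_le hN rb re be').2 lb le)
    ((zq_le hN rc re ce').2 lc le) with ⟨ab, ac, ae, bc, be, ce, h0⟩ | h0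
  · rcases h0 with h0 | ⟨ld, h0⟩
    · refine h.no_D4 ha hb hc he ?_ ?_ ?_ ?_ ?_ ?_ (half_root hδ h0)
      · simpa using inner_zq hN (h.root ha) (h.root hb) ab
      · simpa using inner_zq hN (h.root ha) (h.root hc) ac
      · simpa using inner_zq hN (h.root ha) (h.root he) ae
      · simpa using inner_zq hN (h.root hb) (h.root hc) bc
      · simpa using inner_zq hN (h.root hb) (h.root he) be
      · simpa using inner_zq hN (h.root hc) (h.root he) ce
    · apply h2
      left
      refine ⟨ab, ac, ae, bc, be, ce, ?_⟩
      rcases h0 with ⟨k, l⟩ | ⟨k, l⟩ | ⟨k, l⟩ | ⟨k, l⟩ | ⟨k, l⟩ | ⟨k, l⟩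
      · exact Or.inl (sum_root hN ra rb hδ la lb ab ld k l)
      · exact Or.inr (Or.inl (sum_root hN ra rc hδ la lc ac ld k l))
      · exact Or.inr (Or.inr (Or.inl (sum_root hN ra re hδ la le ae ld k l)))
      · exact Or.inr (Or.inr (Or.inr (Or.inl (sum_root hN rb rc hδ lb lc bc ld k l))))
      · exact Or.inr (Or.inr (Or.inr (Or.inr (Or.inl (sum_root hN rb re hδ lb le be ld k l)))))
      · exact Or.inr (Or.inr (Or.inr (Or.inr (Or.inr (sum_root hN rc re hδ lc le ce ld k l)))))
  · exact h2 (Or.inr h0)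

/-- Three equal roots and a fourth one orthogonal to it. -/
lemma Good.np_aaa (hN : D.Scale N) (h : Good D S p q) {a e : V} (ha : a ∈ S)
    (he : e ∈ S) (la : zq N a a = 2) (le : zq N e e = 2) : D.NP a a a e := by
  rcases h.cls_eq hN ha ha he la la le with h1 | h1
  · exact h1
  · omega

end RootSystemData



section symm
variable {A : Type*} [Ring A]

/-- symmetrized products -/
def s2 (a b : A) : A := a * b + b * a
/-- symmetrized products -/
def s3 (a b c : A) : A := a * s2 b c + b * s2 a c + c * s2 a b
/-- symmetrized products -/
def s4 (a b c d : A) : A := a * s3 b c d + b * s3 a c d + c * s3 a b d + d * s3 a b c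
/-- commutator -/
def der (e a : A) : A := e * a - a * e

lemma der_mul (e a b : A) : der e (a * b) = der e a * b + a * der e b := by
  unfold der; noncomm_ring

lemma der_add (e a b : A) : der e (a + b) = der e a + der e b := by
  unfold der; noncomm_ring

lemma s2_comm (a b : A) : s2 a b = s2 b a := by unfold s2; abel

lemma s3_12 (a b c : A) : s3 a b c = s3 b a c := by
  unfold s3; rw [s2_comm a b]; abel

lemma s3_23 (a b c : A) : s3 a b c = s3 a c b := by
  unfold s3; rw [s2_comm b c]; abel

lemma s4_12 (a b c d : A) : s4 a b c d = s4 b a c d := by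
  unfold s4; rw [s3_12 a b c, s3_12 a b d]; abel

lemma s4_23 (a b c d : A) : s4 a b c d = s4 a c b d := by
  unfold s4; rw [s3_23 a b c, s3_12 b c d]; abel

lemma s4_34 (a b c d : A) : s4 a b c d = s4 a b d c := by
  unfold s4; rw [s3_23 b c d, s3_23 a c d]; abel

lemma der_s2 (e a b : A) : der e (s2 a b) = s2 (der e a) b + s2 a (der e b) := by
  simp only [s2, der_add, der_mul]; abel

lemma der_s3 (e a b c : A) :
    der e (s3 a b c) = s3 (der e a) b c + s3 a (der e b) c + s3 a b (der e c) := by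
  simp only [s3, der_add, der_mul, der_s2, mul_add]; abel

lemma der_s4 (e a b c d : A) :
    der e (s4 a b c d) = s4 (der e a) b c d + s4 a (der e b) c d + s4 a b (der e c) d
      + s4 a b c (der e d) := by
  simp only [s4, der_add, der_mul, der_s3, mul_add]; abel

lemma s4_self (a : A) : s4 a a a a = 24 • a ^ 4 := by
  simp only [s4, s3, s2]; noncomm_ring

lemma s4_add (a a' b c d : A) : s4 (a + a') b c d = s4 a b c d + s4 a' b c d := by
  simp only [s4, s3, s2]; noncomm_ring

lemma s4_smul {R : Type*} [CommSemiring R] [Algebra R A] (r : R) (a b c d : A) :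
    s4 (r • a) b c d = r • s4 a b c d := by
  simp only [s4, s3, s2, smul_mul_assoc, mul_smul_comm, mul_add, smul_add]

end symm

section lie
variable {L : Type*} [LieRing L] [LieAlgebra ℂ L]

/-- polarization of the fourth power of the adjoint operator -/
def T4 (a b c d : L) : Module.End ℂ L :=
  s4 (LieAlgebra.ad ℂ L a) (LieAlgebra.ad ℂ L b) (LieAlgebra.ad ℂ L c) (LieAlgebra.ad ℂ L d)

lemma T4_12 (a b c d : L) : T4 a b c d = T4 b a c d := s4_12 _ _ _ _
lemma T4_23 (a b c d : L) : T4 a b c d = T4 a c b d := s4_23 _ _ _ _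
lemma T4_34 (a b c d : L) : T4 a b c d = T4 a b d c := s4_34 _ _ _ _

lemma T4_add1 (a a' b c d : L) : T4 (a + a') b c d = T4 a b c d + T4 a' b c d := by
  unfold T4; rw [map_add, s4_add]

lemma T4_smul1 (r : ℂ) (a b c d : L) : T4 (r • a) b c d = r • T4 a b c d := by
  unfold T4; rw [map_smul, s4_smul]

lemma T4_smul2 (r : ℂ) (a b c d : L) : T4 a (r • b) c d = r • T4 a b c d := by
  rw [T4_12, T4_smul1, T4_12]

lemma T4_smul3 (r : ℂ) (a b c d : L) : T4 a b (r • c) d = r • T4 a b c d := by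
  rw [T4_23, T4_smul2, T4_23]

lemma T4_smul4 (r : ℂ) (a b c d : L) : T4 a b c (r • d) = r • T4 a b c d := by
  rw [T4_34, T4_smul3, T4_34]

lemma T4_zero4 (a b c : L) : T4 a b c 0 = 0 := by
  have := T4_smul4 0 a b c (0 : L); simpa using this

lemma T4_zero3 (a b c : L) : T4 a b 0 c = 0 := by rw [T4_34, T4_zero4]

lemma T4_der (e a b c d : L) (h : T4 a b c d = 0) :
    T4 ⁅e, a⁆ b c d + T4 a ⁅e, b⁆ c d + T4 a b ⁅e, c⁆ d + T4 a b c ⁅e, d⁆ = 0 := by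
  have h1 := der_s4 (LieAlgebra.ad ℂ L e) (LieAlgebra.ad ℂ L a) (LieAlgebra.ad ℂ L b)
    (LieAlgebra.ad ℂ L c) (LieAlgebra.ad ℂ L d)
  have h2 : ∀ x : L, der (LieAlgebra.ad ℂ L e) (LieAlgebra.ad ℂ L x) = LieAlgebra.ad ℂ L ⁅e, x⁆ := by
    intro x; ext z
    simp only [der, LinearMap.sub_apply, Module.End.mul_apply, LieAlgebra.ad_apply, lie_lie]
  have h3 : der (LieAlgebra.ad ℂ L e) (T4 a b c d) = 0 := by rw [h]; simp [der]
  unfold T4 at h3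
  rw [h3] at h1
  simp only [h2] at h1
  exact h1.symm

lemma T4_self (a : L) (h : T4 a a a a = 0) : (LieAlgebra.ad ℂ L a) ^ 4 = 0 := by
  unfold T4 at h
  rw [s4_self] at h
  have : (24 : ℂ) • (LieAlgebra.ad ℂ L a) ^ 4 = 0 := by
    rw [← h]; norm_cast
  exact (smul_eq_zero.mp this).resolve_left (by norm_num)

end lie

namespace LieRootData

variable {L : Type*} [LieRing L] [LieAlgebra ℂ L] {D : LieRootData V L}

open Classical in
/-- weight spaces -/
def G (D : LieRootData V L) (v : V) : Submodule ℂ L :=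
  if v ∈ D.roots then D.rs v else if v = 0 then D.cartan.toSubmodule else ⊥

lemma G_root {v : V} (h : v ∈ D.roots) : D.G v = D.rs v := by simp [G, h]
lemma G_zero : D.G 0 = D.cartan.toSubmodule := by
  have : (0 : V) ∉ D.roots := fun h => D.ne_zero 0 h rfl
  simp [G, this]
lemma G_bot {v : V} (h : v ∉ D.roots) (h' : v ≠ 0) : D.G v = ⊥ := by simp [G, h, h']

/-- operators homogeneous of given degree -/
def Hom (D : LieRootData V L) (A : Module.End ℂ L) (μ : V) : Prop :=
  ∀ δ, ∀ z ∈ D.G δ, A z ∈ D.G (μ + δ)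

lemma hom_ad {γ : V} (hγ : γ ∈ D.roots) {x : L} (hx : x ∈ D.rs γ) :
    D.Hom (LieAlgebra.ad ℂ L x) γ := by
  intro δ z hz
  rw [LieAlgebra.ad_apply]
  by_cases h : δ ∈ D.roots
  · rw [G_root h] at hz
    by_cases h1 : γ + δ ∈ D.roots
    · rw [G_root h1]; exact D.bracket_mem γ hγ δ h h1 x hx z hz
    · by_cases h2 : γ + δ = 0
      · rw [h2, G_zero]
        have : δ = -γ := (neg_eq_of_add_eq_zero_right h2).symm
        rw [this] at hz
        exact D.bracket_cartan_mem γ hγ x hx z hz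
      · rw [D.bracket_eq_zero γ hγ δ h h1 h2 x hx z hz]; exact Submodule.zero_mem _
  · by_cases h2 : δ = 0
    · rw [h2, G_zero] at hz
      rw [h2, add_zero, G_root hγ]
      obtain ⟨c, hc⟩ := D.weight_vec γ hγ z hz x hx
      rw [← lie_skew, hc]
      exact Submodule.neg_mem _ (Submodule.smul_mem _ _ hx)
    · rw [G_bot h h2, Submodule.mem_bot] at hz
      rw [hz, lie_zero]; exact Submodule.zero_mem _

lemma Hom.mul {A B : Module.End ℂ L} {μ ν : V} (hA : D.Hom A μ) (hB : D.Hom B ν) :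
    D.Hom (A * B) (μ + ν) := by
  intro δ z hz
  rw [add_assoc]; exact hA _ _ (hB _ _ hz)

lemma Hom.add {A B : Module.End ℂ L} {μ ν : V} (hA : D.Hom A μ) (hB : D.Hom B ν) (h : ν = μ) :
    D.Hom (A + B) μ := by
  subst h
  intro δ z hz
  exact Submodule.add_mem _ (hA _ _ hz) (hB _ _ hz)

lemma Hom.s2 {A B : Module.End ℂ L} {a b : V} (hA : D.Hom A a) (hB : D.Hom B b) :
    D.Hom (s2 A B) (a + b) := (hA.mul hB).add (hB.mul hA) (by abel)

lemma Hom.s3 {A B C : Module.End ℂ L} {a b c : V} (hA : D.Hom A a) (hB : D.Hom B b)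
    (hC : D.Hom C c) : D.Hom (s3 A B C) (a + (b + c)) :=
  ((hA.mul (hB.s2 hC)).add (hB.mul (hA.s2 hC)) (by abel)).add (hC.mul (hA.s2 hB)) (by abel)

lemma Hom.s4 {A B C E : Module.End ℂ L} {a b c e : V} (hA : D.Hom A a) (hB : D.Hom B b)
    (hC : D.Hom C c) (hE : D.Hom E e) : D.Hom (s4 A B C E) (a + (b + (c + e))) :=
  (((hA.mul (hB.s3 hC hE)).add (hB.mul (hA.s3 hC hE)) (by abel)).add
    (hC.mul (hA.s3 hB hE)) (by abel)).add (hE.mul (hA.s3 hB hC)) (by abel)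

/-- vanishing of the polarization on root spaces -/
def Z (D : LieRootData V L) (a b c e : V) : Prop :=
  ∀ x ∈ D.rs a, ∀ y ∈ D.rs b, ∀ z ∈ D.rs c, ∀ t ∈ D.rs e, T4 x y z t = 0

lemma Z.p12 {a b c e : V} (h : D.Z a b c e) : D.Z b a c e := by
  intro x hx y hy z hz t ht; rw [T4_12]; exact h y hy x hx z hz t ht
lemma Z.p23 {a b c e : V} (h : D.Z a b c e) : D.Z a c b e := by
  intro x hx y hy z hz t ht; rw [T4_23]; exact h x hx z hz y hy t ht
lemma Z.p34 {a b c e : V} (h : D.Z a b c e) : D.Z a b e c := by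
  intro x hx y hy z hz t ht; rw [T4_34]; exact h x hx y hy t ht z hz

lemma eq_zero_of_G {A : Module.End ℂ L} (h : ∀ δ, ∀ z ∈ D.G δ, A z = 0) : A = 0 := by
  have h1 : D.cartan.toSubmodule ⊔ (⨆ α ∈ D.roots, D.rs α) ≤ LinearMap.ker A := by
    refine sup_le ?_ (iSup₂_le ?_)
    · intro z hz
      rw [LinearMap.mem_ker]; exact h 0 z (by rw [G_zero]; exact hz)
    · intro α hα z hz
      rw [LinearMap.mem_ker]; exact h α z (by rw [G_root hα]; exact hz)
  rw [D.sup_eq_top] at h1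
  ext z
  exact h1 (Submodule.mem_top (x := z))

lemma Z_of_NP {a b c e : V} (ha : a ∈ D.roots) (hb : b ∈ D.roots) (hc : c ∈ D.roots)
    (he : e ∈ D.roots) (h : D.toRootSystemData.NP a b c e) : D.Z a b c e := by
  intro x hx y hy z hz t ht
  apply eq_zero_of_G (D := D)
  intro δ v hv
  have h1 := (hom_ad ha hx).s4 (hom_ad hb hy) (hom_ad hc hz) (hom_ad he ht) δ v hv
  by_cases k1 : δ ∈ D.roots ∨ δ = 0
  · by_cases k2 : a + (b + (c + e)) + δ ∈ D.roots ∨ a + (b + (c + e)) + δ = 0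
    · exact (h δ _ k1 k2 (by abel)).elim
    · push Not at k2
      rw [G_bot k2.1 k2.2, Submodule.mem_bot] at h1
      exact h1
  · push Not at k1
    rw [G_bot k1.1 k1.2, Submodule.mem_bot] at hv
    rw [hv, map_zero]

lemma rs_span {α : V} (h : α ∈ D.roots) {x : L} (hx : x ∈ D.rs α) (hx0 : x ≠ 0) {y : L}
    (hy : y ∈ D.rs α) : ∃ c : ℂ, y = c • x := by
  have := (finrank_eq_one_iff_of_nonzero' (⟨x, hx⟩ : D.rs α) (by
    intro h; exact hx0 (congrArg Subtype.val h))).mp (D.rs_dim α h) ⟨y, hy⟩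
  obtain ⟨c, hc⟩ := this
  exact ⟨c, (congrArg Subtype.val hc).symm⟩

lemma Z_of_span {a b c e : V} (ha : a ∈ D.roots) (hb : b ∈ D.roots) (hc : c ∈ D.roots)
    {x y z : L} (hx : x ∈ D.rs a) (hy : y ∈ D.rs b) (hz : z ∈ D.rs c)
    (hx0 : x ≠ 0) (hy0 : y ≠ 0) (hz0 : z ≠ 0) (h : ∀ t ∈ D.rs e, T4 x y z t = 0) : D.Z a b c e := by
  intro x' hx' y' hy' z' hz' t ht
  obtain ⟨r, rfl⟩ := rs_span ha hx hx0 hx'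
  obtain ⟨s, rfl⟩ := rs_span hb hy hy0 hy'
  obtain ⟨u, rfl⟩ := rs_span hc hz hz0 hz'
  rw [T4_smul1, T4_smul2, T4_smul3, h t ht, smul_zero, smul_zero, smul_zero]

lemma M1 {a b k : V} (ha : a ∈ D.roots) (hb : b ∈ D.roots) (hk : k ∈ D.roots)
    (hθ : b - a ∈ D.roots) (h : D.Z a a a k) (h1 : (b - a) + k ∉ D.roots) (h2 : (b - a) + k ≠ 0) :
    D.Z a a b k := by
  obtain ⟨x, hx, hx0⟩ := D.exists_rs ha
  obtain ⟨e, he, he0⟩ := D.exists_rs hθ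
  have hs : b - a + a = b := by abel
  have hy := D.bracket_mem _ hθ _ ha (by rwa [hs]) e he x hx
  have hy0 := D.bracket_ne_zero _ hθ _ ha (by rwa [hs]) e he he0 x hx hx0
  rw [hs] at hy
  refine Z_of_span ha ha hb hx hx hy hx0 hx0 hy0 ?_
  intro t ht
  have := T4_der e x x x t (h x hx x hx x hx t ht)
  rw [D.bracket_eq_zero _ hθ _ hk h1 h2 e he t ht, T4_zero4, T4_12, T4_23 x ⁅e, x⁆] at this
  have h3 : (3 : ℂ) • T4 x x ⁅e, x⁆ t = 0 := by
    rw [← this]; module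
  exact (smul_eq_zero.mp h3).resolve_left (by norm_num)

lemma M2 {a b k k' : V} (ha : a ∈ D.roots) (hb : b ∈ D.roots) (hk : k ∈ D.roots)
    (hθ : b - a ∈ D.roots) (h : D.Z a a k k') (h1 : (b - a) + k ∉ D.roots) (h2 : (b - a) + k ≠ 0)
    (h3 : ∀ e ∈ D.rs (b - a), ∀ x ∈ D.rs a, ∀ y ∈ D.rs k, ∀ t ∈ D.rs k', T4 x x y ⁅e, t⁆ = 0) :
    D.Z a b k k' := by
  obtain ⟨x, hx, hx0⟩ := D.exists_rs ha
  obtain ⟨e, he, he0⟩ := D.exists_rs hθ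
  obtain ⟨z, hz, hz0⟩ := D.exists_rs hk
  have hs : b - a + a = b := by abel
  have hy := D.bracket_mem _ hθ _ ha (by rwa [hs]) e he x hx
  have hy0 := D.bracket_ne_zero _ hθ _ ha (by rwa [hs]) e he he0 x hx hx0
  rw [hs] at hy
  refine Z_of_span ha hb hk hx hy hz hx0 hy0 hz0 ?_
  intro t ht
  have := T4_der e x x z t (h x hx x hx z hz t ht)
  rw [D.bracket_eq_zero _ hθ _ hk h1 h2 e he z hz, T4_zero3, T4_12, h3 e he x hx z hz t ht] at this
  have h3 : (2 : ℂ) • T4 x ⁅e, x⁆ z t = 0 := by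
    rw [← this]; module
  exact (smul_eq_zero.mp h3).resolve_left (by norm_num)

end LieRootData



namespace LieRootData

open RootSystemData

variable {L : Type*} [LieRing L] [LieAlgebra ℂ L] {D : LieRootData V L}
variable {S : Set V} {p q : V →ₗ[ℝ] ℝ} {N : ℝ}

lemma nonroot (hN : D.Scale N) {a b k : V}
    (ha : ⟪a, a⟫ = N) (hb : ⟪b, b⟫ = N) (hk : ⟪k, k⟫ = N)
    (h : 0 ≤ ⟪b, k⟫ - ⟪a, k⟫ - ⟪a, b⟫) : (b - a) + k ∉ D.roots ∧ (b - a) + k ≠ 0 := by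
  apply no_root_of hN
  simp only [inner_add_left, inner_sub_left, inner_add_right, inner_sub_right]
  rw [real_inner_comm a b, real_inner_comm a k, real_inner_comm b k]
  linarith [hN.1]

lemma Z_eq1 (hN : D.Scale N) (h : Good D.toRootSystemData S p q) {a c e : V} (ha : a ∈ S)
    (hc : c ∈ S) (he : e ∈ S) (la : zq N a a = 2) (lc : zq N c c = 2)
    (le : zq N e e = 2) (ac : zq N a c = 0) (ae : zq N a e = 0) (hr : a + c ∈ D.roots) :
    D.Z a a c e := by
  have ra := h.root ha
  have rc := h.root hc
  have re := h.root he
  have ac' : ⟪a, c⟫ = 0 := by simpa using inner_zq hN ra rc ac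
  have ae' : ⟪a, e⟫ = 0 := by simpa using inner_zq hN ra re ae
  obtain ⟨h1, h2⟩ := nonroot hN (a := a) (b := c) (k := e)
    (by rw [inner_zq hN ra ra la]; push_cast; ring) (by rw [inner_zq hN rc rc lc]; push_cast; ring)
    (by rw [inner_zq hN re re le]; push_cast; ring) (by rw [ac', ae']; linarith [h.nn c hc e he])
  exact M1 ra rc re (diff_root ra ac' hr)
    (Z_of_NP ra ra ra re (h.np_aaa hN ha he la le)) h1 h2

lemma Z_eq (hN : D.Scale N) (h : Good D.toRootSystemData S p q) {a c e : V} (ha : a ∈ S)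
    (hc : c ∈ S) (he : e ∈ S) (la : zq N a a = 2) (lc : zq N c c = 2)
    (le : zq N e e = 2) : D.Z a a c e := by
  rcases h.cls_eq hN ha hc he la lc le with h1 | ⟨ac, ae, hr | hr⟩
  · exact Z_of_NP (h.root ha) (h.root ha) (h.root hc) (h.root he) h1
  · exact Z_eq1 hN h ha hc he la lc le ac ae hr
  · exact (Z_eq1 hN h ha he hc la le lc ae ac hr).p34

lemma Z_orth (hN : D.Scale N) (h : Good D.toRootSystemData S p q) {a b c e : V} (ha : a ∈ S)
    (hb : b ∈ S) (hc : c ∈ S) (he : e ∈ S) (la : zq N a a = 2) (lb : zq N b b = 2)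
    (lc : zq N c c = 2) (le : zq N e e = 2) (ab : zq N a b = 0) (ac : zq N a c = 0)
    (ae : zq N a e = 0) (hr : a + b ∈ D.roots) : D.Z a b c e := by
  have ra := h.root ha
  have rb := h.root hb
  have rc := h.root hc
  have re := h.root he
  have aa : ⟪a, a⟫ = N := by rw [inner_zq hN ra ra la]; push_cast; ring
  have bb : ⟪b, b⟫ = N := by rw [inner_zq hN rb rb lb]; push_cast; ring
  have cc : ⟪c, c⟫ = N := by rw [inner_zq hN rc rc lc]; push_cast; ring
  have ee : ⟪e, e⟫ = N := by rw [inner_zq hN re re le]; push_cast; ring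
  have ab' : ⟪a, b⟫ = 0 := by simpa using inner_zq hN ra rb ab
  have ac' : ⟪a, c⟫ = 0 := by simpa using inner_zq hN ra rc ac
  have ae' : ⟪a, e⟫ = 0 := by simpa using inner_zq hN ra re ae
  obtain ⟨h1, h2⟩ := nonroot hN aa bb cc (by rw [ab', ac']; linarith [h.nn b hb c hc])
  obtain ⟨h3, h4⟩ := nonroot hN aa bb ee (by rw [ab', ae']; linarith [h.nn b hb e he])
  have hθ := diff_root ra ab' hr
  refine M2 ra rb rc hθ (Z_eq hN h ha hc he la lc le) h1 h2 ?_
  intro u hu x hx y hy t ht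
  rw [D.bracket_eq_zero _ hθ _ re h3 h4 u hu t ht, T4_zero4]

lemma Z_cyc (hG : D.NotG2) (hN : D.Scale N) (h : Good D.toRootSystemData S p q) {a b c e : V}
    (ha : a ∈ S)
    (hb : b ∈ S) (hc : c ∈ S) (he : e ∈ S) (la : zq N a a = 2) (lb : zq N b b = 2)
    (lc : zq N c c = 2) (le : zq N e e = 2) (ac : zq N a c = 0) (be : zq N b e = 0)
    (ab : zq N a b = 1) (bc : zq N b c = 1) (ce : zq N c e = 1) (ae : zq N a e = 1) :
    D.Z a b c e := by
  have ra := h.root ha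
  have rb := h.root hb
  have rc := h.root hc
  have re := h.root he
  have hNN := hN.1
  have aa : ⟪a, a⟫ = N := by rw [inner_zq hN ra ra la]; push_cast; ring
  have bb : ⟪b, b⟫ = N := by rw [inner_zq hN rb rb lb]; push_cast; ring
  have cc : ⟪c, c⟫ = N := by rw [inner_zq hN rc rc lc]; push_cast; ring
  have ee : ⟪e, e⟫ = N := by rw [inner_zq hN re re le]; push_cast; ring
  have ac' : ⟪a, c⟫ = 0 := by simpa using inner_zq hN ra rc ac
  have be' : ⟪b, e⟫ = 0 := by simpa using inner_zq hN rb re be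
  have ab' : ⟪a, b⟫ = N / 2 := by rw [inner_zq hN ra rb ab]; push_cast; ring
  have bc' : ⟪b, c⟫ = N / 2 := by rw [inner_zq hN rb rc bc]; push_cast; ring
  have ce' : ⟪c, e⟫ = N / 2 := by rw [inner_zq hN rc re ce]; push_cast; ring
  have ae' : ⟪a, e⟫ = N / 2 := by rw [inner_zq hN ra re ae]; push_cast; ring
  have hs : b - a + e = c := by
    rw [← sub_eq_zero]
    apply eq_zero_of_inner
    simp only [inner_add_left, inner_sub_left, inner_add_right, inner_sub_right]
    rw [real_inner_comm a b, real_inner_comm a c, real_inner_comm a e, real_inner_comm b c,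
      real_inner_comm b e, real_inner_comm c e, aa, bb, cc, ee, ac', be', ab', bc', ce', ae']
    linarith
  have hθ : b - a ∈ D.roots := D.toRootSystemData.sub_mem hG rb ra
    (by rintro rfl; linarith) (by rw [real_inner_comm]; linarith)
  obtain ⟨h1, h2⟩ := nonroot hN aa bb cc (by linarith)
  refine M2 ra rb rc hθ (Z_eq hN h ha hc he la lc le) h1 h2 ?_
  intro u hu x hx y hy t ht
  have := D.bracket_mem _ hθ _ re (by rwa [hs]) u hu t ht
  rw [hs] at this
  exact Z_eq hN h ha hc hc la lc lc x hx x hx y hy _ this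

lemma Z_all (hG : D.NotG2) (hN : D.Scale N) (h : Good D.toRootSystemData S p q) {a b c e : V}
    (ha : a ∈ S) (hb : b ∈ S) (hc : c ∈ S) (he : e ∈ S) : D.Z a b c e := by
  have ra := h.root ha
  have rb := h.root hb
  have rc := h.root hc
  have re := h.root he
  rcases zq_self hN ra with la | la
  swap
  · exact Z_of_NP ra rb rc re ((h.np_long hN hb hc he ha la).perm (by abel))
  rcases zq_self hN rb with lb | lb
  swap
  · exact Z_of_NP ra rb rc re ((h.np_long hN ha hc he hb lb).perm (by abel))
  rcases zq_self hN rc with lc | lc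
  swap
  · exact Z_of_NP ra rb rc re ((h.np_long hN ha hb he hc lc).perm (by abel))
  rcases zq_self hN re with le | le
  swap
  · exact Z_of_NP ra rb rc re (h.np_long hN ha hb hc he le)
  by_cases ab : a = b
  · subst ab; exact Z_eq hN h ha hc he la lc le
  by_cases ac : a = c
  · subst ac; exact (Z_eq hN h ha hb he la lb le).p23
  by_cases ae : a = e
  · subst ae; exact (Z_eq hN h ha hb hc la lb lc).p23.p34
  by_cases bc : b = c
  · subst bc; exact (Z_eq hN h hb ha he lb la le).p23.p12
  by_cases be : b = e
  · subst be; exact (Z_eq hN h hb ha hc lb la lc).p23.p12.p34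
  by_cases ce : c = e
  · subst ce; exact (Z_eq hN h hc ha hb lc la lb).p23.p12.p34.p23
  rcases h.cls_ne hN ha hb hc he la lb lc le ab ac ae bc be ce with h1 |
    ⟨zab, zac, zae, zbc, zbe, zce, h1⟩ | ⟨z1, z2, z3, z4, z5, z6⟩ | ⟨z1, z2, z3, z4, z5, z6⟩ |
    ⟨z1, z2, z3, z4, z5, z6⟩
  · exact Z_of_NP ra rb rc re h1
  · have zcb : zq N c b = 0 := by rw [zq_comm, zbc]
    have zba : zq N b a = 0 := by rw [zq_comm, zab]
    have zca : zq N c a = 0 := by rw [zq_comm, zac]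
    rcases h1 with h1 | h1 | h1 | h1 | h1 | h1
    · exact Z_orth hN h ha hb hc he la lb lc le zab zac zae h1
    · exact (Z_orth hN h ha hc hb he la lc lb le zac zab zae h1).p23
    · exact (Z_orth hN h ha he hb hc la le lb lc zae zab zac h1).p23.p34
    · exact (Z_orth hN h hb hc ha he lb lc la le zbc zba zbe h1).p23.p12
    · exact (Z_orth hN h hb he ha hc lb le la lc zbe zba zbc h1).p23.p12.p34
    · exact (Z_orth hN h hc he ha hb lc le la lb zce zca zcb h1).p23.p12.p34.p23
  · exact Z_cyc hG hN h ha hb hc he la lb lc le z1 z2 z3 z4 z5 z6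
  · -- opposite pairs: a,b and c,e
    exact (Z_cyc hG hN h ha hc hb he la lc lb le z1 z2 z3 (by rw [zq_comm]; exact z4) z5 z6).p23
  · -- opposite pairs: a,e and b,c
    exact (Z_cyc hG hN h ha hb he hc la lb le lc z1 z2 z3 z4 (by rw [zq_comm]; exact z5) z6).p34

lemma T4_vanish (hS : ∀ a ∈ S, ∀ b ∈ S, ∀ c ∈ S, ∀ e ∈ S, D.Z a b c e) {x : L}
    (hx : x ∈ D.aSubspace S) : T4 x x x x = 0 := by
  have lin : ∀ b c e : L, (∀ α ∈ S, ∀ y ∈ D.rs α, T4 y b c e = 0) →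
      ∀ y ∈ D.aSubspace S, T4 y b c e = 0 := by
    intro b c e h y hy
    let K : Submodule ℂ L :=
      { carrier := {y | T4 y b c e = 0}
        add_mem' := by
          intro u v hu hv
          simp only [Set.mem_setOf_eq] at *
          rw [T4_add1, hu, hv, add_zero]
        zero_mem' := by
          have := T4_smul1 0 0 b c e
          simpa using this
        smul_mem' := by
          intro r u hu
          simp only [Set.mem_setOf_eq] at *
          rw [T4_smul1, hu, smul_zero] }
    have : D.aSubspace S ≤ K := iSup₂_le fun α hα y hy => h α hα y hy
    exact this hy
  have step1 : ∀ a ∈ S, ∀ b ∈ S, ∀ c ∈ S, ∀ u ∈ D.rs a, ∀ v ∈ D.rs b, ∀ t ∈ D.rs c,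
      ∀ y ∈ D.aSubspace S, T4 y u v t = 0 := by
    intro a ha b hb c hc u hu v hv t ht
    exact lin u v t fun α hα y hy => hS α hα a ha b hb c hc y hy u hu v hv t ht
  have step2 : ∀ b ∈ S, ∀ c ∈ S, ∀ v ∈ D.rs b, ∀ t ∈ D.rs c, ∀ y ∈ D.aSubspace S,
      T4 y x v t = 0 := by
    intro b hb c hc v hv t ht
    exact lin x v t fun α hα y hy => by
      rw [T4_12]; exact step1 α hα b hb c hc y hy v hv t ht x hx
  have step3 : ∀ c ∈ S, ∀ t ∈ D.rs c, ∀ y ∈ D.aSubspace S, T4 y x x t = 0 := by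
    intro c hc t ht
    exact lin x x t fun α hα y hy => by
      rw [T4_12, T4_23]; exact step2 α hα c hc y hy t ht x hx
  exact lin x x x (fun α hα y hy => by
      rw [T4_12, T4_23, T4_34]; exact step3 α hα y hy x hx) x hx

lemma spherical_of_nn (D : LieRootData V L) (hG : D.NotG2) (hI : D.IsIrreducible)
    {w : Module.End ℝ V} (hw : D.InWeyl w)
    (h : ∀ a ∈ D.inversions w, ∀ b ∈ D.inversions w, 0 ≤ ⟪a, b⟫) :
    IsSphericalSubspace (D.aSubspace (D.inversions w)) := by
  obtain ⟨N, hN⟩ := D.toRootSystemData.exists_scale hG hI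
  have good : Good D.toRootSystemData (D.inversions w) D.toRootSystemData.ht
      (-(D.toRootSystemData.ht ∘ₗ w)) := by
    refine ⟨fun γ => ?_, h⟩
    constructor
    · intro hγ
      have hr := D.toRootSystemData.inv_root hγ
      have := (D.toRootSystemData.mem_inv hG hw hr).mp hγ
      exact ⟨hr, this.1, by simpa using this.2⟩
    · rintro ⟨hr, h1, h2⟩
      exact (D.toRootSystemData.mem_inv hG hw hr).mpr ⟨h1, by simpa using h2⟩
  intro x hx
  exact T4_self x (T4_vanish (fun a ha b hb c hc e he => Z_all hG hN good ha hb hc he) hx)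

end LieRootData

/-- If `Φ` is irreducible and not of type `G₂` and `w ∈ W`, then
`w` is fully commutative if and only if `𝔞_w = ⊕_{α ∈ Φ(w)} 𝔤_α` is a spherical
subspace of `𝔫`, i.e. `ad(x)^4 = 0` for every `x ∈ 𝔞_w`. -/
theorem fullyCommutative_iff_spherical
    {V : Type*} [NormedAddCommGroup V] [InnerProductSpace ℝ V]
    {L : Type*} [LieRing L] [LieAlgebra ℂ L]
    (D : LieRootData V L)
    (hirr : D.toRootSystemData.IsIrreducible)
    (hG2 : D.toRootSystemData.NotG2)
    (w : Module.End ℝ V) (hw : D.toRootSystemData.InWeyl w) :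
    D.toRootSystemData.FullyCommutative w ↔
      IsSphericalSubspace (D.aSubspace (D.toRootSystemData.inversions w)) := by
  rw [D.toRootSystemData.fc_iff hG2 hw]
  constructor
  · exact D.spherical_of_nn hG2 hirr hw
  · intro hs a ha b hb
    by_contra hc
    push Not at hc
    exact D.not_sph hG2 hirr ha hb (fun x hx => hx.1) hc hs
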